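/- Let 𝒢_h be a HEG cellularly embedded in a punctured surface Σ (i.e. there is a regular embedding of its completed graph 𝒢̄ in Σ ∪ ∂Σ). Then the underlying graph 𝒢 of 𝒢_h is cellularly embedded in the punctured surface Σ: Σ − φ(𝒢) is a disjoint union of 2-cells possibly with punctures. -/

import Mathlib

/-! ## Surfaces, punctured surfaces and graph embeddings -/

noncomputable section
open scoped Classical

/-- The Euclidean plane. -/
abbrev Plane := EuclideanSpace ℝ (Fin 2)

/-- A subset of a topological space is a 2-cell if it is homeomorphic to an
open disc. -/
def IsTwoCell {X : Type} [TopologicalSpace X] (A : Set X) : Prop :=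
  Nonempty (A ≃ₜ (Metric.ball (0 : Plane) 1 : Set Plane))

/-- A subset is a 2-cell with punctures if it is homeomorphic to an open disc
with finitely many pairwise disjoint closed discs removed. -/
def IsPuncturedTwoCell {X : Type} [TopologicalSpace X] (A : Set X) : Prop :=
  ∃ (m : ℕ) (c : Fin m → Plane) (r : Fin m → ℝ),
    (∀ i, 0 < r i) ∧
    (∀ i, Metric.closedBall (c i) (r i) ⊆ Metric.ball (0 : Plane) 1) ∧
    (∀ i j, i ≠ j →
      Disjoint (Metric.closedBall (c i) (r i)) (Metric.closedBall (c j) (r j))) ∧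
    Nonempty (A ≃ₜ
      ((Metric.ball (0 : Plane) 1 \ ⋃ i, Metric.closedBall (c i) (r i)) : Set Plane))

/-- A closed surface: a compact connected Hausdorff space in which every point
has an open neighbourhood homeomorphic to an open disc. -/
def IsClosedSurface (X : Type) [TopologicalSpace X] : Prop :=
  CompactSpace X ∧ ConnectedSpace X ∧ T2Space X ∧
    ∀ x : X, ∃ U : Set X, IsOpen U ∧ x ∈ U ∧ IsTwoCell U

/-- A punctured surface: a closed connected compact surface `Total = Σ̃`
together with finitely many pairwise disjoint embedded closed discs (the
punctures).  The punctured surface `Σ` itself is `Total` minus the closed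
discs, `Σ ∪ ∂Σ` is `Total` minus the open discs, and `∂Σ` is the union of the
boundary circles of the discs; capping off the punctures gives back `Σ̃`. -/
structure PuncturedSurface where
  Total : Type
  [topo : TopologicalSpace Total]
  surf : IsClosedSurface Total
  n : ℕ
  cap : Fin n → (Metric.closedBall (0 : Plane) 1 : Set Plane) → Total
  capCont : ∀ i, Continuous (cap i)
  capInj : ∀ i, Function.Injective (cap i)
  capDisjoint : ∀ i j, i ≠ j → Disjoint (Set.range (cap i)) (Set.range (cap j))

attribute [instance] PuncturedSurface.topo

namespace PuncturedSurface

variable (S : PuncturedSurface)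

/-- The `i`-th removed closed disc. -/
def disc (i : Fin S.n) : Set S.Total := Set.range (S.cap i)

/-- The interior of the `i`-th removed disc. -/
def intDisc (i : Fin S.n) : Set S.Total := S.cap i '' {x | ‖(x : Plane)‖ < 1}

/-- The `i`-th boundary circle. -/
def bdCircle (i : Fin S.n) : Set S.Total := S.cap i '' {x | ‖(x : Plane)‖ = 1}

/-- The open punctured surface `Σ`. -/
def openPart : Set S.Total := Set.univ \ ⋃ i, S.disc i

/-- The surface with boundary `Σ ∪ ∂Σ`. -/
def withBoundary : Set S.Total := Set.univ \ ⋃ i, S.intDisc i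

/-- The boundary `∂Σ`. -/
def boundary : Set S.Total := ⋃ i, S.bdCircle i

/-- The union of the removed discs (the punctures). -/
def discs : Set S.Total := ⋃ i, S.disc i

end PuncturedSurface

/-- A finite multigraph: `ends e b` are the two end vertices of the edge `e`
(loops and parallel edges allowed). -/
structure Multigraph where
  V : Type
  E : Type
  vFin : Finite V
  eFin : Finite E
  ends : E → Bool → V

namespace Multigraph

variable (M : Multigraph)

/-- The disjoint union of the vertices and of one closed interval per edge. -/
def Pre : Type := M.V ⊕ (M.E × unitInterval)

instance : TopologicalSpace M.Pre :=
  letI : TopologicalSpace M.V := ⊥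
  letI : TopologicalSpace M.E := ⊥
  inferInstanceAs (TopologicalSpace (M.V ⊕ (M.E × unitInterval)))

/-- The gluing relation defining the topological realization: the two end
points of the interval of an edge are identified with its end vertices. -/
def glue : M.Pre → M.Pre → Prop := fun x y =>
  ∃ e b, x = Sum.inr (e, if b then 1 else 0) ∧ y = Sum.inl (M.ends e b)

/-- The topological realization `|M|` of the multigraph. -/
def Real : Type := Quot M.glue

instance : TopologicalSpace M.Real := inferInstanceAs (TopologicalSpace (Quot M.glue))

/-- The point of `|M|` corresponding to a vertex. -/
def vtx (v : M.V) : M.Real := Quot.mk _ (Sum.inl v)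

/-- The path in `|M|` corresponding to an edge. -/
def edgePath (e : M.E) (t : unitInterval) : M.Real := Quot.mk _ (Sum.inr (e, t))

end Multigraph

/-- A half-edge graph (HEG): a finite multigraph together with a finite set
`Hh` of half-edges, each incident to a unique vertex. -/
structure HEG where
  V : Type
  E : Type
  Hh : Type
  vFin : Finite V
  eFin : Finite E
  hFin : Finite Hh
  ends : E → Bool → V
  hInc : Hh → V

namespace HEG

variable (G : HEG)

/-- The underlying multigraph `𝒢` of a HEG (forget the half-edges). -/
def underlyingMG : Multigraph where
  V := G.V
  E := G.E
  vFin := G.vFin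
  eFin := G.eFin
  ends := G.ends

/-- The completed graph `𝒢̄(𝒱 ∪ 𝒱_h, ℰ ∪ h)` of a HEG: one new vertex is
added for each half-edge, and each half-edge `h` incident to `v₀` becomes an
edge joining `v₀` to its new vertex. -/
def completedMG : Multigraph where
  V := G.V ⊕ G.Hh
  E := G.E ⊕ G.Hh
  vFin := by haveI := G.vFin; haveI := G.hFin; exact inferInstance
  eFin := by haveI := G.eFin; haveI := G.hFin; exact inferInstance
  ends := fun e b => match e with
    | .inl e => .inl (G.ends e b)
    | .inr h => if b then .inr h else .inl (G.hInc h)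

/-- The natural inclusion `|𝒢| → |𝒢̄|` of the realization of the underlying
graph into the realization of the completed graph. -/
def inclReal : G.underlyingMG.Real → G.completedMG.Real :=
  Quot.map (Sum.map Sum.inl (fun p => (Sum.inl p.1, p.2))) (by
    rintro x y ⟨e, b, rfl, rfl⟩
    exact ⟨Sum.inl e, b, rfl, rfl⟩)

end HEG

/-- An embedding of a multigraph in a punctured surface whose image avoids the
open punctures and which decomposes the capped-off closed surface `Σ̃` into
2-cells. -/
structure CellEmbedding (M : Multigraph) (S : PuncturedSurface) where
  toFun : M.Real → S.Total
  emb : Topology.IsEmbedding toFun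
  range_subset : Set.range toFun ⊆ S.withBoundary
  cellular : ∀ x ∈ Set.univ \ Set.range toFun,
    IsTwoCell (connectedComponentIn (Set.univ \ Set.range toFun) x)

/-- A cell embedding is `W`-regular if the embedded graph meets the boundary
`∂Σ` exactly in the vertices of `W`. -/
def CellEmbedding.VRegular {M : Multigraph} {S : PuncturedSurface}
    (φ : CellEmbedding M S) (W : Set M.V) : Prop :=
  S.boundary ∩ Set.range φ.toFun = φ.toFun '' (M.vtx '' W)

/-- A regular embedding of (the completed graph of) a HEG `G` in `Σ ∪ ∂Σ`:
a `𝒱_h`-regular cell embedding of `𝒢̄`.  This is the datum of a HEG cellular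
embedding `G ⊂ Σ`. -/
structure RegularEmbedding (G : HEG) (S : PuncturedSurface) extends
    CellEmbedding G.completedMG S where
  regular : toCellEmbedding.VRegular (Set.range (Sum.inr : G.Hh → G.V ⊕ G.Hh))

section PlaneTopology

open scoped NNReal
open Set Metric Filter Topology

/-- `ζ - z` has a continuous logarithm on `T`. -/
def HasLog (T : Set ℂ) (z : ℂ) : Prop :=
  ∃ g : ℂ → ℂ, ContinuousOn g T ∧ ∀ ζ ∈ T, Complex.exp (g ζ) = ζ - z

/-- `z` can escape to infinity avoiding `T`. -/
def Esc (T : Set ℂ) (z : ℂ) : Prop :=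
  ∃ S : Set ℂ, IsPreconnected S ∧ z ∈ S ∧ Disjoint S T ∧ ¬ Bornology.IsBounded S

/-- The complement of `T` has no bounded component. -/
def Full (T : Set ℂ) : Prop := ∀ z ∉ T, Esc T z

theorem Esc.notMem {T : Set ℂ} {z : ℂ} (h : Esc T z) : z ∉ T := by
  obtain ⟨S, -, hz, hd, -⟩ := h
  exact fun hT => (disjoint_left.1 hd) hz hT

theorem Esc.mono {T T' : Set ℂ} {z : ℂ} (h : Esc T z) (hT : T' ⊆ T) : Esc T' z := by
  obtain ⟨S, hS, hz, hd, hb⟩ := h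
  exact ⟨S, hS, hz, hd.mono_right hT, hb⟩

theorem IsPreconnected.exp_eq_diff_const {α : Type*} [TopologicalSpace α] {S : Set α}
    (hS : IsPreconnected S) {f g : α → ℂ} (hf : ContinuousOn f S) (hg : ContinuousOn g S)
    (h : ∀ x ∈ S, Complex.exp (f x) = Complex.exp (g x)) :
    ∃ c : ℂ, Complex.exp c = 1 ∧ ∀ x ∈ S, f x = g x + c := by
  have : DiscreteTopology (AddSubgroup.zmultiples (2 * Real.pi * Complex.I) : Set ℂ) :=
    NormedSpace.discreteTopology_zmultiples (2 * Real.pi * Complex.I)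
  obtain ⟨c, hc, hfc⟩ := hS.eqOn_const_of_mapsTo
    (T := (AddSubgroup.zmultiples (2 * Real.pi * Complex.I) : Set ℂ)) ⟨this⟩ (hf.sub hg) (by
      intro x hx
      obtain ⟨n, hn⟩ := Complex.exp_eq_exp_iff_exists_int.1 (h x hx)
      simp only [Pi.sub_apply, SetLike.mem_coe, AddSubgroup.mem_zmultiples_iff]
      exact ⟨n, by rw [hn]; simp⟩) ⟨0, zero_mem _⟩
  refine ⟨c, ?_, fun x hx => ?_⟩
  · obtain ⟨n, rfl⟩ := AddSubgroup.mem_zmultiples_iff.1 hc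
    rw [Complex.exp_eq_one_iff]
    exact ⟨n, by simp⟩
  · have := hfc hx
    simp only [Pi.sub_apply, Function.const_apply] at this
    linear_combination this

theorem exists_continuous_log {F : ℂ → ℂ} (hF : Continuous F) (h0 : ∀ z, F z ≠ 0) :
    ∃ g : ℂ → ℂ, Continuous g ∧ ∀ z, Complex.exp (g z) = F z := by
  have hsc : IsSimplyConnected (univ : Set ℂ) := by
    have : ContractibleSpace (univ : Set ℂ) := (Homeomorph.Set.univ ℂ).contractibleSpace
    exact (inferInstance : SimplyConnectedSpace (univ : Set ℂ))
  obtain ⟨g, hg, hgF⟩ := Complex.exists_continuousOn_eqOn_exp_comp hsc isOpen_univ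
    hF.continuousOn (by rintro ⟨z, -, hz⟩; exact h0 z hz)
  exact ⟨g, continuousOn_univ.1 hg, fun z => hgF (mem_univ z)⟩

theorem not_log_near_infinity {g : ℂ → ℂ} (hg : Continuous g) (z : ℂ) (R : ℝ) (hR : 0 < R)
    (h : ∀ ζ, ‖ζ - z‖ = R → Complex.exp (g ζ) = ζ - z) : False := by
  have h1 : ∀ θ : ℝ, Complex.exp (g (z + R * Complex.exp (θ * Complex.I))) =
      Complex.exp (θ * Complex.I + Real.log R) := by
    intro θ
    rw [h]
    · rw [Complex.exp_add, ← Complex.ofReal_exp, Real.exp_log hR]; ring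
    · simp [Complex.norm_exp_ofReal_mul_I, abs_of_pos hR]
  obtain ⟨c, -, hc⟩ := (isPreconnected_univ (α := ℝ)).exp_eq_diff_const
    (f := fun θ : ℝ => g (z + R * Complex.exp (θ * Complex.I)))
    (g := fun θ : ℝ => θ * Complex.I + Real.log R) (by fun_prop) (by fun_prop)
    (fun θ _ => h1 θ)
  have h2 := hc 0 trivial
  have h3 := hc (2 * Real.pi) trivial
  simp only [Complex.ofReal_mul, Complex.ofReal_ofNat, Complex.exp_two_pi_mul_I,
    Complex.ofReal_zero, zero_mul, Complex.exp_zero] at h2 h3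
  rw [h2] at h3
  have h4 : (2 * Real.pi * Complex.I : ℂ) = 0 := by linear_combination -h3
  simp [Real.pi_ne_zero] at h4

theorem frontier_connectedComponentIn_subset {T : Set ℂ} (hT : IsClosed T) (z : ℂ) :
    frontier (connectedComponentIn Tᶜ z) ⊆ T := by
  intro a ha
  by_contra haT
  have hopen : IsOpen (connectedComponentIn Tᶜ z) := hT.isOpen_compl.connectedComponentIn
  have ho : IsOpen (connectedComponentIn Tᶜ a) := hT.isOpen_compl.connectedComponentIn
  have haa : a ∈ connectedComponentIn Tᶜ a := mem_connectedComponentIn haT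
  rw [hopen.frontier_eq] at ha
  obtain ⟨b, hb1, hb2⟩ := mem_closure_iff.1 ha.1 _ ho haa
  have e1 := connectedComponentIn_eq hb1
  have e2 := connectedComponentIn_eq hb2
  apply ha.2
  rw [e2, ← e1]; exact haa

theorem HasLog.esc {T : Set ℂ} (hT : IsCompact T) {z : ℂ} (hz : z ∉ T) (h : HasLog T z) :
    Esc T z := by
  obtain ⟨g, hg, hge⟩ := h
  set Q := connectedComponentIn Tᶜ z with hQ
  have hzQ : z ∈ Q := mem_connectedComponentIn hz
  refine ⟨Q, isPreconnected_connectedComponentIn, hzQ,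
    disjoint_left.2 fun x hx => connectedComponentIn_subset _ _ hx, fun hb => ?_⟩
  obtain ⟨G, hG⟩ := ContinuousMap.exists_restrict_eq hT.isClosed
    ⟨T.domRestrict g, continuousOn_iff_continuous_domRestrict.1 hg⟩
  have hG' : ∀ ζ ∈ T, G ζ = g ζ := fun ζ hζ => by
    have := congrArg (fun f => f ⟨ζ, hζ⟩) hG
    simpa using this
  set F : ℂ → ℂ := fun ζ => if ζ ∈ Q then Complex.exp (G ζ) else ζ - z with hF
  have hFc : Continuous F := by
    apply Continuous.if
    · intro a ha
      have := frontier_connectedComponentIn_subset hT.isClosed z ha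
      rw [hG' a this, hge a this]
    · fun_prop
    · fun_prop
  have hF0 : ∀ ζ, F ζ ≠ 0 := by
    intro ζ
    by_cases hζ : ζ ∈ Q
    · simp [hF, hζ]
    · simp only [hF, hζ, if_false, ne_eq, sub_eq_zero]
      rintro rfl; exact hζ hzQ
  obtain ⟨l, hl, hlF⟩ := exists_continuous_log hFc hF0
  obtain ⟨R, hR⟩ := hb.subset_ball z
  refine not_log_near_infinity hl z (max R 1) (by positivity) fun ζ hζ => ?_
  rw [hlF]
  have : ζ ∉ Q := fun hq => by
    have := hR hq
    rw [mem_ball, dist_eq_norm, hζ] at this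
    exact absurd (le_max_left R 1) (not_le.2 this)
  simp [hF, this]

theorem HasLog.move {T : Set ℂ} {w w' : ℂ} (hw : ∀ ζ ∈ T, ‖w - w'‖ < ‖ζ - w‖)
    (h : HasLog T w) : HasLog T w' := by
  obtain ⟨g, hg, hge⟩ := h
  have hne : ∀ ζ ∈ T, ζ - w ≠ 0 := fun ζ hζ h0 => by
    have := hw ζ hζ
    rw [h0, norm_zero] at this
    exact absurd (norm_nonneg _) (not_le.2 this)
  have hs : ∀ ζ ∈ T, 1 + (w - w') / (ζ - w) ∈ Complex.slitPlane := fun ζ hζ => by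
    apply Complex.mem_slitPlane_of_norm_lt_one
    rw [norm_div, div_lt_one (norm_pos_iff.2 (hne ζ hζ))]
    exact hw ζ hζ
  refine ⟨fun ζ => g ζ + Complex.log (1 + (w - w') / (ζ - w)), hg.add ?_, fun ζ hζ => ?_⟩
  · apply ContinuousOn.clog _ hs
    exact continuousOn_const.add (continuousOn_const.div (by fun_prop) hne)
  · rw [Complex.exp_add, hge ζ hζ, Complex.exp_log (Complex.slitPlane_ne_zero (hs ζ hζ))]
    field_simp [hne ζ hζ]
    ring

theorem Esc.hasLog {T : Set ℂ} (hT : IsCompact T) {z : ℂ} (h : Esc T z) : HasLog T z := by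
  obtain ⟨S, hS, hz, hd, hb⟩ := h
  rcases T.eq_empty_or_nonempty with rfl | hne
  · exact ⟨0, continuousOn_empty _, by simp⟩
  obtain ⟨R, hR⟩ := hT.isBounded.subset_ball 0
  have : ¬ S ⊆ closedBall 0 (max R 1) := fun hs => hb (isBounded_closedBall.subset hs)
  obtain ⟨w, hwS, hw⟩ := not_subset.1 this
  have hwn : max R 1 < ‖w‖ := by simpa using hw
  have hw0 : w ≠ 0 := by
    rintro rfl
    rw [norm_zero] at hwn
    exact absurd (le_max_right R 1) (by linarith)
  have hwlog : HasLog T w := by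
    have hs : ∀ ζ ∈ T, 1 + (-(ζ / w)) ∈ Complex.slitPlane := fun ζ hζ => by
      apply Complex.mem_slitPlane_of_norm_lt_one
      rw [norm_neg, norm_div, div_lt_one (norm_pos_iff.2 hw0)]
      have : ‖ζ‖ < R := by simpa using hR hζ
      exact (this.trans_le (le_max_left _ _)).trans hwn
    refine ⟨fun ζ => Complex.log (-w) + Complex.log (1 + (-(ζ / w))),
      continuousOn_const.add (ContinuousOn.clog (by fun_prop) hs), fun ζ hζ => ?_⟩
    rw [Complex.exp_add, Complex.exp_log (neg_ne_zero.2 hw0),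
      Complex.exp_log (Complex.slitPlane_ne_zero (hs ζ hζ))]
    field_simp
    ring
  refine hS.induction₂' (fun a b => HasLog T a → HasLog T b) (fun a ha => ?_)
    (fun a b c _ _ _ hab hbc => hbc ∘ hab) hwS hz hwlog
  have haT : a ∉ T := fun h => disjoint_left.1 hd ha h
  have hdpos : 0 < infDist a T := (hT.isClosed.notMem_iff_infDist_pos hne).1 haT
  refine eventually_nhdsWithin_of_eventually_nhds ?_
  filter_upwards [ball_mem_nhds a (half_pos hdpos)] with b hb'
  have hab : ‖a - b‖ < infDist a T / 2 := by
    rw [mem_ball, dist_comm, dist_eq_norm] at hb'; exact hb'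
  have key : ∀ ζ ∈ T, infDist a T ≤ ‖ζ - a‖ := fun ζ hζ => by
    rw [← dist_eq_norm, dist_comm]; exact infDist_le_dist_of_mem hζ
  constructor
  · exact HasLog.move fun ζ hζ => by linarith [key ζ hζ]
  · refine HasLog.move fun ζ hζ => ?_
    have h1 := key ζ hζ
    have h2 : ‖ζ - a‖ ≤ ‖ζ - b‖ + ‖a - b‖ := by
      calc ‖ζ - a‖ = ‖(ζ - b) - (a - b)‖ := by ring_nf
        _ ≤ _ := norm_sub_le _ _
    rw [norm_sub_rev b a]; linarith

/-- Janiszewski's theorem. -/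
theorem Esc.union {X Z : Set ℂ} (hX : IsCompact X) (hZ : IsCompact Z)
    (hXZ : IsPreconnected (X ∩ Z)) {z : ℂ} (h1 : Esc X z) (h2 : Esc Z z) : Esc (X ∪ Z) z := by
  have hz : z ∉ X ∪ Z := fun h => h.elim h1.notMem h2.notMem
  obtain ⟨f, hf, hfe⟩ := h1.hasLog hX
  obtain ⟨g, hg, hge⟩ := h2.hasLog hZ
  obtain ⟨c, hc, hfg⟩ := hXZ.exp_eq_diff_const (hf.mono inter_subset_left)
    (hg.mono inter_subset_right) (fun x hx => by rw [hfe x hx.1, hge x hx.2])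
  refine HasLog.esc (hX.union hZ) hz ⟨fun ζ => if ζ ∈ X then f ζ else g ζ + c, ?_, ?_⟩
  · apply ContinuousOn.union_of_isClosed _ _ hX.isClosed hZ.isClosed
    · exact hf.congr fun x hx => by simp [hx]
    · exact (hg.add (continuousOn_const (c := c))).congr fun x hx => by
        by_cases hxX : x ∈ X
        · simp [hxX, hfg x ⟨hxX, hx⟩]
        · simp [hxX]
  · rintro ζ hζ
    by_cases hζX : ζ ∈ X
    · simp [hζX, hfe ζ hζX]
    · have hζZ : ζ ∈ Z := hζ.resolve_left hζX
      simp [hζX, Complex.exp_add, hc, hge ζ hζZ]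

/-- A compact continuous image of the plane admitting a continuous section has a connected
complement. -/
theorem Full.of_section {T : Set ℂ} (hT : IsCompact T) (e σ : ℂ → ℂ) (he : Continuous e)
    (heT : ∀ z, e z ∈ T) (hσ : ContinuousOn σ T) (hes : ∀ x ∈ T, e (σ x) = x) : Full T := by
  intro z hz
  obtain ⟨g, hg, hge⟩ := exists_continuous_log (F := fun w => e w - z) (by fun_prop)
    (fun w h => hz (by rw [← sub_eq_zero.1 h]; exact heT w))
  exact HasLog.esc hT hz ⟨g ∘ σ, hg.comp_continuousOn hσ, fun ζ hζ => by
    simp [hge, hes ζ hζ]⟩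

theorem Esc.of_isPreconnected {T S : Set ℂ} {z w : ℂ} (hS : IsPreconnected S) (hz : z ∈ S)
    (hw : w ∈ S) (hd : Disjoint S T) (h : Esc T w) : Esc T z := by
  obtain ⟨S', hS', hw', hd', hb⟩ := h
  exact ⟨S ∪ S', hS.union w hw hw' hS', Or.inl hz, hd.union_left hd',
    fun h => hb (h.subset subset_union_right)⟩

theorem Esc.of_norm_lt {T : Set ℂ} {R : ℝ} (hR : T ⊆ closedBall 0 R) {z : ℂ} (hz0 : z ≠ 0)
    (hz : R < ‖z‖) : Esc T z := by
  refine ⟨(fun t : ℝ => (t : ℂ) * z) '' Ici 1, isPreconnected_Ici.image _ (by fun_prop),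
    ⟨1, by simp, by simp⟩, ?_, fun hb => ?_⟩
  · rw [disjoint_left]
    rintro _ ⟨t, ht, rfl⟩ hT
    have h1 : ‖(t : ℂ) * z‖ ≤ R := by simpa using hR hT
    have ht1 : (1 : ℝ) ≤ t := ht
    rw [norm_mul, Complex.norm_real, Real.norm_of_nonneg (by linarith)] at h1
    nlinarith [norm_nonneg z]
  · obtain ⟨C, hC⟩ := hb.subset_closedBall 0
    have hzp : 0 < ‖z‖ := norm_pos_iff.2 hz0
    have h1 : (((|C| + 1) / ‖z‖ + 1 : ℝ) : ℂ) * z ∈ closedBall (0 : ℂ) C :=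
      hC ⟨_, by simp only [mem_Ici]; linarith [show 0 ≤ (|C| + 1) / ‖z‖ by positivity], rfl⟩
    rw [mem_closedBall, dist_zero_right, norm_mul, Complex.norm_real,
      Real.norm_of_nonneg (by positivity), add_mul, div_mul_cancel₀ _ hzp.ne'] at h1
    linarith [le_abs_self C]

theorem Esc.exists_dist {T : Set ℂ} (hT : IsCompact T) (hne : T.Nonempty) {w : ℂ} (h : Esc T w) :
    ∃ δ > 0, ∃ N ∈ 𝓝 w, ∀ z ∈ N, Esc {y | infDist y T ≤ δ} z := by
  obtain ⟨R, hR⟩ := hT.isBounded.subset_closedBall 0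
  set Q := connectedComponentIn Tᶜ w with hQ
  have hQo : IsOpen Q := hT.isClosed.isOpen_compl.connectedComponentIn
  have hwT : w ∈ Tᶜ := h.notMem
  obtain ⟨S, hS, hz, hd, hb⟩ := h
  have hSQ : S ⊆ Q := hS.subset_connectedComponentIn hz (disjoint_left.1 hd)
  have : ¬ S ⊆ closedBall 0 (max (R + 1) 1) := fun hs => hb (isBounded_closedBall.subset hs)
  obtain ⟨w', hwS, hw'⟩ := not_subset.1 this
  have hwn : max (R + 1) 1 < ‖w'‖ := by simpa using hw'
  have hw0 : w' ≠ 0 := by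
    rintro rfl
    rw [norm_zero] at hwn
    exact absurd (le_max_right (R + 1) 1) (by linarith)
  have hpc : IsPathConnected Q := hQo.isConnected_iff_isPathConnected.1
    (isConnected_connectedComponentIn_iff.2 hwT)
  obtain ⟨γ, hγ⟩ := hpc.joinedIn w (hSQ hz) w' (hSQ hwS)
  have hcomp : IsCompact (range γ) := isCompact_range γ.continuous
  have hcont : ContinuousOn (fun y => infDist y T) (range γ) := (continuous_infDist_pt T).continuousOn
  obtain ⟨y, ⟨t, rfl⟩, hy⟩ := hcomp.exists_isMinOn ⟨w, 0, by simp⟩ hcont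
  have hpos : ∀ x, x ∉ T → 0 < infDist x T := fun x hx =>
    (hT.isClosed.notMem_iff_infDist_pos hne).1 hx
  have h1 := hpos (γ t) (connectedComponentIn_subset _ _ (hγ t))
  have h2 := hpos w hwT
  set δ := min (min (infDist (γ t) T / 2) (infDist w T / 4)) 1 with hδ
  have hδ1 : δ ≤ infDist (γ t) T / 2 := (min_le_left _ _).trans (min_le_left _ _)
  have hδ2 : δ ≤ infDist w T / 4 := (min_le_left _ _).trans (min_le_right _ _)
  have hδ3 : δ ≤ 1 := min_le_right _ _
  have hδ0 : 0 < δ := by positivity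
  refine ⟨δ, hδ0, ball w (infDist w T / 2), ball_mem_nhds _ (by positivity), fun z hz => ?_⟩
  have e1 : Esc {y | infDist y T ≤ δ} w' := by
    refine Esc.of_norm_lt (R := R + 1) (fun y hy => ?_) hw0 ((le_max_left _ _).trans_lt hwn)
    obtain ⟨x, hx, hxy⟩ := hT.exists_infDist_eq_dist hne y
    have : dist x 0 ≤ R := hR hx
    have hy' : infDist y T ≤ δ := hy
    rw [mem_closedBall]
    linarith [dist_triangle y x 0]
  have e2 : Esc {y | infDist y T ≤ δ} w := by
    refine Esc.of_isPreconnected (isPreconnected_range γ.continuous) ⟨0, by simp⟩ ⟨1, by simp⟩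
      (disjoint_left.2 ?_) e1
    intro x hx hx'
    have h3 : infDist (γ t) T ≤ infDist x T := hy hx
    have h4 : infDist x T ≤ δ := hx'
    linarith
  refine Esc.of_isPreconnected (convex_ball w (infDist w T / 2)).isPreconnected hz
    (mem_ball_self (by positivity)) (disjoint_left.2 ?_) e2
  intro x hx hx'
  have h4 : infDist x T ≤ δ := hx'
  have h5 : infDist w T ≤ infDist x T + dist w x := infDist_le_infDist_add_dist
  rw [mem_ball, dist_comm] at hx
  linarith

theorem Full.exists_dist {T : Set ℂ} (hT : IsCompact T) (hne : T.Nonempty) (hfull : Full T)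
    {ε : ℝ} (hε : 0 < ε) :
    ∃ δ > 0, ∀ z, ε ≤ infDist z T → Esc {y | infDist y T ≤ δ} z := by
  obtain ⟨R, hR⟩ := hT.isBounded.subset_closedBall 0
  have hK : IsCompact ({z : ℂ | ε ≤ infDist z T} ∩ closedBall 0 (|R| + 1)) :=
    (isCompact_closedBall _ _).inter_left
      (isClosed_le continuous_const (continuous_infDist_pt T))
  have key : ∃ δ > 0, ∀ z ∈ {z : ℂ | ε ≤ infDist z T} ∩ closedBall 0 (|R| + 1),
      Esc {y | infDist y T ≤ δ} z := by
    refine hK.induction_on (p := fun s => ∃ δ > 0, ∀ z ∈ s, Esc {y | infDist y T ≤ δ} z)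
      ⟨1, one_pos, by simp⟩ ?_ ?_ ?_
    · rintro s t hst ⟨δ, hδ, h⟩
      exact ⟨δ, hδ, fun z hz => h z (hst hz)⟩
    · rintro s t ⟨δ, hδ, h⟩ ⟨δ', hδ', h'⟩
      refine ⟨min δ δ', lt_min hδ hδ', ?_⟩
      rintro z (hz | hz)
      · exact (h z hz).mono fun y hy => le_trans (show infDist y T ≤ _ from hy) (min_le_left _ _)
      · exact (h' z hz).mono fun y hy => le_trans (show infDist y T ≤ _ from hy) (min_le_right _ _)
    · rintro w ⟨hw, -⟩
      have hwT : w ∉ T := fun h => by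
        have : ε ≤ infDist w T := hw
        rw [infDist_zero_of_mem h] at this
        linarith
      obtain ⟨δ, hδ, N, hN, h⟩ := (hfull w hwT).exists_dist hT hne
      exact ⟨N, mem_nhdsWithin_of_mem_nhds hN, δ, hδ, h⟩
  obtain ⟨δ, hδ, h⟩ := key
  refine ⟨min δ 1, by positivity, fun z hz => ?_⟩
  by_cases hzb : z ∈ closedBall (0 : ℂ) (|R| + 1)
  · exact (h z ⟨hz, hzb⟩).mono fun y hy =>
      le_trans (show infDist y T ≤ _ from hy) (min_le_left _ _)
  · have hzn : |R| + 1 < ‖z‖ := by simpa using hzb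
    refine Esc.of_norm_lt (R := |R| + 1) (fun y hy => ?_) (fun h0 => ?_) hzn
    · obtain ⟨x, hx, hxy⟩ := hT.exists_infDist_eq_dist hne y
      have h1 : dist x 0 ≤ R := hR hx
      have hy' : infDist y T ≤ 1 := le_trans (show infDist y T ≤ _ from hy) (min_le_right _ _)
      rw [mem_closedBall]
      linarith [dist_triangle y x 0, le_abs_self R]
    · rw [h0, norm_zero] at hzn
      linarith [abs_nonneg R]

/-- The six directions of the triangular lattice. -/
def hexDir : Fin 6 → ℤ × ℤ := ![(1, 0), (1, 1), (0, 1), (-1, 0), (-1, -1), (0, -1)]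

theorem hexDir_add_three (i : Fin 6) : hexDir (i + 3) = -hexDir i := by
  fin_cases i <;> rfl

/-- Adjacency in the triangular lattice. -/
def LAdj (u v : ℤ × ℤ) : Prop := ∃ i, v = u + hexDir i

theorem LAdj.symm {u v : ℤ × ℤ} (h : LAdj u v) : LAdj v u := by
  obtain ⟨i, rfl⟩ := h
  exact ⟨i + 3, by rw [hexDir_add_three]; abel⟩

/-- Connectedness of a finite set of lattice points, in terms of cuts. -/
def LConn (Q : Finset (ℤ × ℤ)) : Prop :=
  ∀ S ⊆ Q, S.Nonempty → (Q \ S).Nonempty → ∃ a ∈ S, ∃ b ∈ Q \ S, LAdj a b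

theorem LConn.subset_or_disjoint {N Q S : Finset (ℤ × ℤ)} (hN : LConn N) (hNQ : N ⊆ Q)
    (hS : ∀ a ∈ S, ∀ b ∈ Q \ S, ¬ LAdj a b) : N ⊆ S ∨ Disjoint N S := by
  by_contra! h
  obtain ⟨h1, h2⟩ := h
  obtain ⟨x, hxN, hxS⟩ := Finset.not_subset.1 h1
  obtain ⟨y, hyN, hyS⟩ := Finset.not_disjoint_iff.1 h2
  obtain ⟨a, ha, b, hb, hab⟩ := hN (N ∩ S) Finset.inter_subset_left
    ⟨y, Finset.mem_inter.2 ⟨hyN, hyS⟩⟩ ⟨x, by simp [hxN, hxS]⟩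
  simp only [Finset.mem_sdiff, Finset.mem_inter, not_and] at ha hb
  exact hS a ha.2 b (Finset.mem_sdiff.2 ⟨hNQ hb.1, hb.2 hb.1⟩) hab

theorem LConn.of_height {Q : Finset (ℤ × ℤ)} (r : ℤ × ℤ) (h : ℤ × ℤ → ℕ)
    (hQ : ∀ q ∈ Q, q ≠ r → ∃ p ∈ Q, LAdj q p ∧ h p < h q) : LConn Q := by
  intro S hS hSne hSne'
  have key : ∀ A ⊆ Q, A.Nonempty → r ∉ A → ∃ a ∈ A, ∃ b ∈ Q \ A, LAdj a b := by
    intro A hA hAne hr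
    obtain ⟨q, hq, hmin⟩ := A.exists_min_image h hAne
    obtain ⟨p, hp, hqp, hlt⟩ := hQ q (hA hq) (fun e => hr (e ▸ hq))
    exact ⟨q, hq, p, Finset.mem_sdiff.2 ⟨hp, fun hpA => absurd (hmin p hpA) (by omega)⟩, hqp⟩
  by_cases hr : r ∈ S
  · obtain ⟨a, ha, b, hb, hab⟩ := key (Q \ S) Finset.sdiff_subset hSne' (by simp [hr])
    rw [Finset.sdiff_sdiff_eq_self hS] at hb
    exact ⟨b, hb, a, ha, hab.symm⟩
  · exact key S hS hSne hr

theorem exists_outer_neighbour {R : Finset (ℤ × ℤ)} (hR : R.Nonempty) :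
    ∃ r ∈ R, r + hexDir 0 ∉ R ∧ r + hexDir 1 ∉ R ∧ r + hexDir 2 ∉ R := by
  obtain ⟨r, hr, hmax⟩ := R.exists_max_image (fun v : ℤ × ℤ => toLex v) hR
  have key : ∀ w : ℤ × ℤ, toLex (0 : ℤ × ℤ) < toLex w → r + w ∉ R := by
    intro w hw hrw
    have h1 := hmax _ hrw
    rw [Prod.Lex.toLex_le_toLex] at h1
    rw [Prod.Lex.toLex_lt_toLex] at hw
    simp at h1 hw
    omega
  exact ⟨r, hr, key _ (by decide), key _ (by decide), key _ (by decide)⟩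

/-- A connected finite set with a boundary point outside of a connected subset `N` has a
boundary point outside of `N` whose removal does not disconnect it. -/
theorem LConn.exists_erase {Q N : Finset (ℤ × ℤ)} (hQ : LConn Q) (hN : LConn N) (hNQ : N ⊆ Q)
    {b : ℤ × ℤ} (hb : b ∈ Q \ N) (hbd : ∃ i, b + hexDir i ∉ Q) :
    ∃ q ∈ Q \ N, (∃ i, q + hexDir i ∉ Q) ∧ LConn (Q.erase q) := by
  have key : ∀ n : ℕ, ∀ q ∈ Q \ N, (∃ i, q + hexDir i ∉ Q) → ∀ R ⊆ Q.erase q, R.card ≤ n →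
      R.Nonempty → Disjoint R N → (∀ a ∈ R, ∀ c ∈ Q.erase q \ R, ¬ LAdj a c) →
      ∃ q ∈ Q \ N, (∃ i, q + hexDir i ∉ Q) ∧ LConn (Q.erase q) := by
    intro n
    induction n with
    | zero =>
      intro q _ _ R _ hc hne
      exact absurd (Finset.card_pos.2 hne) (by omega)
    | succ n ih =>
      intro q hq hqb R hRQ hc hne hRN hsep
      obtain ⟨r, hr, h0, h1, h2⟩ := exists_outer_neighbour hne
      have hrQ : r ∈ Q := Finset.mem_of_mem_erase (hRQ hr)
      have hout : ∀ i, r + hexDir i ∉ R → r + hexDir i ∈ Q → r + hexDir i = q := by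
        intro i hi hiQ
        by_contra hne
        exact hsep r hr _ (by simp [hi, hiQ, hne]) ⟨i, rfl⟩
      have hrb : ∃ i, r + hexDir i ∉ Q := by
        by_contra! hall
        have e0 := hout 0 h0 (hall 0)
        have e1 := hout 1 h1 (hall 1)
        rw [← e1] at e0
        exact absurd (add_left_cancel e0) (by decide)
      have hrN : r ∈ Q \ N := Finset.mem_sdiff.2 ⟨hrQ, Finset.disjoint_left.1 hRN hr⟩
      by_cases hconn : LConn (Q.erase r)
      · exact ⟨r, hrN, hrb, hconn⟩
      have hC : LConn (Q \ R) := by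
        intro S hS hSne hSne'
        by_contra! hno
        have hqQR : q ∈ Q \ R := Finset.mem_sdiff.2
          ⟨(Finset.mem_sdiff.1 hq).1, fun h => by simpa using hRQ h⟩
        have aux : ∀ B ⊆ Q \ R, B.Nonempty → q ∉ B → (∀ a ∈ B, ∀ c ∈ (Q \ R) \ B, ¬ LAdj a c) →
            False := by
          intro B hB hBne hqB hBs
          have hBQ : B ⊆ Q := hB.trans Finset.sdiff_subset
          obtain ⟨a, ha, c, hc, hac⟩ := hQ B hBQ hBne ⟨q, by simp [hqB, (Finset.mem_sdiff.1 hq).1]⟩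
          simp only [Finset.mem_sdiff] at hc
          by_cases hcR : c ∈ R
          · have haB := hB ha
            simp only [Finset.mem_sdiff] at haB
            exact hsep c hcR a (by simp [haB.1, haB.2]; rintro rfl; exact hqB ha) hac.symm
          · exact hBs a ha c (by simp [hc, hcR]) hac
        by_cases hqS : q ∈ S
        · refine aux ((Q \ R) \ S) Finset.sdiff_subset hSne' (by simp [hqS]) ?_
          intro a ha c hc hac
          rw [Finset.sdiff_sdiff_eq_self hS] at hc
          exact hno c hc a ha hac.symm
        · exact aux S hS hSne hqS hno
      have hCsub : Q \ R ⊆ Q.erase r := by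
        intro x hx
        simp only [Finset.mem_sdiff] at hx
        exact Finset.mem_erase.2 ⟨fun e => hx.2 (e ▸ hr), hx.1⟩
      have hNC : N ⊆ Q \ R := fun x hx =>
        Finset.mem_sdiff.2 ⟨hNQ hx, fun h => Finset.disjoint_left.1 hRN h hx⟩
      have fin : ∀ R' ⊆ Q.erase r, R'.Nonempty → Disjoint (Q \ R) R' →
          (∀ a ∈ R', ∀ c ∈ Q.erase r \ R', ¬ LAdj a c) →
          ∃ q ∈ Q \ N, (∃ i, q + hexDir i ∉ Q) ∧ LConn (Q.erase q) := by
        intro R' hR' hne' hd hs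
        have hsub : R' ⊆ R.erase r := by
          intro x hx
          have h1 := Finset.mem_erase.1 (hR' hx)
          refine Finset.mem_erase.2 ⟨h1.1, ?_⟩
          by_contra hxR
          exact Finset.disjoint_left.1 hd (Finset.mem_sdiff.2 ⟨h1.2, hxR⟩) hx
        refine ih r hrN hrb R' hR' ?_ hne' ((hd.mono_left hNC).symm) hs
        have := Finset.card_le_card hsub
        rw [Finset.card_erase_of_mem hr] at this
        omega
      simp only [LConn, not_forall, not_exists, not_and] at hconn
      obtain ⟨S, hS, hSne, hSne', hno⟩ := hconn
      rcases hC.subset_or_disjoint hCsub hno with h | h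
      · refine fin (Q.erase r \ S) Finset.sdiff_subset hSne' ?_ ?_
        · exact (Finset.disjoint_sdiff).mono_left h
        · intro a ha c hc hac
          rw [Finset.sdiff_sdiff_eq_self hS] at hc
          exact hno c hc a ha hac.symm
      · exact fin S hS hSne h hno
  by_cases hconn : LConn (Q.erase b)
  · exact ⟨b, hb, hbd, hconn⟩
  simp only [LConn, not_forall, not_exists, not_and] at hconn
  obtain ⟨S, hS, hSne, hSne', hno⟩ := hconn
  have hNb : N ⊆ Q.erase b := fun x hx => Finset.mem_erase.2
    ⟨fun e => (Finset.mem_sdiff.1 hb).2 (e ▸ hx), hNQ hx⟩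
  rcases hN.subset_or_disjoint hNb hno with h | h
  · refine key _ b hb hbd (Q.erase b \ S) Finset.sdiff_subset le_rfl hSne'
      (Finset.sdiff_disjoint.mono_right h) ?_
    intro a ha c hc hac
    rw [Finset.sdiff_sdiff_eq_self hS] at hc
    exact hno c hc a ha hac.symm
  · exact key _ b hb hbd S hS le_rfl hSne h.symm hno

/-- The Euler characteristic of the full subcomplex of the triangular lattice spanned by `Q`. -/
def lchi (Q : Finset (ℤ × ℤ)) : ℤ :=
  let b : ℤ × ℤ → ℤ := fun v => if v ∈ Q then 1 else 0
  ∑ v ∈ Q, (1 - b (v + hexDir 0) - b (v + hexDir 1) - b (v + hexDir 2)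
    + b (v + hexDir 0) * b (v + hexDir 1) + b (v + hexDir 1) * b (v + hexDir 2))

theorem lchi_insert {Q : Finset (ℤ × ℤ)} {q : ℤ × ℤ} (hq : q ∉ Q) :
    lchi (insert q Q) = lchi Q + 1 - ∑ i : Fin 6, (if q + hexDir i ∈ Q then 1 else 0)
      + ∑ i : Fin 6, (if q + hexDir i ∈ Q then 1 else 0) *
          (if q + hexDir (i + 1) ∈ Q then 1 else 0) := by
  have hb : ∀ v, (if v ∈ insert q Q then (1 : ℤ) else 0) =
      (if v ∈ Q then 1 else 0) + (if v = q then 1 else 0) := by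
    intro v
    by_cases h : v = q
    · subst h; simp [hq]
    · simp [h]
  have e0 : hexDir 3 = -hexDir 0 := rfl
  have e1 : hexDir 4 = -hexDir 1 := rfl
  have e2 : hexDir 5 = -hexDir 2 := rfl
  have hd0 : hexDir 0 ≠ 0 := by decide
  have hd1 : hexDir 1 ≠ 0 := by decide
  have hd2 : hexDir 2 ≠ 0 := by decide
  have hsum : ∀ (w : ℤ × ℤ) (f : ℤ × ℤ → ℤ),
      ∑ v ∈ Q, f v * (if v + w = q then 1 else 0) = (if q - w ∈ Q then f (q - w) else 0) := by
    intro w f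
    rw [← Finset.sum_ite_eq' Q (q - w) f]
    refine Finset.sum_congr rfl fun v _ => ?_
    by_cases h : v = q - w
    · simp [h]
    · rw [if_neg h, if_neg (fun h' => h (by rw [← h']; simp)), mul_zero]
  have hz : ∀ (v w w' : ℤ × ℤ), w ≠ w' →
      (if v + w = q then (1 : ℤ) else 0) * (if v + w' = q then 1 else 0) = 0 := by
    intro v w w' hww
    by_cases h : v + w = q
    · by_cases h' : v + w' = q
      · exact absurd (add_left_cancel (h.trans h'.symm)) hww
      · simp [h']
    · simp [h]
  have s1 : ∀ w : ℤ × ℤ, ∑ v ∈ Q, (if v + w = q then (1 : ℤ) else 0) =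
      if q - w ∈ Q then 1 else 0 := by
    intro w; have := hsum w (fun _ => 1); simpa using this
  unfold lchi
  simp only [hb]
  rw [Finset.sum_insert hq]
  have expand : ∀ v ∈ Q, (1 - ((if v + hexDir 0 ∈ Q then (1 : ℤ) else 0) + if v + hexDir 0 = q then 1 else 0) -
          ((if v + hexDir 1 ∈ Q then 1 else 0) + if v + hexDir 1 = q then 1 else 0) -
        ((if v + hexDir 2 ∈ Q then 1 else 0) + if v + hexDir 2 = q then 1 else 0) +
      ((if v + hexDir 0 ∈ Q then 1 else 0) + if v + hexDir 0 = q then 1 else 0) *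
        ((if v + hexDir 1 ∈ Q then 1 else 0) + if v + hexDir 1 = q then 1 else 0) +
    ((if v + hexDir 1 ∈ Q then 1 else 0) + if v + hexDir 1 = q then 1 else 0) *
      ((if v + hexDir 2 ∈ Q then 1 else 0) + if v + hexDir 2 = q then 1 else 0)) =
      (1 - (if v + hexDir 0 ∈ Q then (1 : ℤ) else 0) - (if v + hexDir 1 ∈ Q then 1 else 0) -
        (if v + hexDir 2 ∈ Q then 1 else 0) +
        (if v + hexDir 0 ∈ Q then 1 else 0) * (if v + hexDir 1 ∈ Q then 1 else 0) +
        (if v + hexDir 1 ∈ Q then 1 else 0) * (if v + hexDir 2 ∈ Q then 1 else 0)) +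
      (- (if v + hexDir 0 = q then 1 else 0) - (if v + hexDir 1 = q then 1 else 0)
        - (if v + hexDir 2 = q then 1 else 0)
        + (if v + hexDir 0 ∈ Q then 1 else 0) * (if v + hexDir 1 = q then 1 else 0)
        + (if v + hexDir 1 ∈ Q then 1 else 0) * (if v + hexDir 0 = q then 1 else 0)
        + (if v + hexDir 1 ∈ Q then 1 else 0) * (if v + hexDir 2 = q then 1 else 0)
        + (if v + hexDir 2 ∈ Q then 1 else 0) * (if v + hexDir 1 = q then 1 else 0)) := by
    intro v _
    have z1 := hz v (hexDir 0) (hexDir 1) (by decide)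
    have z2 := hz v (hexDir 1) (hexDir 2) (by decide)
    linear_combination z1 + z2
  rw [Finset.sum_congr rfl expand, Finset.sum_add_distrib]
  simp only [Finset.sum_add_distrib, Finset.sum_sub_distrib, Finset.sum_neg_distrib, s1, hsum]
  have a1 : q - hexDir 1 + hexDir 0 = q + hexDir 5 := by
    rw [sub_add, sub_eq_add_neg]; rfl
  have a2 : q - hexDir 0 + hexDir 1 = q + hexDir 2 := by
    rw [sub_add, sub_eq_add_neg]; rfl
  have a3 : q - hexDir 2 + hexDir 1 = q + hexDir 0 := by
    rw [sub_add, sub_eq_add_neg]; rfl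
  have a4 : q - hexDir 1 + hexDir 2 = q + hexDir 3 := by
    rw [sub_add, sub_eq_add_neg]; rfl
  have b0 : q - hexDir 0 = q + hexDir 3 := by rw [e0, sub_eq_add_neg]
  have b1 : q - hexDir 1 = q + hexDir 4 := by rw [e1, sub_eq_add_neg]
  have b2 : q - hexDir 2 = q + hexDir 5 := by rw [e2, sub_eq_add_neg]
  rw [a1, a2, a3, a4, b0, b1, b2]
  have n0 : ∀ i, i = 0 ∨ i = 1 ∨ i = 2 → q + hexDir i ≠ q := by
    rintro i (rfl | rfl | rfl) <;> simpa
  simp only [n0 0 (by simp), n0 1 (by simp), n0 2 (by simp), if_false, Fin.sum_univ_six]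
  have f1 : (0 : Fin 6) + 1 = 1 := rfl
  have f2 : (1 : Fin 6) + 1 = 2 := rfl
  have f3 : (2 : Fin 6) + 1 = 3 := rfl
  have f4 : (3 : Fin 6) + 1 = 4 := rfl
  have f5 : (4 : Fin 6) + 1 = 5 := rfl
  have f6 : (5 : Fin 6) + 1 = 0 := rfl
  rw [f1, f2, f3, f4, f5, f6]
  have ite_mul' : ∀ (P R : Prop) [Decidable P] [Decidable R],
      (if P then (if R then (1 : ℤ) else 0) else 0) = (if P then 1 else 0) * (if R then 1 else 0) := by
    intros; split_ifs <;> simp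
  simp only [ite_mul']
  ring

theorem cyclic_arcs_pos (p : Fin 6 → Bool) (h1 : ∃ i, p i = true) (h2 : ∃ i, p i = false) :
    (1 : ℤ) ≤ ∑ i, (if p i then 1 else 0) -
      ∑ i, (if p i then 1 else 0) * (if p (i + 1) then 1 else 0) := by
  revert p; decide

theorem cyclic_arcs_one (p : Fin 6 → Bool) (h1 : ∃ i, p i = true) (h2 : ∃ i, p i = false)
    (h : ∑ i, (if p i then 1 else 0) -
      ∑ i, (if p i then 1 else 0) * (if p (i + 1) then 1 else 0) ≤ (1 : ℤ)) :
    ∃ a m : Fin 6, m ≠ 0 ∧ ∀ i, (p (a + i) = true ↔ i < m) := by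
  revert p; decide

/-- The neighbours of `q` in `Q` form a proper nonempty cyclic interval. -/
def RingContig (q : ℤ × ℤ) (Q : Finset (ℤ × ℤ)) : Prop :=
  ∃ a m : Fin 6, m ≠ 0 ∧ ∀ i, (q + hexDir (a + i) ∈ Q ↔ i < m)

theorem lchi_insert_le {Q : Finset (ℤ × ℤ)} {q : ℤ × ℤ} (hq : q ∉ Q)
    (h1 : ∃ i, q + hexDir i ∈ Q) (h2 : ∃ i, q + hexDir i ∉ Q) :
    lchi (insert q Q) ≤ lchi Q ∧ (lchi Q ≤ lchi (insert q Q) → RingContig q Q) := by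
  have := cyclic_arcs_pos (fun i => decide (q + hexDir i ∈ Q)) (by simpa using h1)
    (by simpa using h2)
  simp only [decide_eq_true_eq] at this
  rw [lchi_insert hq]
  refine ⟨by linarith, fun h => ?_⟩
  obtain ⟨a, m, hm, h⟩ := cyclic_arcs_one (fun i => decide (q + hexDir i ∈ Q))
    (by simpa using h1) (by simpa using h2) (by simp only [decide_eq_true_eq]; linarith)
  exact ⟨a, m, hm, fun i => by simpa using h i⟩

theorem LConn.exists_neighbour {Q : Finset (ℤ × ℤ)} {q : ℤ × ℤ} (hQ : LConn Q) (hq : q ∈ Q)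
    (hne : (Q.erase q).Nonempty) : ∃ i, q + hexDir i ∈ Q.erase q := by
  obtain ⟨a, ha, b, hb, i, rfl⟩ := hQ {q} (by simpa) (by simp)
    (by rwa [← Finset.erase_eq])
  rw [Finset.mem_singleton] at ha
  subst ha
  exact ⟨i, by rwa [Finset.erase_eq]⟩

theorem exists_boundary {Q : Finset (ℤ × ℤ)} (hQ : Q.Nonempty) :
    ∃ q ∈ Q, ∃ i, q + hexDir i ∉ Q := by
  obtain ⟨r, hr, h, -⟩ := exists_outer_neighbour hQ
  exact ⟨r, hr, 0, h⟩

theorem hexDir_ne_zero (i : Fin 6) : hexDir i ≠ 0 := by revert i; decide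

theorem LConn.lchi_le_one {Q : Finset (ℤ × ℤ)} (hQ : LConn Q) (hne : Q.Nonempty) :
    lchi Q ≤ 1 := by
  induction hn : Q.card generalizing Q with
  | zero => exact absurd (Finset.card_pos.2 hne) (by omega)
  | succ n ih =>
    obtain ⟨b, hb, hbd⟩ := exists_boundary hne
    obtain ⟨q, hq, ⟨j, hj⟩, hc⟩ := hQ.exists_erase (N := ∅) (by intro S hS h; simp_all)
      (by simp) (by simpa using hb) hbd
    have hqQ : q ∈ Q := by simpa using hq
    have hcard : (Q.erase q).card = n := by rw [Finset.card_erase_of_mem hqQ]; omega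
    rw [← Finset.insert_erase hqQ]
    rcases (Q.erase q).eq_empty_or_nonempty with h0 | h0
    · rw [h0, lchi_insert (by simp)]
      simp [lchi]
    · have := (lchi_insert_le (Finset.notMem_erase q Q) (hQ.exists_neighbour hqQ h0)
        ⟨j, fun h => hj (Finset.mem_of_mem_erase h)⟩).1
      exact this.trans (ih hc h0 hcard)

/-- A square box in the lattice. -/
def lbox (n : ℕ) : Finset (ℤ × ℤ) := Finset.Icc (-n : ℤ) n ×ˢ Finset.Icc (-n : ℤ) n

theorem mem_lbox {n : ℕ} {v : ℤ × ℤ} :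
    v ∈ lbox n ↔ (-(n : ℤ) ≤ v.1 ∧ v.1 ≤ n) ∧ (-(n : ℤ) ≤ v.2 ∧ v.2 ≤ n) := by
  simp [lbox]

theorem lconn_lbox (n : ℕ) : LConn (lbox n) := by
  refine LConn.of_height 0 (fun v => v.1.natAbs + v.2.natAbs) ?_
  rintro ⟨x, y⟩ hq hne
  rw [mem_lbox] at hq
  simp only [ne_eq, Prod.mk_eq_zero, not_and_or] at hne hq
  have : 0 < x ∨ x < 0 ∨ 0 < y ∨ y < 0 := by omega
  rcases this with h | h | h | h
  · exact ⟨(x - 1, y), by rw [mem_lbox]; simp only; omega, ⟨3, by ext <;> simp [hexDir]; ring⟩,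
      by simp only; omega⟩
  · exact ⟨(x + 1, y), by rw [mem_lbox]; simp only; omega, ⟨0, by ext <;> simp [hexDir]⟩,
      by simp only; omega⟩
  · exact ⟨(x, y - 1), by rw [mem_lbox]; simp only; omega, ⟨5, by ext <;> simp [hexDir]; ring⟩,
      by simp only; omega⟩
  · exact ⟨(x, y + 1), by rw [mem_lbox]; simp only; omega, ⟨2, by ext <;> simp [hexDir]⟩,
      by simp only; omega⟩

theorem lchi_lbox (n : ℕ) : lchi (lbox n) = 1 := by
  have e0 : hexDir 0 = (1, 0) := rfl
  have e1 : hexDir 1 = (1, 1) := rfl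
  have e2 : hexDir 2 = (0, 1) := rfl
  have key : ∀ (s t : ℕ) (P : ℤ × ℤ → Prop) [DecidablePred P],
      (∀ v ∈ lbox n, P v ↔ v.1 + s ≤ n ∧ v.2 + t ≤ n) →
      s ≤ 1 → t ≤ 1 →
      ∑ v ∈ lbox n, (if P v then (1 : ℤ) else 0) = (2 * n + 1 - s) * (2 * n + 1 - t) := by
    intro s t P _ hP hs ht
    have : (lbox n).filter P =
        Finset.Icc (-n : ℤ) (n - s) ×ˢ Finset.Icc (-n : ℤ) (n - t) := by
      ext v
      rw [Finset.mem_filter]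
      constructor
      · rintro ⟨h, h'⟩
        rw [hP v h] at h'
        rw [mem_lbox] at h
        simp only [Finset.mem_product, Finset.mem_Icc]
        omega
      · intro h
        simp only [Finset.mem_product, Finset.mem_Icc] at h
        have hv : v ∈ lbox n := by rw [mem_lbox]; omega
        exact ⟨hv, (hP v hv).2 (by omega)⟩
    rw [Finset.sum_boole, this, Finset.card_product, Int.card_Icc, Int.card_Icc]
    push_cast
    rw [Int.toNat_of_nonneg (by omega), Int.toNat_of_nonneg (by omega)]
    ring
  have hmul : ∀ (P R : Prop) [Decidable P] [Decidable R], (if P then (1 : ℤ) else 0) * (if R then 1 else 0) =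
      if P ∧ R then 1 else 0 := by
    intros; split_ifs <;> simp_all
  unfold lchi
  simp only [hmul, Finset.sum_add_distrib, Finset.sum_sub_distrib]
  have k0 : ∑ v ∈ lbox n, (1 : ℤ) = (2 * n + 1) * (2 * n + 1) := by
    have := key 0 0 (fun _ => True) (by intro v hv; rw [mem_lbox] at hv; simp; omega)
      (by simp) (by simp)
    simpa using this
  rw [k0, key 1 0 fun x => x + hexDir 0 ∈ lbox n, key 1 1 fun x => x + hexDir 1 ∈ lbox n,
    key 0 1 fun x => x + hexDir 2 ∈ lbox n,
    key 1 1 fun x => x + hexDir 0 ∈ lbox n ∧ x + hexDir 1 ∈ lbox n,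
    key 1 1 fun x => x + hexDir 1 ∈ lbox n ∧ x + hexDir 2 ∈ lbox n]
  · push_cast; ring
  all_goals first
    | omega
    | (intro v hv; rw [mem_lbox] at hv; simp only [mem_lbox, e0, e1, e2, Prod.fst_add, Prod.snd_add]; push_cast; omega)

/-- `G` is closed relative to `Q` if it contains all the neighbours of its points outside `Q`. -/
def RelClosed (Q G : Finset (ℤ × ℤ)) : Prop := ∀ a ∈ G, a ∈ Q ∨ ∀ i, a + hexDir i ∈ G

theorem RelClosed.le_of_le {Q G : Finset (ℤ × ℤ)} (hG : RelClosed Q G) (f : ℤ × ℤ → ℤ)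
    (i : Fin 6) (hf : ∀ v, f v < f (v + hexDir i)) {n : ℤ} (hQ : ∀ v ∈ Q, f v ≤ n) :
    ∀ v ∈ G, f v ≤ n := by
  intro v hv
  obtain ⟨a, ha, hmax⟩ := G.exists_max_image f ⟨v, hv⟩
  rcases hG a ha with h | h
  · exact (hmax v hv).trans (hQ a h)
  · exact absurd (hmax _ (h i)) (not_le.2 (hf a))

theorem RelClosed.subset_lbox {Q G : Finset (ℤ × ℤ)} (hG : RelClosed Q G) {n : ℕ}
    (hQ : Q ⊆ lbox n) : G ⊆ lbox n := by
  have hQ' := fun v (hv : v ∈ Q) => mem_lbox.1 (hQ hv)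
  intro v hv
  have h1 := hG.le_of_le (fun v => v.1) 0 (by intro v; simp [hexDir]) (fun v hv => (hQ' v hv).1.2) v hv
  have h2 := hG.le_of_le (fun v => v.2) 2 (by intro v; simp [hexDir]) (fun v hv => (hQ' v hv).2.2) v hv
  have h3 := hG.le_of_le (fun v => -v.1) 3 (by intro v; simp [hexDir]) (n := n)
    (fun v hv => by have := (hQ' v hv).1.1; omega) v hv
  have h4 := hG.le_of_le (fun v => -v.2) 5 (by intro v; simp [hexDir]) (n := n)
    (fun v hv => by have := (hQ' v hv).2.1; omega) v hv
  rw [mem_lbox]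
  omega

theorem exists_subset_lbox (Q : Finset (ℤ × ℤ)) : ∃ n, Q ⊆ lbox n := by
  refine ⟨Q.sup fun v => v.1.natAbs + v.2.natAbs, fun v hv => ?_⟩
  have := Finset.le_sup (f := fun v : ℤ × ℤ => v.1.natAbs + v.2.natAbs) hv
  rw [mem_lbox]
  omega

/-- The union of `Q` and of the bounded components of its complement. -/
def lfill (Q : Finset (ℤ × ℤ)) : Finset (ℤ × ℤ) :=
  (lbox (exists_subset_lbox Q).choose).filter fun v => ∃ G, RelClosed Q G ∧ v ∈ G

theorem mem_lfill {Q : Finset (ℤ × ℤ)} {v : ℤ × ℤ} :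
    v ∈ lfill Q ↔ ∃ G, RelClosed Q G ∧ v ∈ G := by
  simp only [lfill, Finset.mem_filter, and_iff_right_iff_imp]
  rintro ⟨G, hG, hv⟩
  exact hG.subset_lbox (exists_subset_lbox Q).choose_spec hv

theorem RelClosed.subset_lfill {Q G : Finset (ℤ × ℤ)} (hG : RelClosed Q G) : G ⊆ lfill Q :=
  fun _ hv => mem_lfill.2 ⟨G, hG, hv⟩

theorem relClosed_lfill (Q : Finset (ℤ × ℤ)) : RelClosed Q (lfill Q) := by
  intro a ha
  obtain ⟨G, hG, haG⟩ := mem_lfill.1 ha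
  exact (hG a haG).imp_right fun h i => hG.subset_lfill (h i)

theorem subset_lfill (Q : Finset (ℤ × ℤ)) : Q ⊆ lfill Q :=
  RelClosed.subset_lfill fun _ h => Or.inl h

theorem lfill_mono {Q Q' : Finset (ℤ × ℤ)} (h : Q ⊆ Q') : lfill Q ⊆ lfill Q' :=
  RelClosed.subset_lfill fun a ha => (relClosed_lfill Q a ha).imp_left fun h' => h h'

theorem lconn_lfill {Q : Finset (ℤ × ℤ)} (hQ : LConn Q) : LConn (lfill Q) := by
  intro S hS hSne hSne'
  by_contra! hno
  have aux : ∀ B ⊆ lfill Q, B.Nonempty → Disjoint Q B →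
      (∀ a ∈ B, ∀ c ∈ lfill Q \ B, ¬ LAdj a c) → False := by
    intro B hB hBne hd hs
    obtain ⟨b, hb, i, hbi⟩ := exists_boundary hBne
    rcases relClosed_lfill Q b (hB hb) with h | h
    · exact Finset.disjoint_left.1 hd h hb
    · exact hs b hb _ (Finset.mem_sdiff.2 ⟨h i, hbi⟩) ⟨i, rfl⟩
  rcases hQ.subset_or_disjoint (subset_lfill Q) hno with h | h
  · refine aux (lfill Q \ S) Finset.sdiff_subset hSne' (Finset.disjoint_sdiff.mono_left h) ?_
    intro a ha c hc hac
    rw [Finset.sdiff_sdiff_eq_self hS] at hc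
    exact hno c hc a ha hac.symm
  · exact aux S hS hSne h hno

theorem exists_shelling_step {Q C : Finset (ℤ × ℤ)} (hQ : LConn Q) (hne : Q.Nonempty)
    (hC : LConn C) (hchi : lchi C = 1) (hQC : lfill Q ⊆ C) (hCQ : C ≠ lfill Q) :
    ∃ q ∈ C \ lfill Q, LConn (C.erase q) ∧ lchi (C.erase q) = 1 ∧ RingContig q (C.erase q) := by
  have hb : ∃ b ∈ C \ lfill Q, ∃ i, b + hexDir i ∉ C := by
    by_contra! hall
    refine hCQ (Finset.Subset.antisymm (RelClosed.subset_lfill fun a ha => ?_) hQC)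
    by_cases haf : a ∈ lfill Q
    · exact (relClosed_lfill Q a haf).imp_right fun h i => hQC (h i)
    · exact Or.inr (hall a (Finset.mem_sdiff.2 ⟨ha, haf⟩))
  obtain ⟨b, hb, hbd⟩ := hb
  obtain ⟨q, hq, ⟨j, hj⟩, hc⟩ := hC.exists_erase (lconn_lfill hQ) hQC hb hbd
  obtain ⟨hqC, hqf⟩ := Finset.mem_sdiff.1 hq
  have hne' : (C.erase q).Nonempty := by
    obtain ⟨x, hx⟩ := hne
    have := subset_lfill Q hx
    exact ⟨x, Finset.mem_erase.2 ⟨fun e => hqf (e ▸ this), hQC this⟩⟩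
  have h1 := lchi_insert_le (Finset.notMem_erase q C) (hC.exists_neighbour hqC hne')
        ⟨j, fun h => hj (Finset.mem_of_mem_erase h)⟩
  rw [Finset.insert_erase hqC, hchi] at h1
  have h2 := hc.lchi_le_one hne'
  exact ⟨q, hq, hc, le_antisymm h2 h1.1, h1.2 h2⟩

theorem shelling_induction {Q C : Finset (ℤ × ℤ)} (hQ : LConn Q) (hne : Q.Nonempty)
    (hC : LConn C) (hchi : lchi C = 1) (hQC : lfill Q ⊆ C) {P : Finset (ℤ × ℤ) → Prop}
    (base : LConn (lfill Q) → lchi (lfill Q) = 1 → P (lfill Q))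
    (step : ∀ q ∈ C \ lfill Q, ∀ Q' ⊆ C, q ∉ Q' → lfill Q ⊆ Q' → RingContig q Q' → P Q' →
      P (insert q Q')) : P C := by
  induction hn : C.card generalizing C with
  | zero =>
    have : C = lfill Q := by
      have : C = ∅ := Finset.card_eq_zero.1 hn
      subst this
      exact (Finset.subset_empty.1 hQC).symm
    subst this
    exact base hC hchi
  | succ n ih =>
    by_cases h : C = lfill Q
    · subst h; exact base hC hchi
    obtain ⟨q, hq, hc, hchi', hring⟩ := exists_shelling_step hQ hne hC hchi hQC h
    obtain ⟨hqC, hqf⟩ := Finset.mem_sdiff.1 hq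
    have hsub : lfill Q ⊆ C.erase q := fun x hx =>
      Finset.mem_erase.2 ⟨fun e => hqf (e ▸ hx), hQC hx⟩
    rw [← Finset.insert_erase hqC]
    refine step q hq _ (Finset.erase_subset q C) (Finset.notMem_erase q C) hsub hring
      (ih hc hchi' hsub (fun q' hq' Q' hQ' => step q' ?_ Q' (hQ'.trans (Finset.erase_subset q C)))
        (by rw [Finset.card_erase_of_mem hqC]; omega))
    simp only [Finset.mem_sdiff, Finset.mem_erase] at hq' ⊢
    exact ⟨hq'.1.2, hq'.2⟩

theorem lchi_lfill {Q : Finset (ℤ × ℤ)} (hQ : LConn Q) (hne : Q.Nonempty) :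
    lchi (lfill Q) = 1 := by
  obtain ⟨n, hn⟩ := exists_subset_lbox Q
  exact shelling_induction hQ hne (lconn_lbox n) (lchi_lbox n)
    ((relClosed_lfill Q).subset_lbox hn) (P := fun _ => lchi (lfill Q) = 1)
    (fun _ h => h) (fun _ _ _ _ _ _ _ h => h)

/-- The hexagonal norm on the plane. -/
def hexN (z : ℂ) : ℝ := max (max |z.re| |z.im|) |z.re - z.im|

/-- The point of the plane corresponding to a lattice point. -/
def lpt (v : ℤ × ℤ) : ℂ := ⟨v.1, v.2⟩

@[simp] theorem lpt_re (v : ℤ × ℤ) : (lpt v).re = v.1 := rfl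
@[simp] theorem lpt_im (v : ℤ × ℤ) : (lpt v).im = v.2 := rfl

theorem lpt_add (u v : ℤ × ℤ) : lpt (u + v) = lpt u + lpt v := by
  apply Complex.ext <;> simp

theorem hexN_le {z : ℂ} {r : ℝ} :
    hexN z ≤ r ↔ (-r ≤ z.re ∧ z.re ≤ r) ∧ (-r ≤ z.im ∧ z.im ≤ r) ∧
      (-r ≤ z.re - z.im ∧ z.re - z.im ≤ r) := by
  simp only [hexN, max_le_iff, abs_le, and_assoc]

theorem hexN_lt {z : ℂ} {r : ℝ} :
    hexN z < r ↔ (-r < z.re ∧ z.re < r) ∧ (-r < z.im ∧ z.im < r) ∧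
      (-r < z.re - z.im ∧ z.re - z.im < r) := by
  simp only [hexN, max_lt_iff, abs_lt, and_assoc]

theorem continuous_hexN : Continuous hexN := by
  unfold hexN; fun_prop

/-- `z` lies in the open star of the lattice point `v`. -/
def LNear (z : ℂ) (v : ℤ × ℤ) : Prop := hexN (z - lpt v) < 1

theorem lnear_iff {z : ℂ} {v : ℤ × ℤ} :
    LNear z v ↔ (-1 < z.re - v.1 ∧ z.re - v.1 < 1) ∧ (-1 < z.im - v.2 ∧ z.im - v.2 < 1) ∧
      (-1 < (z.re - v.1) - (z.im - v.2) ∧ (z.re - v.1) - (z.im - v.2) < 1) := by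
  simp [LNear, hexN_lt]

theorem isOpen_lnear (v : ℤ × ℤ) : IsOpen {z | LNear z v} :=
  isOpen_lt (continuous_hexN.comp (by fun_prop)) continuous_const

theorem lnear_self (v : ℤ × ℤ) : LNear (lpt v) v := by simp [lnear_iff]

theorem exists_lnear (z : ℂ) : ∃ v, LNear z v := by
  refine ⟨(⌊z.re⌋, ⌊z.im⌋), lnear_iff.2 ?_⟩
  have h1 := Int.floor_le z.re
  have h2 := Int.lt_floor_add_one z.re
  have h3 := Int.floor_le z.im
  have h4 := Int.lt_floor_add_one z.im
  simp only
  refine ⟨⟨?_, ?_⟩, ⟨?_, ?_⟩, ?_, ?_⟩ <;> linarith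

theorem eq_or_ladj {u v : ℤ × ℤ} (h1 : |v.1 - u.1| ≤ 1) (h2 : |v.2 - u.2| ≤ 1)
    (h3 : |(v.1 - u.1) - (v.2 - u.2)| ≤ 1) : u = v ∨ LAdj u v := by
  obtain ⟨a, b⟩ := u
  obtain ⟨c, d⟩ := v
  simp only [abs_le] at h1 h2 h3
  have : (c = a ∧ d = b) ∨ (c = a + 1 ∧ d = b) ∨ (c = a + 1 ∧ d = b + 1) ∨ (c = a ∧ d = b + 1) ∨
    (c = a + -1 ∧ d = b) ∨ (c = a + -1 ∧ d = b + -1) ∨ (c = a ∧ d = b + -1) := by omega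
  rcases this with ⟨rfl, rfl⟩ | ⟨rfl, rfl⟩ | ⟨rfl, rfl⟩ | ⟨rfl, rfl⟩ | ⟨rfl, rfl⟩ | ⟨rfl, rfl⟩ |
    ⟨rfl, rfl⟩
  · exact Or.inl rfl
  · exact Or.inr ⟨0, by simp [hexDir]⟩
  · exact Or.inr ⟨1, by simp [hexDir]⟩
  · exact Or.inr ⟨2, by simp [hexDir]⟩
  · exact Or.inr ⟨3, by simp [hexDir]⟩
  · exact Or.inr ⟨4, by simp [hexDir]⟩
  · exact Or.inr ⟨5, by simp [hexDir]⟩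

theorem eq_or_ladj_of_lt {u v : ℤ × ℤ} (h1 : |(v.1 - u.1 : ℝ)| < 2) (h2 : |(v.2 - u.2 : ℝ)| < 2)
    (h3 : |((v.1 - u.1) - (v.2 - u.2) : ℝ)| < 2) : u = v ∨ LAdj u v := by
  have h1' : |v.1 - u.1| < 2 := by exact_mod_cast h1
  have h2' : |v.2 - u.2| < 2 := by exact_mod_cast h2
  have h3' : |(v.1 - u.1) - (v.2 - u.2)| < 2 := by exact_mod_cast h3
  exact eq_or_ladj (by omega) (by omega) (by omega)

theorem LNear.eq_or_ladj {z : ℂ} {u v : ℤ × ℤ} (hu : LNear z u) (hv : LNear z v) :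
    u = v ∨ LAdj u v := by
  rw [lnear_iff] at hu hv
  apply eq_or_ladj_of_lt <;> rw [abs_lt] <;> constructor <;> linarith

theorem lnear_lpt {u v : ℤ × ℤ} (h : LNear (lpt u) v) : v = u := by
  rw [lnear_iff] at h
  simp only [lpt_re, lpt_im] at h
  obtain ⟨⟨h1, h2⟩, ⟨h3, h4⟩, -⟩ := h
  have h1' : -1 < u.1 - v.1 := by exact_mod_cast h1
  have h2' : u.1 - v.1 < 1 := by exact_mod_cast h2
  have h3' : -1 < u.2 - v.2 := by exact_mod_cast h3
  have h4' : u.2 - v.2 < 1 := by exact_mod_cast h4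
  ext <;> omega

theorem LNear.segment {p y : ℂ} {v w : ℤ × ℤ} (hp : LNear p v) (hy : y ∈ segment ℝ p (lpt v))
    (hw : LNear y w) : w = v ∨ LNear p w := by
  rw [segment_eq_image'] at hy
  obtain ⟨t, ⟨ht0, ht1⟩, rfl⟩ := hy
  have hyv : LNear (p + t • (lpt v - p)) v := by
    rw [lnear_iff] at hp ⊢
    simp only [Complex.add_re, Complex.smul_re, Complex.sub_re, lpt_re, smul_eq_mul,
      Complex.add_im, Complex.smul_im, Complex.sub_im, lpt_im] at hp ⊢
    refine ⟨⟨?_, ?_⟩, ⟨?_, ?_⟩, ?_, ?_⟩ <;> nlinarith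
  rcases hyv.eq_or_ladj hw with h | ⟨i, rfl⟩
  · exact Or.inl h.symm
  right
  have h1 : (1 - t) ≤ 1 := by linarith
  have h0 : 0 < 1 - t := by
    rcases ht1.lt_or_eq with h | h
    · linarith
    · subst h
      exfalso
      have := lnear_lpt (u := v) (by simpa using hw)
      exact hexDir_ne_zero i (by simpa using this)
  rw [lnear_iff] at hp hw ⊢
  simp only [Complex.add_re, Complex.smul_re, Complex.sub_re, lpt_re, smul_eq_mul,
      Complex.add_im, Complex.smul_im, Complex.sub_im, lpt_im, Prod.fst_add, Prod.snd_add] at hp hw ⊢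
  obtain ⟨a, b⟩ := v
  obtain ⟨x, y⟩ := p
  simp only at hp hw ⊢
  obtain ⟨X, hX⟩ : ∃ X, X = x - a := ⟨_, rfl⟩
  obtain ⟨Y, hY⟩ : ∃ Y, Y = y - b := ⟨_, rfl⟩
  have ex : x = X + a := by rw [hX]; ring
  have ey : y = Y + b := by rw [hY]; ring
  subst ex ey
  clear hX hY
  fin_cases i <;> simp [hexDir] at hp hw ⊢ <;>
    refine ⟨⟨?_, ?_⟩, ⟨?_, ?_⟩, ?_, ?_⟩ <;> nlinarith

/-- The union of all cells of the triangulated plane all of whose vertices lie in `Q`. -/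
def lbody (Q : Finset (ℤ × ℤ)) : Set ℂ := {z | ∀ v, LNear z v → v ∈ Q}

theorem lbody_mono {Q Q' : Finset (ℤ × ℤ)} (h : Q ⊆ Q') : lbody Q ⊆ lbody Q' :=
  fun _ hz v hv => h (hz v hv)

theorem lpt_mem_lbody {Q : Finset (ℤ × ℤ)} {v : ℤ × ℤ} : lpt v ∈ lbody Q ↔ v ∈ Q :=
  ⟨fun h => h v (lnear_self v), fun h u hu => by rwa [lnear_lpt hu]⟩

theorem isClosed_lbody (Q : Finset (ℤ × ℤ)) : IsClosed (lbody Q) := by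
  have : lbody Q = ⋂ v, ⋂ _ : v ∉ Q, {z | LNear z v}ᶜ := by
    ext z
    simp only [lbody, Set.mem_ofPred_eq, mem_iInter, mem_compl_iff]
    exact forall_congr' fun v => not_imp_not.symm
  rw [this]
  exact isClosed_iInter fun v => isClosed_iInter fun _ => (isOpen_lnear v).isClosed_compl

theorem LNear.norm_sub_lt {z : ℂ} {v : ℤ × ℤ} (h : LNear z v) : ‖z - lpt v‖ < 2 := by
  rw [lnear_iff] at h
  refine (Complex.norm_le_abs_re_add_abs_im _).trans_lt ?_
  have h1 : |(z - lpt v).re| < 1 := by rw [abs_lt]; simpa using h.1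
  have h2 : |(z - lpt v).im| < 1 := by rw [abs_lt]; simpa using h.2.1
  linarith

theorem isBounded_iUnion_lnear (Q : Finset (ℤ × ℤ)) :
    Bornology.IsBounded {z | ∃ v ∈ Q, LNear z v} := by
  have : {z | ∃ v ∈ Q, LNear z v} ⊆ ⋃ v ∈ Q, ball (lpt v) 2 := by
    rintro z ⟨v, hv, hz⟩
    simp only [mem_iUnion]
    exact ⟨v, hv, by rw [mem_ball, dist_eq_norm]; exact hz.norm_sub_lt⟩
  refine Bornology.IsBounded.subset ?_ this
  exact (Bornology.isBounded_biUnion_finset Q).2 fun v _ => isBounded_ball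

theorem isCompact_lbody (Q : Finset (ℤ × ℤ)) : IsCompact (lbody Q) := by
  refine isCompact_of_isClosed_isBounded (isClosed_lbody Q)
    ((isBounded_iUnion_lnear Q).subset fun z hz => ?_)
  obtain ⟨v, hv⟩ := exists_lnear z
  exact ⟨v, hz v hv, hv⟩

theorem lbody_inter (X Z : Finset (ℤ × ℤ)) : lbody (X ∩ Z) = lbody X ∩ lbody Z := by
  ext z
  simp only [lbody, Finset.mem_inter, Set.mem_ofPred_eq, mem_inter_iff]
  exact ⟨fun h => ⟨fun v hv => (h v hv).1, fun v hv => (h v hv).2⟩,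
    fun h v hv => ⟨h.1 v hv, h.2 v hv⟩⟩

theorem lbody_union {X Z : Finset (ℤ × ℤ)} (h : ∀ a ∈ X \ Z, ∀ b ∈ Z \ X, ¬ LAdj a b) :
    lbody (X ∪ Z) = lbody X ∪ lbody Z := by
  refine Subset.antisymm (fun z hz => ?_)
    (union_subset (lbody_mono Finset.subset_union_left) (lbody_mono Finset.subset_union_right))
  by_contra hcon
  simp only [lbody, mem_union, Set.mem_ofPred_eq, not_or, not_forall, exists_prop] at hcon
  obtain ⟨⟨v, hv, hvX⟩, u, hu, huZ⟩ := hcon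
  have hvZ : v ∈ Z := (Finset.mem_union.1 (hz v hv)).resolve_left hvX
  have huX : u ∈ X := (Finset.mem_union.1 (hz u hu)).resolve_right huZ
  rcases hu.eq_or_ladj hv with e | hadj
  · exact huZ (e ▸ hvZ)
  · exact h u (Finset.mem_sdiff.2 ⟨huX, huZ⟩) v (Finset.mem_sdiff.2 ⟨hvZ, hvX⟩) hadj

/-- The lattice points whose open star meets `T`. -/
def IsLNbhd (T : Set ℂ) (Q : Finset (ℤ × ℤ)) : Prop := ∀ v, v ∈ Q ↔ ∃ x ∈ T, LNear x v

theorem exists_isLNbhd {T : Set ℂ} (hT : Bornology.IsBounded T) : ∃ Q, IsLNbhd T Q := by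
  obtain ⟨R, hR⟩ := hT.subset_closedBall 0
  have hfin : {v : ℤ × ℤ | ∃ x ∈ T, LNear x v}.Finite := by
    obtain ⟨n, hn⟩ := exists_nat_ge (R + 1)
    refine (lbox n).finite_toSet.subset ?_
    rintro v ⟨x, hx, hv⟩
    have h1 : ‖x‖ ≤ R := by simpa using hR hx
    have h2 := abs_le.1 ((Complex.abs_re_le_norm x).trans h1)
    have h3 := abs_le.1 ((Complex.abs_im_le_norm x).trans h1)
    rw [lnear_iff] at hv
    simp only [Finset.mem_coe, mem_lbox]
    refine ⟨⟨?_, ?_⟩, ?_, ?_⟩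
    · have : -(n : ℝ) ≤ v.1 := by linarith
      exact_mod_cast this
    · have : (v.1 : ℝ) ≤ n := by linarith
      exact_mod_cast this
    · have : -(n : ℝ) ≤ v.2 := by linarith
      exact_mod_cast this
    · have : (v.2 : ℝ) ≤ n := by linarith
      exact_mod_cast this
  exact ⟨hfin.toFinset, fun v => by simp⟩

namespace IsLNbhd

variable {T : Set ℂ} {Q : Finset (ℤ × ℤ)}

theorem subset_lbody (h : IsLNbhd T Q) : T ⊆ lbody Q := fun x hx v hv => (h v).2 ⟨x, hx, hv⟩

theorem nonempty (h : IsLNbhd T Q) (hne : T.Nonempty) : Q.Nonempty := by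
  obtain ⟨x, hx⟩ := hne
  obtain ⟨v, hv⟩ := exists_lnear x
  exact ⟨v, (h v).2 ⟨x, hx, hv⟩⟩

theorem lconn (h : IsLNbhd T Q) (hT : IsPreconnected T) : LConn Q := by
  intro S hS hSne hSne'
  have ho : ∀ A : Finset (ℤ × ℤ), IsOpen {z | ∃ v ∈ A, LNear z v} := by
    intro A
    have : {z | ∃ v ∈ A, LNear z v} = ⋃ v ∈ A, {z | LNear z v} := by ext; simp
    rw [this]
    exact isOpen_biUnion fun v _ => isOpen_lnear v
  have hmeet : ∀ A ⊆ Q, A.Nonempty → (T ∩ {z | ∃ v ∈ A, LNear z v}).Nonempty := by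
    rintro A hA ⟨a, ha⟩
    obtain ⟨x, hx, hxa⟩ := (h a).1 (hA ha)
    exact ⟨x, hx, a, ha, hxa⟩
  obtain ⟨x, hx, ⟨a, ha, hxa⟩, b, hb, hxb⟩ := hT _ _ (ho S) (ho (Q \ S)) (by
      intro x hx
      obtain ⟨v, hv⟩ := exists_lnear x
      have hvQ : v ∈ Q := (h v).2 ⟨x, hx, hv⟩
      by_cases hvS : v ∈ S
      · exact Or.inl ⟨v, hvS, hv⟩
      · exact Or.inr ⟨v, Finset.mem_sdiff.2 ⟨hvQ, hvS⟩, hv⟩)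
    (hmeet S hS hSne) (hmeet _ Finset.sdiff_subset hSne')
  refine ⟨a, ha, b, hb, (hxa.eq_or_ladj hxb).resolve_left ?_⟩
  rintro rfl
  exact (Finset.mem_sdiff.1 hb).2 ha

theorem segment_subset {p : ℂ} {v : ℤ × ℤ} (hp : p ∈ lbody Q) (hv : LNear p v) :
    segment ℝ p (lpt v) ⊆ lbody Q := by
  intro y hy w hw
  rcases hv.segment hy hw with rfl | h
  · exact hp _ hv
  · exact hp _ h

theorem isPreconnected_lbody (h : IsLNbhd T Q) (hT : IsPreconnected T) :
    IsPreconnected (lbody Q) := by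
  rcases T.eq_empty_or_nonempty with rfl | ⟨x₀, hx₀⟩
  · have : lbody Q = ∅ := by
      rw [eq_empty_iff_forall_notMem]
      intro z hz
      obtain ⟨v, hv⟩ := exists_lnear z
      obtain ⟨x, hx, -⟩ := (h v).1 (hz v hv)
      exact hx
    rw [this]; exact isPreconnected_empty
  refine isPreconnected_of_forall x₀ fun z hz => ?_
  obtain ⟨v, hv⟩ := exists_lnear z
  obtain ⟨x, hx, hxv⟩ := (h v).1 (hz v hv)
  refine ⟨(segment ℝ z (lpt v) ∪ segment ℝ x (lpt v)) ∪ T, union_subset (union_subset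
    (segment_subset hz hv) (segment_subset (h.subset_lbody hx) hxv)) h.subset_lbody,
    Or.inr hx₀, Or.inl (Or.inl (left_mem_segment _ _ _)), ?_⟩
  refine IsPreconnected.union x (Or.inr (left_mem_segment _ _ _)) hx ?_ hT
  exact IsPreconnected.union (lpt v) (right_mem_segment _ _ _) (right_mem_segment _ _ _)
    (convex_segment _ _).isPreconnected (convex_segment _ _).isPreconnected

end IsLNbhd

theorem Esc.notMem_lfill {Q : Finset (ℤ × ℤ)} {v : ℤ × ℤ} (h : Esc (lbody Q) (lpt v)) :
    v ∉ lfill Q := by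
  intro hv
  have hvQ : v ∉ Q := fun h' => h.notMem (lpt_mem_lbody.2 h')
  obtain ⟨S, hS, hz, hd, hb⟩ := h
  obtain ⟨G, hG, hvG⟩ := mem_lfill.1 hv
  have ho : ∀ p : ℤ × ℤ → Prop, IsOpen {z | ∃ v, p v ∧ LNear z v} := by
    intro p
    have : {z | ∃ v, p v ∧ LNear z v} = ⋃ v, ⋃ _ : p v, {z | LNear z v} := by ext; simp
    rw [this]
    exact isOpen_iUnion fun v => isOpen_iUnion fun _ => isOpen_lnear v
  have hsub := hS.subset_left_of_subset_union (ho fun a => a ∈ G ∧ a ∉ Q)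
    (ho fun a => a ∉ G ∧ a ∉ Q) (by
      rw [disjoint_left]
      rintro z ⟨a, ⟨haG, haQ⟩, ha⟩ ⟨b, ⟨hbG, hbQ⟩, hb⟩
      rcases ha.eq_or_ladj hb with rfl | ⟨i, rfl⟩
      · exact hbG haG
      · exact hbG (((hG a haG).resolve_left haQ) i)) (by
      intro z hz
      have : ¬ ∀ v, LNear z v → v ∈ Q := fun h => disjoint_left.1 hd hz h
      push Not at this
      obtain ⟨u, hu, huQ⟩ := this
      by_cases huG : u ∈ G
      · exact Or.inl ⟨u, ⟨huG, huQ⟩, hu⟩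
      · exact Or.inr ⟨u, ⟨huG, huQ⟩, hu⟩)
    ⟨lpt v, hz, v, ⟨hvG, hvQ⟩, lnear_self v⟩
  refine hb ((isBounded_iUnion_lnear G).subset (hsub.trans ?_))
  rintro z ⟨a, ha, hz⟩
  exact ⟨a, ha.1, hz⟩

theorem esc_lbody_of_notMem_lfill {Q : Finset (ℤ × ℤ)} {v : ℤ × ℤ} (hv : v ∉ lfill Q) :
    Esc (lbody Q) (lpt v) := by
  have hvQ : lpt v ∈ (lbody Q)ᶜ := fun h => hv (subset_lfill Q (lpt_mem_lbody.1 h))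
  refine ⟨connectedComponentIn (lbody Q)ᶜ (lpt v), isPreconnected_connectedComponentIn,
    mem_connectedComponentIn hvQ, disjoint_left.2 fun x hx =>
      connectedComponentIn_subset _ _ hx, fun hb => hv ?_⟩
  obtain ⟨B, hB⟩ := exists_isLNbhd hb
  set G := B.filter fun a => lpt a ∈ connectedComponentIn (lbody Q)ᶜ (lpt v)
  have hG : ∀ a, a ∈ G ↔ lpt a ∈ connectedComponentIn (lbody Q)ᶜ (lpt v) := by
    intro a
    simp only [G, Finset.mem_filter, and_iff_right_iff_imp]
    exact fun h => (hB a).2 ⟨_, h, lnear_self a⟩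
  refine mem_lfill.2 ⟨G ∪ Q, fun a ha => ?_, Finset.mem_union_left _
    ((hG v).2 (mem_connectedComponentIn hvQ))⟩
  by_cases haQ : a ∈ Q
  · exact Or.inl haQ
  right
  intro i
  by_cases hbQ : a + hexDir i ∈ Q
  · exact Finset.mem_union_right _ hbQ
  refine Finset.mem_union_left _ ((hG _).2 ?_)
  have haG := (hG a).1 ((Finset.mem_union.1 ha).resolve_right haQ)
  have hseg : segment ℝ (lpt a) (lpt (a + hexDir i)) ⊆ (lbody Q)ᶜ := by
    intro y hy hyQ
    rw [segment_eq_image'] at hy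
    obtain ⟨t, ⟨ht0, ht1⟩, rfl⟩ := hy
    rcases ht1.lt_or_eq with h | rfl
    · refine haQ (hyQ a ?_)
      rw [lpt_add, lnear_iff]
      fin_cases i <;> simp [hexDir] <;> constructor <;> (try constructor) <;> linarith
    · refine hbQ (lpt_mem_lbody.1 ?_)
      simpa using hyQ
  rw [connectedComponentIn_eq haG]
  exact (convex_segment _ _).isPreconnected.subset_connectedComponentIn (left_mem_segment _ _ _)
    hseg (right_mem_segment _ _ _)

section radial

variable {K : Set ℂ}

/-- Radial expansion of a star-shaped body by the Möbius map fixing `0` and `1`. -/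
def radialMap (K : Set ℂ) (s : ℝ) (x : ℂ) : ℂ :=
  (s + (1 - s) * min (gauge K x) 1)⁻¹ • x

theorem radialDenom_pos {s : ℝ} (hs : 0 < s) (x : ℂ) :
    0 < s + (1 - s) * min (gauge K x) 1 := by
  have h0 : 0 ≤ min (gauge K x) 1 := le_min (gauge_nonneg x) zero_le_one
  have h1 : min (gauge K x) 1 ≤ 1 := min_le_right _ _
  rcases h1.lt_or_eq with h | h
  · nlinarith [mul_pos hs (sub_pos.2 h)]
  · rw [h]; linarith

theorem radialMap_inv {s : ℝ} (hs : 0 < s) (x : ℂ) :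
    radialMap K s⁻¹ (radialMap K s x) = x := by
  have hd := radialDenom_pos (K := K) hs x
  set d := s + (1 - s) * min (gauge K x) 1 with hdd
  have h1 : radialMap K s x = d⁻¹ • x := rfl
  have h2 : gauge K (d⁻¹ • x) = d⁻¹ * gauge K x := by
    rw [gauge_smul_of_nonneg (inv_nonneg.2 hd.le), smul_eq_mul]
  rw [h1, radialMap, h2, smul_smul]
  have hs' := hs.ne'
  have key : (s⁻¹ + (1 - s⁻¹) * min (d⁻¹ * gauge K x) 1) = d⁻¹ := by
    rcases le_total (gauge K x) 1 with h | h
    · rw [min_eq_left h] at hdd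
      have hle : d⁻¹ * gauge K x ≤ 1 := by
        rw [inv_mul_le_iff₀ hd, mul_one, hdd]
        nlinarith [mul_nonneg hs.le (sub_nonneg.2 h)]
      rw [min_eq_left hle]
      field_simp
      rw [hdd]; ring
    · rw [min_eq_right h] at hdd
      have : d = 1 := by rw [hdd]; ring
      rw [this, inv_one, one_mul, min_eq_right h]; ring
  rw [key, inv_inv, mul_inv_cancel₀ hd.ne', one_smul]

theorem continuous_radialMap (hK : Convex ℝ K) (h0 : K ∈ 𝓝 0) {s : ℝ} (hs : 0 < s) :
    Continuous (radialMap K s) := by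
  have hg := continuous_gauge hK h0
  unfold radialMap
  refine Continuous.smul (Continuous.inv₀ (by fun_prop) fun x => (radialDenom_pos hs x).ne')
    continuous_id

/-- The radial expansion as a homeomorphism. -/
def radialHomeo (hK : Convex ℝ K) (h0 : K ∈ 𝓝 0) {s : ℝ} (hs : 0 < s) : ℂ ≃ₜ ℂ where
  toFun := radialMap K s
  invFun := radialMap K s⁻¹
  left_inv := radialMap_inv hs
  right_inv x := by simpa using radialMap_inv (K := K) (inv_pos.2 hs) x
  continuous_toFun := continuous_radialMap hK h0 hs
  continuous_invFun := continuous_radialMap hK h0 (inv_pos.2 hs)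

theorem radialMap_of_one_le {s : ℝ} {x : ℂ} (hx : 1 ≤ gauge K x) : radialMap K s x = x := by
  rw [radialMap, min_eq_right hx]; simp

end radial

theorem exists_push_zero {K P V : Set ℂ} (hK : Convex ℝ K) (hKc : IsCompact K)
    (h0 : 0 ∈ interior K) (hP : IsCompact P) (hPK : P ⊆ K) (h0P : (0 : ℂ) ∉ P) (hV : IsOpen V)
    (hexit : ∀ x ∈ P, ∀ τ : ℝ, 0 ≤ τ → x + τ • x ∈ frontier K → x + τ • x ∈ V) :
    ∃ k : ℂ ≃ₜ ℂ, (∀ x ∉ interior K, k x = x) ∧ ∀ x ∈ P, k x ∈ V := by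
  have h0' : K ∈ 𝓝 (0 : ℂ) := mem_interior_iff_mem_nhds.1 h0
  have hg := continuous_gauge hK h0'
  have hpos : ∀ x ∈ P, 0 < gauge K x := fun x hx =>
    (gauge_pos (absorbent_nhds_zero h0')
      (NormedSpace.isVonNBounded_of_isBounded ℝ hKc.isBounded)).2 fun e => h0P (e ▸ hx)
  have hle : ∀ x ∈ P, gauge K x ≤ 1 := fun x hx => gauge_le_one_of_mem (hPK hx)
  have hev : ∀ᶠ s : ℝ in 𝓝 0, ∀ x ∈ P, radialMap K s x ∈ V := by
    refine hP.eventually_forall_of_forall_eventually fun x hx => ?_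
    have hc : ContinuousAt (fun p : ℝ × ℂ => radialMap K p.1 p.2) (0, x) := by
      unfold radialMap
      have hd : Continuous fun p : ℝ × ℂ => p.1 + (1 - p.1) * min (gauge K p.2) 1 := by fun_prop
      refine ContinuousAt.smul (ContinuousAt.inv₀ hd.continuousAt ?_) continuousAt_snd
      simp only [sub_zero, one_mul, zero_add]
      exact (lt_min (hpos x hx) one_pos).ne'
    refine hc.eventually (hV.mem_nhds ?_)
    have e : radialMap K 0 x = x + ((gauge K x)⁻¹ - 1) • x := by
      rw [radialMap, min_eq_left (hle x hx)]
      simp only [zero_add, sub_zero, one_mul, sub_smul, one_smul]; abel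
    simp only
    rw [e]
    refine hexit x hx _ (sub_nonneg.2 ((one_le_inv₀ (hpos x hx)).2 (hle x hx))) ?_
    rw [← e, ← gauge_eq_one_iff_mem_frontier hK h0', radialMap, min_eq_left (hle x hx)]
    simp only [zero_add, sub_zero, one_mul]
    rw [gauge_smul_of_nonneg (inv_nonneg.2 (hpos x hx).le), smul_eq_mul,
      inv_mul_cancel₀ (hpos x hx).ne']
  obtain ⟨s, hs, hs0⟩ := ((hev.filter_mono nhdsWithin_le_nhds).and
    (self_mem_nhdsWithin (s := Ioi (0 : ℝ)))).exists
  refine ⟨radialHomeo hK h0' hs0, fun x hx => radialMap_of_one_le ?_, hs⟩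
  rw [← gauge_lt_one_iff_mem_interior hK h0', not_lt] at hx
  exact hx

/-- Points of a compact part of a convex body can be pushed radially from a centre towards the
boundary of the body. -/
theorem exists_push {H P V : Set ℂ} {c : ℂ} (hH : Convex ℝ H) (hHc : IsCompact H)
    (hc : c ∈ interior H) (hP : IsCompact P) (hPH : P ⊆ H) (hcP : c ∉ P) (hV : IsOpen V)
    (hexit : ∀ x ∈ P, ∀ τ : ℝ, 0 ≤ τ → x + τ • (x - c) ∈ frontier H → x + τ • (x - c) ∈ V) :
    ∃ k : ℂ ≃ₜ ℂ, (∀ x ∉ interior H, k x = x) ∧ ∀ x ∈ P, k x ∈ V := by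
  let e : ℂ ≃ₜ ℂ := Homeomorph.addRight c
  have he : ∀ x, e x = x + c := fun x => rfl
  obtain ⟨k, hk1, hk2⟩ := exists_push_zero (K := e ⁻¹' H) (P := e ⁻¹' P) (V := e ⁻¹' V)
    (hH.translate_preimage_left c) (e.isCompact_preimage.2 hHc)
    (by rw [← e.preimage_interior]; simpa [he] using hc) (e.isCompact_preimage.2 hP)
    (preimage_mono hPH) (by simpa [he] using hcP) (hV.preimage e.continuous)
    (fun x hx τ hτ hf => by
      rw [← e.preimage_frontier] at hf
      have := hexit (e x) hx τ hτ (by simpa [he, add_right_comm] using hf)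
      simpa [he, add_right_comm] using this)
  refine ⟨e.symm.trans (k.trans e), fun x hx => ?_, fun x hx => ?_⟩
  · have : k (e.symm x) = e.symm x := hk1 _ (by rw [← e.preimage_interior]; simpa using hx)
    simp [this]
  · simpa using hk2 (e.symm x) (by simpa using hx)

/-- The six linear forms cutting out the sectors of the hexagonal star. -/
def hexForm (i : Fin 6) (x : ℂ) : ℝ :=
  ![x.re - x.im, x.re, x.im, x.im - x.re, -x.re, -x.im] i

/-- The six forms in terms of two of them. -/
def hexComb (i : Fin 6) (p r : ℝ) : ℝ := ![p, p + r, r, -p, -p - r, -r] i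

theorem hexForm_add (a i : Fin 6) (x : ℂ) :
    hexForm (a + i) x = hexComb i (hexForm a x) (hexForm (a + 2) x) := by
  fin_cases a <;> fin_cases i <;> simp [hexForm, hexComb] <;> ring

theorem hexComb_cone {m : Fin 6} (hm : m ≠ 0) : ∃ (j : Fin 6) (α β : ℝ), ¬ j < m ∧
    (∀ a, hexForm a (lpt (hexDir (a + j))) = α ∧ hexForm (a + 2) (lpt (hexDir (a + j))) = β) ∧
    ∀ (p r s : ℝ) (i : Fin 6), 0 ≤ s → ¬ i < m → 0 < hexComb i p r → 0 < hexComb (i + 1) p r →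
      ∃ i', ¬ i' < m ∧ 0 < hexComb i' (p + s * α) (r + s * β) ∧
        0 < hexComb (i' + 1) (p + s * α) (r + s * β) := by
  have h3 : ∀ a, hexForm a (lpt (hexDir (a + 3))) = -1 ∧
      hexForm (a + 2) (lpt (hexDir (a + 3))) = 0 := by
    intro a; fin_cases a <;> simp [hexForm, hexDir]
  have h4 : ∀ a, hexForm a (lpt (hexDir (a + 4))) = 0 ∧
      hexForm (a + 2) (lpt (hexDir (a + 4))) = -1 := by
    intro a; fin_cases a <;> simp [hexForm, hexDir]
  have h5 : ∀ a, hexForm a (lpt (hexDir (a + 5))) = 1 ∧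
      hexForm (a + 2) (lpt (hexDir (a + 5))) = -1 := by
    intro a; fin_cases a <;> simp [hexForm, hexDir]
  have key : ∀ (j : Fin 6) (α β : ℝ), (m.val ≤ 3 ∧ α = -1 ∧ β = 0 ∨ m.val = 4 ∧ α = 0 ∧ β = -1 ∨
      m.val = 5 ∧ α = 1 ∧ β = -1) → ∀ (p r s : ℝ) (i : Fin 6), 0 ≤ s → ¬ i < m →
      0 < hexComb i p r → 0 < hexComb (i + 1) p r →
      ∃ i', ¬ i' < m ∧ 0 < hexComb i' (p + s * α) (r + s * β) ∧
        0 < hexComb (i' + 1) (p + s * α) (r + s * β) := by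
    intro j α β h p r s i hs hi h1 h2
    by_contra! hcon
    have c1 := hcon 1
    have c2 := hcon 2
    have c3 := hcon 3
    have c4 := hcon 4
    have c5 := hcon 5
    clear hcon
    fin_cases m <;> simp at hm h <;> obtain ⟨rfl, rfl⟩ := h <;> fin_cases i <;>
      simp [hexComb] at hi h1 h2 c1 c2 c3 c4 c5 <;> grind
  by_cases hm3 : m.val ≤ 3
  · exact ⟨3, -1, 0, by omega, h3, key 3 _ _ (Or.inl ⟨hm3, rfl, rfl⟩)⟩
  by_cases hm4 : m.val = 4
  · exact ⟨4, 0, -1, by omega, h4, key 4 _ _ (Or.inr (Or.inl ⟨hm4, rfl, rfl⟩))⟩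
  · exact ⟨5, 1, -1, by omega, h5, key 5 _ _ (Or.inr (Or.inr ⟨by omega, rfl, rfl⟩))⟩

theorem lnear_hexDir_iff {q : ℤ × ℤ} {x : ℂ} (hx : hexN (x - lpt q) ≤ 1) (i : Fin 6) :
    LNear x (q + hexDir i) ↔ 0 < hexForm i (x - lpt q) ∧ 0 < hexForm (i + 1) (x - lpt q) := by
  obtain ⟨y, rfl⟩ : ∃ y, x = lpt q + y := ⟨x - lpt q, by ring⟩
  rw [add_sub_cancel_left] at hx ⊢
  rw [hexN_le] at hx
  rw [lnear_iff]
  fin_cases i <;> simp [hexForm, hexDir] <;> grind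

theorem convex_hexN (c : ℂ) (r : ℝ) : Convex ℝ {x | hexN (x - c) ≤ r} := by
  intro x hx y hy a b ha hb hab
  simp only [mem_ofPred_eq, hexN_le, Complex.sub_re, Complex.sub_im, Complex.add_re, Complex.add_im,
    Complex.smul_re, Complex.smul_im, smul_eq_mul] at hx hy ⊢
  obtain rfl : b = 1 - a := by linarith
  refine ⟨⟨?_, ?_⟩, ⟨?_, ?_⟩, ?_, ?_⟩ <;> nlinarith

theorem hexForm_smul_add (i : Fin 6) (t s : ℝ) (x y : ℂ) :
    hexForm i (t • (x + s • y)) = t * (hexForm i x + s * hexForm i y) := by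
  fin_cases i <;> simp [hexForm] <;> ring

theorem exists_push_star {q : ℤ × ℤ} {Q : Finset (ℤ × ℤ)} (hq : q ∉ Q) (hr : RingContig q Q)
    {V : Set ℂ} (hV : IsOpen V) (hQV : lbody Q ⊆ V) :
    ∃ k : ℂ ≃ₜ ℂ, (∀ x, 1 < hexN (x - lpt q) → k x = x) ∧ ∀ x ∈ lbody (insert q Q), k x ∈ V := by
  obtain ⟨a, m, hm, hring⟩ := hr
  obtain ⟨j, α, β, hj, hw, hcone⟩ := hexComb_cone hm
  set w := lpt (hexDir (a + j)) with hwdef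
  have hjw : q + hexDir (a + j) ∉ Q := by rw [hring]; exact hj
  set H : Set ℂ := {x | hexN (x - lpt q) ≤ 1} with hH
  have hHcl : IsClosed H := isClosed_le (continuous_hexN.comp (by fun_prop)) continuous_const
  have hsub_int : {x | hexN (x - lpt q) < 1} ⊆ interior H :=
    interior_maximal (fun x (hx : hexN (x - lpt q) < 1) => hx.le) (isOpen_lnear q)
  have hHc : IsCompact H := by
    refine isCompact_of_isClosed_isBounded hHcl ((isBounded_closedBall (x := lpt q) (r := 2)).subset
      fun x hx => ?_)
    have hx := hexN_le.1 hx
    rw [mem_closedBall, dist_eq_norm]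
    refine (Complex.norm_le_abs_re_add_abs_im _).trans ?_
    have h1 : |(x - lpt q).re| ≤ 1 := abs_le.2 hx.1
    have h2 : |(x - lpt q).im| ≤ 1 := abs_le.2 hx.2.1
    linarith
  set c := lpt q + (1 / 2 : ℝ) • w with hc
  have hcint : hexN (c - lpt q) < 1 := by
    rw [hc, add_sub_cancel_left, hexN_lt, hwdef]
    generalize a + j = l
    fin_cases l <;> simp [hexDir] <;> norm_num
  have hcnear : LNear c (q + hexDir (a + j)) := by
    rw [lnear_iff, hc, hwdef]
    generalize a + j = l
    fin_cases l <;> simp [hexDir] <;> norm_num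
  have hcP : c ∉ lbody (insert q Q) := by
    intro h
    rcases Finset.mem_insert.1 (h _ hcnear) with h | h
    · exact hexDir_ne_zero _ (by simpa using h)
    · exact hjw h
  obtain ⟨k, hk1, hk2⟩ := exists_push (P := lbody (insert q Q) ∩ H) (V := V) (convex_hexN _ _) hHc
    (hsub_int hcint) ((isCompact_lbody _).inter_right hHcl) inter_subset_right (fun h => hcP h.1) hV
    (by
      rintro x ⟨hxQ, hxH⟩ τ hτ hy
      set y := x + τ • (x - c) with hydef
      have hy1 : hexN (y - lpt q) ≤ 1 := hHcl.frontier_subset hy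
      have hy2 : ¬ hexN (y - lpt q) < 1 := fun h => hy.2 (hsub_int h)
      refine hQV fun v hv => ?_
      have hqv : LAdj q v := by
        refine (eq_or_ladj_of_lt ?_ ?_ ?_ : q = v ∨ _).resolve_left fun e => hy2 (e ▸ hv) <;>
        · rw [hexN_le] at hy1
          rw [lnear_iff] at hv
          simp only [Complex.sub_re, Complex.sub_im, lpt_re, lpt_im] at hy1
          rw [abs_lt]
          constructor <;> linarith
      obtain ⟨l, rfl⟩ := hqv
      obtain ⟨i, rfl⟩ : ∃ i, l = a + i := ⟨l - a, by abel⟩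
      rw [hring]
      by_contra hi
      obtain ⟨hn1, hn2⟩ := (lnear_hexDir_iff hy1 _).1 hv
      rw [add_assoc, hexForm_add] at hn2
      rw [hexForm_add] at hn1
      obtain ⟨i', hi', hp1, hp2⟩ := hcone _ _ (τ / 2) i (by positivity) hi hn1 hn2
      have hxy : x - lpt q = (1 + τ)⁻¹ • ((y - lpt q) + (τ / 2) • w) := by
        rw [eq_inv_smul_iff₀ (by positivity), hydef, hc]
        simp only [Complex.real_smul]
        push_cast
        ring
      have hτ' : 0 < (1 + τ)⁻¹ := by positivity
      have e : ∀ l, hexForm (a + l) (x - lpt q) =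
          (1 + τ)⁻¹ * hexComb l (hexForm a (y - lpt q) + τ / 2 * α)
            (hexForm (a + 2) (y - lpt q) + τ / 2 * β) := by
        intro l
        rw [hxy, hexForm_smul_add, hexForm_add a l, hexForm_add a l, hwdef, (hw a).1, (hw a).2]
        congr 1
        fin_cases l <;> simp [hexComb] <;> ring
      have hxn : LNear x (q + hexDir (a + i')) := by
        rw [lnear_hexDir_iff hxH, add_assoc, e, e]
        exact ⟨by positivity, by positivity⟩
      rcases Finset.mem_insert.1 (hxQ _ hxn) with h | h
      · exact hexDir_ne_zero _ (by simpa using h)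
      · exact hi' ((hring i').1 h))
  refine ⟨k, fun x hx => hk1 x fun h => absurd (interior_subset h) (not_le.2 hx), fun x hx => ?_⟩
  by_cases hxH : x ∈ H
  · exact hk2 x ⟨hx, hxH⟩
  rw [hk1 x fun h => hxH (interior_subset h)]
  refine hQV fun v hv => (Finset.mem_insert.1 (hx v hv)).resolve_left ?_
  rintro rfl
  exact hxH (le_of_lt hv)

/-- A lattice body can be pushed into any neighbourhood of the filling of a connected set. -/
theorem exists_push_lbody {Q C : Finset (ℤ × ℤ)} (hQ : LConn Q) (hne : Q.Nonempty) (hC : LConn C)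
    (hchi : lchi C = 1) (hQC : lfill Q ⊆ C) {V : Set ℂ} (hV : IsOpen V)
    (hQV : lbody (lfill Q) ⊆ V) :
    ∃ h : ℂ ≃ₜ ℂ, (∀ x, (∀ q ∈ C \ lfill Q, 1 < hexN (x - lpt q)) → h x = x) ∧
      ∀ x ∈ lbody C, h x ∈ V := by
  refine shelling_induction (P := fun Q' => ∀ V : Set ℂ, IsOpen V → lbody (lfill Q) ⊆ V →
    ∃ h : ℂ ≃ₜ ℂ, (∀ x, (∀ q ∈ C \ lfill Q, 1 < hexN (x - lpt q)) → h x = x) ∧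
      ∀ x ∈ lbody Q', h x ∈ V) hQ hne hC hchi hQC ?_ ?_ V hV hQV
  · intro _ _ V _ hQV
    exact ⟨Homeomorph.refl _, fun _ _ => rfl, fun x hx => hQV hx⟩
  · intro q hq Q' hQ'C hqQ' hQQ' hring hP V hV hQV
    obtain ⟨h, hid, hh⟩ := hP V hV hQV
    obtain ⟨k, kid, hk⟩ := exists_push_star hqQ' hring (hV.preimage h.continuous) hh
    refine ⟨k.trans h, fun x hx => ?_, hk⟩
    simp [kid x (hx q hq), hid x hx]

theorem IsCompact.exists_infDist_subset {T U : Set ℂ} (hT : IsCompact T) (hne : T.Nonempty)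
    (hU : IsOpen U) (hTU : T ⊆ U) : ∃ δ > 0, {x | infDist x T ≤ δ} ⊆ U := by
  obtain ⟨δ, hδ, h⟩ := hT.exists_cthickening_subset_open hU hTU
  refine ⟨δ, hδ, fun x hx => h ?_⟩
  obtain ⟨y, hy, e⟩ := hT.exists_infDist_eq_dist hne x
  exact mem_cthickening_of_dist_le x y δ T hy (e ▸ hx)

theorem IsCompact.isCompact_infDist_le {T : Set ℂ} (hT : IsCompact T) (hne : T.Nonempty) (δ : ℝ) :
    IsCompact {x | infDist x T ≤ δ} := by
  refine hT.cthickening (r := δ) |>.of_isClosed_subset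
    (isClosed_le (continuous_infDist_pt T) continuous_const) fun x hx => ?_
  obtain ⟨y, hy, e⟩ := hT.exists_infDist_eq_dist hne x
  exact mem_cthickening_of_dist_le x y δ T hy (e ▸ hx)

/-- Multiplication by a nonzero real number. -/
def scaleHomeo (μ : ℝ) (hμ : μ ≠ 0) : ℂ ≃ₜ ℂ := Homeomorph.smulOfNeZero μ hμ

@[simp] theorem scaleHomeo_apply (μ : ℝ) (hμ : μ ≠ 0) (x : ℂ) : scaleHomeo μ hμ x = μ • x := rfl

theorem IsPreconnected.scale_preimage {μ : ℝ} (hμ : μ ≠ 0) {T : Set ℂ} (hT : IsPreconnected T) :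
    IsPreconnected {y : ℂ | μ • y ∈ T} := by
  have : {y : ℂ | μ • y ∈ T} = (scaleHomeo μ hμ).symm '' T := by
    rw [Homeomorph.image_symm]; rfl
  rw [this]
  exact hT.image _ (Homeomorph.continuous _).continuousOn

theorem Esc.scale {μ : ℝ} (hμ : 0 < μ) {T : Set ℂ} {z : ℂ} (h : Esc T (μ • z)) :
    Esc {y | μ • y ∈ T} z := by
  obtain ⟨S, hS, hz, hd, hb⟩ := h
  refine ⟨{y | μ • y ∈ S}, hS.scale_preimage hμ.ne', hz, ?_, fun hb' => hb ?_⟩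
  · rw [disjoint_left] at hd ⊢
    exact fun y hy hy' => hd hy hy'
  · have : S = (scaleHomeo μ hμ.ne') '' {y | μ • y ∈ S} :=
      (image_preimage_eq S (scaleHomeo μ hμ.ne').surjective).symm
    rw [this]
    exact hb'.smul₀ μ

theorem norm_le_of_hexN_le {z : ℂ} (h : hexN z ≤ 1) : ‖z‖ ≤ 2 := by
  rw [hexN_le] at h
  refine (Complex.norm_le_abs_re_add_abs_im _).trans ?_
  have h1 : |z.re| ≤ 1 := abs_le.2 h.1
  have h2 : |z.im| ≤ 1 := abs_le.2 h.2.1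
  linarith

theorem infDist_scale_le {T : Set ℂ} {μ : ℝ} (hμ : 0 < μ) (z w : ℂ) :
    infDist (μ • z) T ≤ infDist (μ • w) T + μ * ‖z - w‖ := by
  refine (infDist_le_infDist_add_dist (y := μ • w)).trans (le_of_eq ?_)
  rw [dist_eq_norm, ← smul_sub, norm_smul, Real.norm_of_nonneg hμ.le]

theorem IsLNbhd.infDist_le {T : Set ℂ} {μ : ℝ} (hμ : 0 < μ) {Q : Finset (ℤ × ℤ)}
    (hQ : IsLNbhd {y | μ • y ∈ T} Q) {z : ℂ} (hz : z ∈ lbody Q) : infDist (μ • z) T ≤ μ * 4 := by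
  obtain ⟨v, hv⟩ := exists_lnear z
  obtain ⟨x, hx, hxv⟩ := (hQ v).1 (hz v hv)
  have h1 := infDist_scale_le (T := T) hμ z x
  rw [infDist_zero_of_mem (show μ • x ∈ T from hx), zero_add] at h1
  refine h1.trans (mul_le_mul_of_nonneg_left ?_ hμ.le)
  have h2 : z - x = (z - lpt v) - (x - lpt v) := by ring
  rw [h2]
  refine (norm_sub_le _ _).trans ?_
  linarith [hv.norm_sub_lt, hxv.norm_sub_lt]

theorem Full.exists_lfill_near {T : Set ℂ} (hT : IsCompact T) (hne : T.Nonempty) (hfull : Full T)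
    {ε : ℝ} (hε : 0 < ε) : ∃ μ₀ > 0, ∀ μ : ℝ, 0 < μ → μ < μ₀ → ∀ Q, IsLNbhd {y | μ • y ∈ T} Q →
      ∀ v ∈ lfill Q, ∀ z, hexN (z - lpt v) ≤ 1 → infDist (μ • z) T < ε := by
  obtain ⟨δ, hδ, hesc⟩ := Full.exists_dist hT hne hfull (half_pos hε)
  refine ⟨min (δ / 4) (ε / 4), by positivity, fun μ hμ hlt Q hQ v hv z hz => ?_⟩
  have h1 := hlt.trans_le (min_le_left _ _)
  have h2 := hlt.trans_le (min_le_right _ _)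
  have h3 : infDist (μ • lpt v) T < ε / 2 := by
    by_contra! hcon
    refine Esc.notMem_lfill (((hesc _ hcon).scale hμ).mono fun z hz => ?_) hv
    have := hQ.infDist_le hμ hz
    show infDist (μ • z) T ≤ δ
    linarith
  have h4 := infDist_scale_le (T := T) hμ z (lpt v)
  have h5 := mul_le_mul_of_nonneg_left (norm_le_of_hexN_le hz) hμ.le
  linarith

/-- The planar squeezing theorem: if two non-separating continua meet in a continuum, then a
homeomorphism supported near the second one moves the union into any given neighbourhood of the
first one. -/
theorem exists_squeeze {Tx Tz o V : Set ℂ} (hx : IsCompact Tx) (hxc : IsPreconnected Tx)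
    (hxf : Full Tx) (hz : IsCompact Tz) (hzc : IsPreconnected Tz) (hzf : Full Tz)
    (hI : IsPreconnected (Tx ∩ Tz)) (hIne : (Tx ∩ Tz).Nonempty) {ρ : ℝ} (hρ : 0 < ρ)
    (hdist : ∀ x ∈ Tx \ Tz, ∀ z ∈ Tz \ Tx, ρ ≤ dist x z) (ho : IsOpen o) (hzo : Tz ⊆ o)
    (hV : IsOpen V) (hxV : Tx ⊆ V) :
    ∃ h : ℂ ≃ₜ ℂ, (∃ κ ⊆ o, IsCompact κ ∧ ∀ x ∉ κ, h x = x) ∧ ∀ x ∈ Tx ∪ Tz, h x ∈ V := by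
  obtain ⟨εx, hεx, hεxV⟩ := hx.exists_infDist_subset (hIne.mono inter_subset_left) hV hxV
  obtain ⟨εz, hεz, hεzo⟩ := hz.exists_infDist_subset (hIne.mono inter_subset_right) ho hzo
  obtain ⟨μx, hμx, hnx⟩ := hxf.exists_lfill_near hx (hIne.mono inter_subset_left) hεx
  obtain ⟨μz, hμz, hnz⟩ := hzf.exists_lfill_near hz (hIne.mono inter_subset_right) hεz
  obtain ⟨μ, hμ, hlt⟩ := exists_between (show 0 < min (min μx μz) (ρ / 6) by positivity)
  have hltx := hlt.trans_le ((min_le_left _ _).trans (min_le_left _ _))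
  have hltz := hlt.trans_le ((min_le_left _ _).trans (min_le_right _ _))
  have hltρ := hlt.trans_le (min_le_right _ _)
  have hcomp : ∀ T, IsCompact T → IsCompact {y : ℂ | μ • y ∈ T} := fun T hT =>
    (scaleHomeo μ hμ.ne').isCompact_preimage.2 hT
  obtain ⟨X, hX⟩ := exists_isLNbhd (hcomp Tx hx).isBounded
  obtain ⟨Z, hZ⟩ := exists_isLNbhd (hcomp Tz hz).isBounded
  have hXZ : IsLNbhd {y : ℂ | μ • y ∈ Tx ∪ Tz} (X ∪ Z) := by
    intro v
    rw [Finset.mem_union, hX, hZ]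
    constructor
    · rintro (⟨x, hx, h⟩ | ⟨x, hx, h⟩)
      · exact ⟨x, Or.inl hx, h⟩
      · exact ⟨x, Or.inr hx, h⟩
    · rintro ⟨x, hx | hx, h⟩
      · exact Or.inl ⟨x, hx, h⟩
      · exact Or.inr ⟨x, hx, h⟩
  have hfar : ∀ x ∈ {y : ℂ | μ • y ∈ Tx \ Tz}, ∀ z ∈ {y : ℂ | μ • y ∈ Tz \ Tx}, 6 < ‖x - z‖ := by
    intro x hx z hz
    have := hdist _ hx _ hz
    rw [dist_eq_norm, ← smul_sub, norm_smul, Real.norm_of_nonneg hμ.le] at this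
    by_contra! hcon
    have := mul_le_mul_of_nonneg_left hcon hμ.le
    linarith
  have hXIZ : IsLNbhd {y : ℂ | μ • y ∈ Tx ∩ Tz} (X ∩ Z) := by
    intro v
    rw [Finset.mem_inter, hX, hZ]
    constructor
    · rintro ⟨⟨x, hx, hxv⟩, z, hz, hzv⟩
      by_cases hx' : μ • x ∈ Tz
      · exact ⟨x, ⟨hx, hx'⟩, hxv⟩
      by_cases hz' : μ • z ∈ Tx
      · exact ⟨z, ⟨hz', hz⟩, hzv⟩
      exfalso
      have h1 := hfar x ⟨hx, hx'⟩ z ⟨hz, hz'⟩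
      rw [show x - z = (x - lpt v) - (z - lpt v) by ring] at h1
      linarith [norm_sub_le (x - lpt v) (z - lpt v), hxv.norm_sub_lt, hzv.norm_sub_lt]
    · rintro ⟨x, hx, h⟩
      exact ⟨⟨x, hx.1, h⟩, x, hx.2, h⟩
  have hbody : lbody (X ∪ Z) = lbody X ∪ lbody Z := by
    refine lbody_union fun a ha b hb hab => ?_
    rw [Finset.mem_sdiff, hX, hZ] at ha
    rw [Finset.mem_sdiff, hX, hZ] at hb
    obtain ⟨⟨x, hx, hxa⟩, ha⟩ := ha
    obtain ⟨⟨z, hz, hzb⟩, hb⟩ := hb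
    have h1 := hfar x ⟨hx, fun h => ha ⟨x, h, hxa⟩⟩ z ⟨hz, fun h => hb ⟨z, h, hzb⟩⟩
    rw [show x - z = (x - lpt a) - (z - lpt b) + (lpt a - lpt b) by ring] at h1
    have h2 : ‖lpt a - lpt b‖ ≤ 2 := by
      obtain ⟨i, rfl⟩ := hab
      refine norm_le_of_hexN_le ?_
      rw [hexN_le, lpt_add]
      fin_cases i <;> simp [hexDir]
    linarith [norm_add_le ((x - lpt a) - (z - lpt b)) (lpt a - lpt b),
      norm_sub_le (x - lpt a) (z - lpt b), hxa.norm_sub_lt, hzb.norm_sub_lt]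
  have hXc := hX.lconn (hxc.scale_preimage hμ.ne')
  have hne' : ∀ T : Set ℂ, T.Nonempty → {y : ℂ | μ • y ∈ T}.Nonempty := by
    rintro T ⟨t, ht⟩
    exact ⟨μ⁻¹ • t, by simpa [smul_smul, hμ.ne'] using ht⟩
  have hXne := hX.nonempty (hne' _ (hIne.mono inter_subset_left))
  have hXZc := hXZ.lconn ((IsPreconnected.union' hIne hxc hzc).scale_preimage hμ.ne')
  have hXZne : (X ∪ Z).Nonempty := hXne.mono Finset.subset_union_left
  have hCZ : ∀ q ∈ lfill (X ∪ Z) \ lfill X, q ∈ lfill Z := by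
    intro q hq
    rw [Finset.mem_sdiff] at hq
    by_contra hqZ
    refine Esc.notMem_lfill ?_ hq.1
    rw [hbody]
    refine Esc.union (isCompact_lbody _) (isCompact_lbody _) ?_ (esc_lbody_of_notMem_lfill hq.2)
      (esc_lbody_of_notMem_lfill hqZ)
    rw [← lbody_inter]
    exact hXIZ.isPreconnected_lbody (hI.scale_preimage hμ.ne')
  let e := scaleHomeo μ hμ.ne'
  obtain ⟨h, hid, hh⟩ := exists_push_lbody hXc hXne (lconn_lfill hXZc) (lchi_lfill hXZc hXZne)
    (lfill_mono Finset.subset_union_left) (V := e ⁻¹' V) (hV.preimage e.continuous) (by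
      intro y hy
      obtain ⟨v, hv⟩ := exists_lnear y
      exact hεxV (hnx μ hμ hltx X hX v (hy v hv) y (le_of_lt hv)).le)
  refine ⟨e.symm.trans (h.trans e), ⟨_, hεzo,
    hz.isCompact_infDist_le (hIne.mono inter_subset_right) _, fun x hx => ?_⟩, fun x hx => ?_⟩
  · have : h (e.symm x) = e.symm x := by
      refine hid _ fun q hq => ?_
      by_contra! hcon
      have := hnz μ hμ hltz Z hZ q (hCZ q hq) _ hcon
      rw [show μ • e.symm x = x from e.apply_symm_apply x] at this
      exact hx this.le
    simp [this]
  · refine hh _ (lbody_mono (subset_lfill _) (hXZ.subset_lbody ?_))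
    show μ • e.symm x ∈ Tx ∪ Tz
    rwa [show μ • e.symm x = x from e.apply_symm_apply x]

/-- The maps `f` and `g` are mutually inverse homeomorphisms between the sets `A` and `B`. -/
structure HomeoPair {X Y : Type*} [TopologicalSpace X] [TopologicalSpace Y] (f : X → Y)
    (g : Y → X) (A : Set X) (B : Set Y) : Prop where
  contf : ContinuousOn f A
  contg : ContinuousOn g B
  mapsf : MapsTo f A B
  mapsg : MapsTo g B A
  left : ∀ x ∈ A, g (f x) = x
  right : ∀ y ∈ B, f (g y) = y

namespace HomeoPair

variable {X Y Z : Type*} [TopologicalSpace X] [TopologicalSpace Y] [TopologicalSpace Z]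
  {f : X → Y} {g : Y → X} {A : Set X} {B : Set Y}

/-- The homeomorphism of subtypes. -/
def toHomeo (h : HomeoPair f g A B) : A ≃ₜ B where
  toFun := h.mapsf.restrict
  invFun := h.mapsg.restrict
  left_inv x := Subtype.ext (h.left x x.2)
  right_inv x := Subtype.ext (h.right x x.2)
  continuous_toFun := h.contf.mapsToRestrict h.mapsf
  continuous_invFun := h.contg.mapsToRestrict h.mapsg

theorem trans (h : HomeoPair f g A B) {f' : Y → Z} {g' : Z → Y} {C : Set Z}
    (h' : HomeoPair f' g' B C) : HomeoPair (f' ∘ f) (g ∘ g') A C where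
  contf := h'.contf.comp h.contf h.mapsf
  contg := h.contg.comp h'.contg h'.mapsg
  mapsf := h'.mapsf.comp h.mapsf
  mapsg := h.mapsg.comp h'.mapsg
  left x hx := by simp [h'.left _ (h.mapsf hx), h.left x hx]
  right x hx := by simp [h.right _ (h'.mapsg hx), h'.right x hx]

theorem restrict (h : HomeoPair f g A B) {A' : Set X} {B' : Set Y} (hA : A' ⊆ A) (hB : B' ⊆ B)
    (hf : MapsTo f A' B') (hg : MapsTo g B' A') : HomeoPair f g A' B' :=
  ⟨h.contf.mono hA, h.contg.mono hB, hf, hg, fun x hx => h.left x (hA hx),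
    fun y hy => h.right y (hB hy)⟩

/-- A homeomorphism between complements which is the identity off `o` restricts to any set
containing `o`. -/
theorem diff {f g : X → X} {T T' o G : Set X} (h : HomeoPair f g Tᶜ T'ᶜ) (hT : T ⊆ o)
    (hf : ∀ x ∉ o, f x = x) (hoG : o ⊆ G) :
    HomeoPair f g (G \ T) (G \ T') := by
  have hg : ∀ x ∉ o, g x = x := fun x hx => by
    have := h.left x fun hx' => hx (hT hx')
    rwa [hf x hx] at this
  refine h.restrict (fun x hx => hx.2) (fun x hx => hx.2) (fun x hx => ⟨?_, h.mapsf hx.2⟩)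
    fun x hx => ⟨?_, h.mapsg hx.2⟩
  · by_contra hcon
    have h1 := h.left x hx.2
    rw [hg _ fun h' => hcon (hoG h')] at h1
    exact hcon (by rw [h1]; exact hx.1)
  · by_contra hcon
    have h1 := h.right x hx.2
    rw [hf _ fun h' => hcon (hoG h')] at h1
    exact hcon (by rw [h1]; exact hx.1)

end HomeoPair

section Lim

variable {X : Type*}

/-- The pointwise limit of a sequence of maps that stabilises off a decreasing sequence of sets. -/
def limFun (k : ℕ → X → X) (O : ℕ → Set X) (x : X) : X :=
  if h : ∃ n, x ∉ O n then k h.choose x else x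

theorem limFun_eq {k : ℕ → X → X} {O : ℕ → Set X} (hO : Antitone O)
    (hk : ∀ n, ∀ x ∉ O n, k (n + 1) x = k n x) {n : ℕ} {x : X} (hx : x ∉ O n) :
    limFun k O x = k n x := by
  have key : ∀ m n x, n ≤ m → x ∉ O n → k m x = k n x := by
    intro m n x hnm
    induction m, hnm using Nat.le_induction with
    | base => simp
    | succ m hm ih =>
      intro hx
      rw [hk m x fun h => hx (hO hm h), ih hx]
  have h : ∃ n, x ∉ O n := ⟨n, hx⟩
  rw [limFun, dif_pos h]
  rcases le_total n h.choose with h' | h'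
  · exact key _ _ _ h' hx
  · exact (key _ _ _ h' h.choose_spec).symm

theorem exists_limit_homeo [TopologicalSpace X] {k : ℕ → X ≃ₜ X} {O : ℕ → Set X} {T T' : Set X} (hO : Antitone O)
    (hk : ∀ n, ∀ x ∉ O n, k (n + 1) x = k n x) (hT : ∀ n, T ⊆ O n)
    (hTO : ∀ x ∉ T, ∃ n, (O n)ᶜ ∈ 𝓝 x) (hT' : ∀ n, T' ⊆ k n '' O n)
    (hTO' : ∀ y ∉ T', ∃ n, (k n '' O n)ᶜ ∈ 𝓝 y) :
    ∃ f g : X → X, HomeoPair f g Tᶜ T'ᶜ ∧ ∀ x ∉ O 0, f x = k 0 x := by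
  have hk' : ∀ n, ∀ y ∉ k n '' O n, (k (n + 1)).symm y = (k n).symm y := by
    intro n y hy
    have h1 : (k n).symm y ∉ O n := fun h => hy ⟨_, h, by simp⟩
    have h2 := hk n _ h1
    rw [Homeomorph.apply_symm_apply] at h2
    rw [Homeomorph.symm_apply_eq, h2]
  have hW : Antitone fun n => k n '' O n := by
    refine antitone_nat_of_succ_le fun n => ?_
    rintro _ ⟨x, hx, rfl⟩
    by_contra hcon
    have h1 := hk' n _ hcon
    rw [Homeomorph.symm_apply_apply] at h1
    exact hcon ⟨x, hO (Nat.le_succ n) hx, ((k n).symm_apply_eq.1 h1.symm).symm⟩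
  set f := limFun (fun n => k n) O with hf
  set g := limFun (fun n => (k n).symm) (fun n => k n '' O n) with hg
  have hfe : ∀ n x, x ∉ O n → f x = k n x := fun n x hx => limFun_eq hO hk hx
  have hge : ∀ n y, y ∉ k n '' O n → g y = (k n).symm y := fun n y hy => limFun_eq hW hk' hy
  refine ⟨f, g, ⟨fun x hx => ?_, fun y hy => ?_, fun x hx => ?_, fun y hy => ?_, fun x hx => ?_,
    fun y hy => ?_⟩, fun x hx => hfe 0 x hx⟩
  · obtain ⟨n, hn⟩ := hTO x hx
    exact ((k n).continuous.continuousAt.congr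
      (by filter_upwards [hn] with z hz using (hfe n z hz).symm)).continuousWithinAt
  · obtain ⟨n, hn⟩ := hTO' y hy
    exact ((k n).symm.continuous.continuousAt.congr
      (by filter_upwards [hn] with z hz using (hge n z hz).symm)).continuousWithinAt
  · obtain ⟨n, hn⟩ := hTO x hx
    rw [hfe n x (mem_of_mem_nhds hn)]
    exact fun h => mem_of_mem_nhds hn (by simpa using hT' n h)
  · obtain ⟨n, hn⟩ := hTO' y hy
    rw [hge n y (mem_of_mem_nhds hn)]
    exact fun h => mem_of_mem_nhds hn ⟨_, hT n h, by simp⟩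
  · obtain ⟨n, hn⟩ := hTO x hx
    rw [hfe n x (mem_of_mem_nhds hn), hge n, Homeomorph.symm_apply_apply]
    exact fun h => mem_of_mem_nhds hn (by simpa using h)
  · obtain ⟨n, hn⟩ := hTO' y hy
    rw [hge n y (mem_of_mem_nhds hn), hfe n, Homeomorph.apply_symm_apply]
    exact fun h => mem_of_mem_nhds hn ⟨_, h, by simp⟩

end Lim

theorem exists_seq_step {α : Type*} {P : α → Prop} {R : ℕ → α → α → Prop} (a₀ : α) (h₀ : P a₀)
    (h : ∀ n a, P a → ∃ b, P b ∧ R n a b) :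
    ∃ s : ℕ → α, s 0 = a₀ ∧ ∀ n, P (s n) ∧ R n (s n) (s (n + 1)) := by
  choose! F hF using h
  let s : ℕ → α := fun n => Nat.rec a₀ (fun n a => F n a) n
  have hs : ∀ n, P (s n) := fun n => by
    induction n with
    | zero => exact h₀
    | succ n ih => exact (hF n _ ih).1
  exact ⟨s, rfl, fun n => ⟨hs n, (hF n _ (hs n)).2⟩⟩

theorem full_singleton (a : ℂ) : Full {a} :=
  Full.of_section isCompact_singleton (fun _ => a) id continuous_const (fun _ => rfl)
    continuousOn_id fun _ hx => (mem_singleton_iff.1 hx).symm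

/-- The complement of a non-separating continuum is homeomorphic to the complement of a point. -/
theorem exists_shrink {T o : Set ℂ} (hT : IsCompact T) (hTc : IsPreconnected T) (hTf : Full T)
    (hne : T.Nonempty) (ho : IsOpen o) (hTo : T ⊆ o) :
    ∃ p ∈ o, ∃ f g : ℂ → ℂ, HomeoPair f g Tᶜ {p}ᶜ ∧ ∀ x ∉ o, f x = x := by
  obtain ⟨a, ha⟩ := hne
  obtain ⟨s, hs0, hs⟩ := exists_seq_step (α := (ℂ ≃ₜ ℂ) × Set ℂ)
    (P := fun b => IsOpen b.2 ∧ T ⊆ b.2)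
    (R := fun n b b' => (∀ x ∉ b.2, b'.1 x = b.1 x) ∧ closure b'.2 ⊆ b.2 ∧
      IsCompact (closure b'.2) ∧ b'.2 ⊆ thickening (1 / (n + 1)) T ∧
      ∀ x ∈ b'.2, ∀ y ∈ b'.2, dist (b'.1 x) (b'.1 y) < 1 / (n + 1))
    (Homeomorph.refl ℂ, o) ⟨ho, hTo⟩ (by
      rintro n ⟨k, O⟩ ⟨hO, hTO⟩
      have hpos : (0 : ℝ) < 1 / (n + 1) := Nat.one_div_pos_of_nat
      obtain ⟨h, ⟨κ, hκ, -, hid⟩, hh⟩ := exists_squeeze (Tx := {a}) (Tz := T) (o := O)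
        (V := k ⁻¹' ball (k a) (1 / (n + 1) / 2)) isCompact_singleton isPreconnected_singleton
        (full_singleton a) hT hTc hTf
        ((subsingleton_singleton.anti inter_subset_left).isPreconnected) ⟨a, rfl, ha⟩ one_pos
        (by rintro x ⟨rfl, hx⟩; exact absurd ha hx) hO hTO
        (isOpen_ball.preimage k.continuous) (by simpa using half_pos hpos)
      obtain ⟨O', hO', hTO', hcl, hco⟩ := exists_open_between_and_isCompact_closure (K := T)
        (U := O ∩ (thickening (1 / (n + 1)) T ∩ (h.trans k) ⁻¹' ball (k a) (1 / (n + 1) / 2)))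
        hT (hO.inter (isOpen_thickening.inter (isOpen_ball.preimage (h.trans k).continuous)))
        fun x hx => ⟨hTO hx, self_subset_thickening hpos _ hx, hh x (Or.inr hx)⟩
      refine ⟨(h.trans k, O'), ⟨hO', hTO'⟩, fun x hx => ?_, hcl.trans inter_subset_left, hco,
        fun x hx => (hcl (subset_closure hx)).2.1, fun x hx y hy => ?_⟩
      · simp [hid x fun h' => hx (hκ h')]
      · have h1 := (hcl (subset_closure hx)).2.2
        have h2 := (hcl (subset_closure hy)).2.2
        simp only [mem_preimage, mem_ball] at h1 h2
        linarith [dist_triangle_right ((h.trans k) x) ((h.trans k) y) (k a)])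
  have hstep := fun n => (hs n).2
  have hTs := fun n => (hs n).1.2
  have hO : Antitone fun n => (s n).2 :=
    antitone_nat_of_succ_le fun n => subset_closure.trans (hstep n).2.1
  have himg : ∀ n, (s (n + 1)).1 '' (closure (s (n + 1)).2) ⊆ (s n).1 '' (s n).2 := by
    rintro n _ ⟨x, hx, rfl⟩
    by_contra hcon
    have h1 : (s n).1.symm ((s (n + 1)).1 x) ∉ (s n).2 := fun h => hcon ⟨_, h, by simp⟩
    have h2 := (hstep n).1 _ h1
    rw [Homeomorph.apply_symm_apply, (s (n + 1)).1.injective.eq_iff] at h2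
    exact h1 (by rw [h2]; exact (hstep n).2.1 hx)
  obtain ⟨p, hp⟩ := IsCompact.nonempty_iInter_of_sequence_nonempty_isCompact_isClosed
    (fun n => (s (n + 1)).1 '' (closure (s (n + 1)).2))
    (fun n => (himg (n + 1)).trans (image_mono subset_closure))
    (fun n => ⟨_, mem_image_of_mem _ (subset_closure (hTs (n + 1) ha))⟩)
    ((hstep 0).2.2.1.image (s 1).1.continuous)
    (fun n => ((hstep n).2.2.1.image (s (n + 1)).1.continuous).isClosed)
  have hp' : ∀ n, p ∈ (s n).1 '' (s n).2 := fun n => himg n (mem_iInter.1 hp n)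
  obtain ⟨f, g, hfg, hf0⟩ := exists_limit_homeo (T := T) (T' := {p}) (k := fun n => (s n).1) hO
    (fun n => (hstep n).1) hTs (fun x hx => by
      have hpos : 0 < infDist x T := (hT.isClosed.notMem_iff_infDist_pos ⟨a, ha⟩).1 hx
      obtain ⟨n, hn⟩ := exists_nat_one_div_lt hpos
      refine ⟨n + 1, ?_⟩
      have : IsOpen {y | 1 / ((n : ℝ) + 1) < infDist y T} :=
        isOpen_lt continuous_const (continuous_infDist_pt T)
      filter_upwards [this.mem_nhds hn] with y hy hy'
      have h1 := (hstep n).2.2.2.1 hy'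
      rw [mem_thickening_iff_infDist_lt ⟨a, ha⟩] at h1
      exact absurd h1 (not_lt.2 (le_of_lt hy)))
    (fun n => by simpa using hp' n)
    (fun y hy => by
      obtain ⟨n, hn⟩ := exists_nat_one_div_lt (dist_pos.2 hy)
      refine ⟨n + 1, ?_⟩
      have : IsOpen {z | 1 / ((n : ℝ) + 1) < dist z p} :=
        isOpen_lt continuous_const (by fun_prop)
      filter_upwards [this.mem_nhds hn] with z hz hz'
      obtain ⟨x, hx, rfl⟩ := hz'
      obtain ⟨w, hw, rfl⟩ := hp' (n + 1)
      exact absurd ((hstep n).2.2.2.2 x hx w hw) (not_lt.2 (le_of_lt hz)))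
  refine ⟨p, ?_, f, g, hfg, fun x hx => ?_⟩
  · simpa [hs0] using hp' 0
  · simpa [hs0] using hf0 x (by simpa [hs0] using hx)

/-- The complement of a point is homeomorphic to the complement of a disc. -/
theorem exists_inflate (p : ℂ) {r : ℝ} (hr : 0 < r) :
    ∃ f g : ℂ → ℂ, HomeoPair f g {p}ᶜ (closedBall p r)ᶜ ∧ ∀ x, 2 * r ≤ dist x p → f x = x := by
  let F : (ℝ → ℝ) → ℂ → ℂ := fun ρ x => p + (ρ ‖x - p‖ / ‖x - p‖) • (x - p)
  have hnorm : ∀ ρ x, x ≠ p → 0 ≤ ρ ‖x - p‖ → ‖F ρ x - p‖ = ρ ‖x - p‖ := by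
    intro ρ x hx h0
    have h1 : 0 < ‖x - p‖ := norm_pos_iff.2 (sub_ne_zero.2 hx)
    simp only [F, add_sub_cancel_left]
    rw [norm_smul, Real.norm_of_nonneg (by positivity), div_mul_cancel₀ _ h1.ne']
  have hcomp : ∀ ρ σ x, x ≠ p → 0 < ρ ‖x - p‖ → σ (ρ ‖x - p‖) = ‖x - p‖ → F σ (F ρ x) = x := by
    intro ρ σ x hx h0 h1
    have h2 : ‖x - p‖ ≠ 0 := norm_ne_zero_iff.2 (sub_ne_zero.2 hx)
    have h3 : F σ (F ρ x) = p + (σ ‖F ρ x - p‖ / ‖F ρ x - p‖) • (F ρ x - p) := rfl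
    rw [h3, hnorm ρ x hx h0.le, h1]
    simp only [F, add_sub_cancel_left, smul_smul]
    rw [div_mul_div_cancel₀ h0.ne', div_self h2, one_smul]; ring
  have hcont : ∀ ρ, Continuous ρ → ContinuousOn (F ρ) {p}ᶜ := by
    intro ρ hρ x hx
    have h2 : ‖x - p‖ ≠ 0 := norm_ne_zero_iff.2 (sub_ne_zero.2 hx)
    refine ContinuousAt.continuousWithinAt ?_
    have h3 : ContinuousAt (fun x => ρ ‖x - p‖ / ‖x - p‖) x :=
      ContinuousAt.div (by fun_prop) (by fun_prop) h2
    have h4 : ContinuousAt (fun x : ℂ => x - p) x := by fun_prop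
    exact continuousAt_const.add (h3.smul h4)
  let ρ : ℝ → ℝ := fun t => max t (r + t / 2)
  let σ : ℝ → ℝ := fun t => min t (2 * (t - r))
  have hne : ∀ x ∈ (closedBall p r)ᶜ, x ≠ p := by
    rintro x hx rfl
    exact hx (mem_closedBall_self hr.le)
  have hlt : ∀ x ∈ (closedBall p r)ᶜ, r < ‖x - p‖ := fun x hx => by
    simpa [dist_eq_norm] using hx
  have hpos : ∀ x : ℂ, x ≠ p → 0 < ‖x - p‖ := fun x hx => norm_pos_iff.2 (sub_ne_zero.2 hx)
  have hρ : ∀ t, 0 < t → r < ρ t ∧ σ (ρ t) = t := by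
    intro t ht
    simp only [ρ, σ]
    constructor
    · exact lt_max_of_lt_right (by linarith)
    · rcases le_total t (r + t / 2) with h | h
      · rw [max_eq_right h, min_eq_right] <;> linarith
      · rw [max_eq_left h, min_eq_left]; linarith
  have hσ : ∀ t, r < t → 0 < σ t ∧ ρ (σ t) = t := by
    intro t ht
    simp only [ρ, σ]
    constructor
    · exact lt_min (by linarith) (by linarith)
    · rcases le_total t (2 * (t - r)) with h | h
      · rw [min_eq_left h, max_eq_left]; linarith
      · rw [min_eq_right h, max_eq_right] <;> linarith
  refine ⟨F ρ, F σ, ⟨hcont ρ (by fun_prop), (hcont σ (by fun_prop)).mono fun x hx => hne x hx,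
    fun x hx => ?_, fun x hx => ?_, fun x hx => ?_, fun x hx => ?_⟩, fun x hx => ?_⟩
  · obtain ⟨h1, -⟩ := hρ _ (hpos x hx)
    rw [mem_compl_iff, mem_closedBall, dist_eq_norm, hnorm ρ x hx (hr.le.trans h1.le)]
    exact not_le.2 h1
  · obtain ⟨h1, -⟩ := hσ _ (hlt x hx)
    intro h
    rw [mem_singleton_iff, ← sub_eq_zero, ← norm_eq_zero, hnorm σ x (hne x hx) h1.le] at h
    exact h1.ne' h
  · obtain ⟨h1, h2⟩ := hρ _ (hpos x hx)
    exact hcomp ρ σ x hx (hr.trans h1) h2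
  · obtain ⟨h1, h2⟩ := hσ _ (hlt x hx)
    exact hcomp σ ρ x (hne x hx) h1 h2
  · rw [dist_eq_norm] at hx
    have : ρ ‖x - p‖ = ‖x - p‖ := max_eq_left (by linarith)
    simp only [F]
    rw [this, div_self (by linarith), one_smul]; ring

theorem exists_replace_disc {T o : Set ℂ} (hT : IsCompact T) (hTc : IsPreconnected T)
    (hTf : Full T) (hne : T.Nonempty) (ho : IsOpen o) (hTo : T ⊆ o) :
    ∃ (p : ℂ) (r : ℝ), 0 < r ∧ closedBall p r ⊆ o ∧
      ∃ f g : ℂ → ℂ, HomeoPair f g Tᶜ (closedBall p r)ᶜ ∧ ∀ x ∉ o, f x = x := by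
  obtain ⟨p, hp, f, g, hfg, hf⟩ := exists_shrink hT hTc hTf hne ho hTo
  obtain ⟨r, hr, hro⟩ := Metric.isOpen_iff.1 ho p hp
  obtain ⟨f', g', hfg', hf'⟩ := exists_inflate p (half_pos hr)
  refine ⟨p, r / 2, half_pos hr, (closedBall_subset_ball (by linarith)).trans hro, _, _,
    hfg.trans hfg', fun x hx => ?_⟩
  have : r ≤ dist x p := not_lt.1 fun h => hx (hro h)
  rw [Function.comp_apply, hf x hx, hf' x (by linarith)]

/-- Disjoint non-separating continua in an open set can be replaced by disjoint round discs. -/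
theorem exists_discs {ι : Type*} [Finite ι] {B : Set ℂ} (hB : IsOpen B) (T : ι → Set ℂ)
    (hT : ∀ i, IsCompact (T i)) (hTc : ∀ i, IsPreconnected (T i)) (hTf : ∀ i, Full (T i))
    (hne : ∀ i, (T i).Nonempty) (hTB : ∀ i, T i ⊆ B)
    (hd : ∀ i j, i ≠ j → Disjoint (T i) (T j)) :
    ∃ (c : ι → ℂ) (r : ι → ℝ), (∀ i, 0 < r i) ∧ (∀ i, closedBall (c i) (r i) ⊆ B) ∧
      (∀ i j, i ≠ j → Disjoint (closedBall (c i) (r i)) (closedBall (c j) (r j))) ∧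
      Nonempty ((B \ ⋃ i, T i : Set ℂ) ≃ₜ (B \ ⋃ i, closedBall (c i) (r i) : Set ℂ)) := by
  have := Fintype.ofFinite ι
  have hdn : Pairwise (Function.onFun Disjoint fun i => 𝓝ˢ (T i)) := fun i j hij =>
    (SeparatedNhds.of_isCompact_isCompact (hT i) (hT j) (hd i j hij)).disjoint_nhdsSet
  obtain ⟨U, hU, hUd⟩ := hdn.exists_mem_filter_of_disjoint
  have : ∀ i, ∃ o, IsOpen o ∧ T i ⊆ o ∧ o ⊆ U i := fun i => mem_nhdsSet_iff_exists.1 (hU i)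
  choose o ho hTo hoU using this
  have hod : ∀ i j, i ≠ j → Disjoint (o i) (o j) := fun i j hij =>
    (hUd hij).mono (hoU i) (hoU j)
  choose c r hr hcr f g hfg hf using fun i => exists_replace_disc (hT i) (hTc i) (hTf i) (hne i)
    ((ho i).inter hB) (subset_inter (hTo i) (hTB i))
  refine ⟨c, r, hr, fun i => (hcr i).trans inter_subset_right, fun i j hij =>
    (hod i j hij).mono ((hcr i).trans inter_subset_left) ((hcr j).trans inter_subset_left), ?_⟩
  let D : Finset ι → ι → Set ℂ := fun S i => if i ∈ S then closedBall (c i) (r i) else T i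
  have hDo : ∀ S i, D S i ⊆ o i := by
    intro S i
    by_cases h : i ∈ S
    · simpa [D, h] using (hcr i).trans inter_subset_left
    · simpa [D, h] using hTo i
  have key : ∀ S : Finset ι, Nonempty ((B \ ⋃ i, T i : Set ℂ) ≃ₜ (B \ ⋃ i, D S i : Set ℂ)) := by
    intro S
    induction S using Finset.induction_on with
    | empty => exact ⟨Homeomorph.setCongr (by simp [D])⟩
    | insert j S hj ih =>
      obtain ⟨e⟩ := ih
      let G := B \ ⋃ i, ⋃ _ : i ≠ j, D S i
      have h1 : B \ ⋃ i, D S i = G \ T j := by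
        ext x
        simp only [G, Set.mem_sdiff, mem_iUnion, not_exists]
        constructor
        · rintro ⟨hx, h⟩
          exact ⟨⟨hx, fun i _ => h i⟩, by simpa [D, hj] using h j⟩
        · rintro ⟨⟨hx, h⟩, hxj⟩
          refine ⟨hx, fun i => ?_⟩
          by_cases hij : i = j
          · subst hij; simpa [D, hj] using hxj
          · exact h i hij
      have h2 : B \ ⋃ i, D (insert j S) i = G \ closedBall (c j) (r j) := by
        have hD : ∀ i, i ≠ j → D (insert j S) i = D S i := fun i hij => by simp [D, hij]
        ext x
        simp only [G, Set.mem_sdiff, mem_iUnion, not_exists]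
        constructor
        · rintro ⟨hx, h⟩
          exact ⟨⟨hx, fun i hij => by simpa [hD i hij] using h i⟩, by simpa [D] using h j⟩
        · rintro ⟨⟨hx, h⟩, hxj⟩
          refine ⟨hx, fun i => ?_⟩
          by_cases hij : i = j
          · subst hij; simpa [D] using hxj
          · simpa [hD i hij] using h i hij
      have hoG : o j ∩ B ⊆ G := by
        rintro x ⟨hx, hxB⟩
        refine ⟨hxB, ?_⟩
        simp only [mem_iUnion, not_exists]
        exact fun i hij hxi => disjoint_left.1 (hod i j hij) (hDo S i hxi) hx
      have h3 := (hfg j).diff (subset_inter (hTo j) (hTB j)) (hf j) hoG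
      exact ⟨e.trans ((Homeomorph.setCongr h1).trans
        (h3.toHomeo.trans (Homeomorph.setCongr h2.symm)))⟩
  obtain ⟨e⟩ := key Finset.univ
  exact ⟨e.trans (Homeomorph.setCongr (by simp [D]))⟩

/-- Every compact absolute retract embedded in the plane is non-separating. -/
theorem full_range {C : Type*} [TopologicalSpace C] [CompactSpace C] {a : C → ℂ}
    (ha : Continuous a) (hinj : a.Injective) {r : ℂ → C} (hr : Continuous r) {i : C → ℂ}
    (hi : Continuous i) (hri : ∀ c, r (i c) = c) : Full (range a) := by
  have hemb := (ha.isClosedEmbedding hinj).isEmbedding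
  refine Full.of_section (isCompact_range ha) (a ∘ r) (i ∘ Function.extend a id fun z => r z)
    (ha.comp hr) (fun z => mem_range_self _) ?_ ?_
  · rw [continuousOn_iff_continuous_domRestrict]
    have : (range a).domRestrict (i ∘ Function.extend a id fun z => r z)
        = i ∘ hemb.toHomeomorph.symm := by
      ext ⟨_, c, rfl⟩
      have : hemb.toHomeomorph.symm ⟨a c, mem_range_self c⟩ = c := by
        rw [Homeomorph.symm_apply_eq]; rfl
      simp [this, hinj.extend_apply, domRestrict_apply]
    rw [this]
    exact hi.comp hemb.toHomeomorph.symm.continuous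
  · rintro _ ⟨c, rfl⟩
    simp [hinj.extend_apply, hri]

theorem full_arc {a : ℝ≥0 → ℂ} {s u : ℝ≥0} (hsu : s ≤ u) (ha : ContinuousOn a (Icc s u))
    (hinj : InjOn a (Icc s u)) : Full (a '' Icc s u) := by
  rw [image_eq_range]
  refine full_range (C := Icc s u) (r := fun z => projIcc s u hsu z.re.toNNReal)
    (i := fun c => ((c : ℝ≥0) : ℝ)) ha.domRestrict hinj.injective ?_ ?_ fun c => ?_
  · exact continuous_projIcc.comp (continuous_real_toNNReal.comp Complex.continuous_re)
  · fun_prop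
  · simp

section Ext

variable {X : Type*}

/-- Extension by the identity of a self-map in a chart. -/
def extMap (j : ℂ → X) (h : ℂ → ℂ) : X → X := Function.extend j (j ∘ h) id

theorem extMap_apply {j : ℂ → X} (hj : j.Injective) (h : ℂ → ℂ) (z : ℂ) :
    extMap j h (j z) = j (h z) := hj.extend_apply _ _ _

theorem extMap_of_notMem {j : ℂ → X} (hj : j.Injective) {h : ℂ → ℂ} {κ : Set ℂ}
    (hid : ∀ x ∉ κ, h x = x) {x : X} (hx : x ∉ j '' κ) : extMap j h x = x := by
  by_cases hr : ∃ z, j z = x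
  · obtain ⟨z, rfl⟩ := hr
    rw [extMap_apply hj, hid z fun h' => hx ⟨z, h', rfl⟩]
  · exact Function.extend_apply' _ _ _ hr

theorem continuous_extMap [TopologicalSpace X] [T2Space X] {j : ℂ → X} (hj : IsOpenEmbedding j) {h : ℂ → ℂ}
    (hc : Continuous h) {κ : Set ℂ} (hκ : IsCompact κ) (hid : ∀ x ∉ κ, h x = x) :
    Continuous (extMap j h) := by
  refine continuous_iff_continuousAt.2 fun x => ?_
  by_cases hx : x ∈ j '' κ
  · obtain ⟨z, -, rfl⟩ := hx
    rw [← hj.continuousAt_iff]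
    have : extMap j h ∘ j = j ∘ h := funext fun z => extMap_apply hj.injective h z
    rw [this]
    exact (hj.continuous.comp hc).continuousAt
  · have : (j '' κ)ᶜ ∈ 𝓝 x := (hκ.image hj.continuous).isClosed.isOpen_compl.mem_nhds hx
    exact continuousAt_id.congr
      (by filter_upwards [this] with y hy using (extMap_of_notMem hj.injective hid hy).symm)

theorem exists_extend [TopologicalSpace X] [T2Space X] {j : ℂ → X} (hj : IsOpenEmbedding j) (h : ℂ ≃ₜ ℂ) {κ : Set ℂ}
    (hκ : IsCompact κ) (hid : ∀ x ∉ κ, h x = x) :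
    ∃ H : X ≃ₜ X, (∀ z, H (j z) = j (h z)) ∧ ∀ x ∉ j '' κ, H x = x := by
  have hid' : ∀ x ∉ κ, h.symm x = x := fun x hx => by rw [h.symm_apply_eq, hid x hx]
  have key : ∀ h : ℂ ≃ₜ ℂ, ∀ x, extMap j h.symm (extMap j h x) = x := by
    intro h x
    by_cases hr : ∃ z, j z = x
    · obtain ⟨z, rfl⟩ := hr
      simp [extMap_apply hj.injective]
    · have : ∀ g, extMap j g x = x := fun g => Function.extend_apply' _ _ _ hr
      rw [this, this]
  exact ⟨{ toFun := extMap j h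
           invFun := extMap j h.symm
           left_inv := key h
           right_inv := key h.symm
           continuous_toFun := continuous_extMap hj h.continuous hκ hid
           continuous_invFun := continuous_extMap hj h.symm.continuous hκ hid' },
    fun z => extMap_apply hj.injective _ z, fun x hx => extMap_of_notMem hj.injective hid hx⟩

end Ext

section Ray

variable {X : Type*} [TopologicalSpace X] [T2Space X]

theorem exists_push_chart {j : ℂ → X} (hj : IsOpenEmbedding j) {A : ℝ≥0 → X}
    (hA : IsClosedEmbedding A) {s t t' : ℝ≥0} (hst : s ≤ t) (htt : t < t')
    (hch : ∀ τ ∈ Icc s t', A τ ∈ range j) {K : Set X} (hK : IsClosed K)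
    (hKA : ∀ τ, t ≤ τ → A τ ∉ K) {O : Set X} (hO : IsOpen O) (hAO : range A ⊆ O) :
    ∃ h : X ≃ₜ X, (∀ x ∉ O, h x = x) ∧ ∀ τ, s ≤ τ → h (A τ) ∉ K := by
  obtain ⟨u, htu, hut⟩ := exists_between htt
  let a : ℝ≥0 → ℂ := fun τ => Function.invFun j (A τ)
  have hja : ∀ τ ∈ Icc s t', j (a τ) = A τ := fun τ hτ => Function.invFun_eq (hch τ hτ)
  have hac : ContinuousOn a (Icc s t') := by
    rw [hj.isEmbedding.continuousOn_iff]
    exact hA.continuous.continuousOn.congr hja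
  have hai : InjOn a (Icc s t') := fun x hx y hy hxy =>
    hA.injective (by rw [← hja x hx, ← hja y hy, hxy])
  have htx : Icc t t' ⊆ Icc s t' := Icc_subset_Icc_left hst
  have hsz : Icc s u ⊆ Icc s t' := Icc_subset_Icc_right hut.le
  have hinter : a '' Icc t t' ∩ a '' Icc s u = a '' Icc t u := by
    rw [← hai.image_inter htx hsz, Icc_inter_Icc, sup_of_le_left hst, inf_of_le_right hut.le]
  have htu' : Icc t u ⊆ Icc s t' := Icc_subset_Icc hst hut.le
  obtain ⟨ρ, hρ, hd⟩ : ∃ ρ > 0, ∀ x ∈ a '' Icc u t', ∀ z ∈ a '' Icc s t, ρ ≤ dist x z := by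
    have h1 : IsCompact (a '' Icc u t') :=
      isCompact_Icc.image_of_continuousOn (hac.mono (Icc_subset_Icc_left (hst.trans htu.le)))
    have h2 : IsCompact (a '' Icc s t) :=
      isCompact_Icc.image_of_continuousOn (hac.mono (Icc_subset_Icc_right htt.le))
    have h3 : Disjoint (a '' Icc u t') (a '' Icc s t) := by
      rw [disjoint_left]
      rintro _ ⟨x, hx, rfl⟩ ⟨y, hy, hxy⟩
      have := hai ⟨hy.1, hy.2.trans htt.le⟩ ⟨hst.trans (htu.le.trans hx.1), hx.2⟩ hxy
      exact absurd (this ▸ hy.2) (not_le.2 (htu.trans_le hx.1))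
    obtain ⟨r, hr, h⟩ := Metric.exists_pos_forall_lt_edist h1 h2.isClosed h3
    refine ⟨r, NNReal.coe_pos.2 hr, fun x hx z hz => ?_⟩
    have := (h x hx z hz).le
    rw [edist_nndist] at this
    exact_mod_cast this
  have hmem : ∀ τ ∈ Icc s t', a τ ∈ j ⁻¹' (O \ A '' Ici t') ↔ τ < t' := by
    intro τ hτ
    rw [mem_preimage, hja τ hτ]
    constructor
    · intro h
      by_contra hcon
      exact h.2 ⟨τ, not_lt.1 hcon, rfl⟩
    · intro h
      refine ⟨hAO ⟨τ, rfl⟩, ?_⟩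
      rintro ⟨y, hy, hyx⟩
      rw [hA.injective hyx] at hy
      exact absurd h (not_lt.2 hy)
  obtain ⟨h, ⟨κ, hκo, hκ, hid⟩, hV⟩ := exists_squeeze (Tx := a '' Icc t t') (Tz := a '' Icc s u)
    (o := j ⁻¹' (O \ A '' Ici t')) (V := j ⁻¹' Kᶜ)
    (isCompact_Icc.image_of_continuousOn (hac.mono htx))
    (isPreconnected_Icc.image _ (hac.mono htx))
    (full_arc htt.le (hac.mono htx) (hai.mono htx))
    (isCompact_Icc.image_of_continuousOn (hac.mono hsz))
    (isPreconnected_Icc.image _ (hac.mono hsz))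
    (full_arc (hst.trans htu.le) (hac.mono hsz) (hai.mono hsz))
    (hinter ▸ isPreconnected_Icc.image _ (hac.mono htu'))
    (hinter ▸ (nonempty_Icc.2 htu.le).image a) hρ
    (by
      rintro _ ⟨⟨x, hx, rfl⟩, hx'⟩ _ ⟨⟨z, hz, rfl⟩, hz'⟩
      refine hd _ ⟨x, ⟨?_, hx.2⟩, rfl⟩ _ ⟨z, ⟨hz.1, ?_⟩, rfl⟩
      · by_contra hcon
        exact hx' ⟨x, ⟨hst.trans hx.1, (not_le.1 hcon).le⟩, rfl⟩
      · by_contra hcon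
        exact hz' ⟨z, ⟨(not_le.1 hcon).le, hz.2.trans hut.le⟩, rfl⟩)
    ((hO.sdiff (hA.isClosedMap _ isClosed_Ici)).preimage hj.continuous)
    (by rintro _ ⟨x, hx, rfl⟩; exact (hmem x (hsz hx)).2 (hx.2.trans_lt hut))
    (hK.isOpen_compl.preimage hj.continuous)
    (by
      rintro _ ⟨x, hx, rfl⟩
      rw [mem_preimage, hja x (htx hx)]
      exact hKA x hx.1)
  obtain ⟨H, hH1, hH2⟩ := exists_extend hj h hκ hid
  refine ⟨H, fun x hx => hH2 x ?_, fun τ hτ => ?_⟩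
  · rintro ⟨z, hz, rfl⟩
    exact hx (hκo hz).1
  · rcases le_total τ t' with h' | h'
    · rw [← hja τ ⟨hτ, h'⟩, hH1]
      refine hV _ ?_
      rcases le_total t τ with h'' | h''
      · exact Or.inl ⟨τ, ⟨h'', h'⟩, rfl⟩
      · exact Or.inr ⟨τ, ⟨hτ, h''.trans htu.le⟩, rfl⟩
    · rw [hH2]
      · exact hKA τ (htt.le.trans h')
      · rintro ⟨z, hz, hzx⟩
        exact (hκo hz).2 ⟨τ, h', hzx.symm⟩

theorem exists_push_ray (hX : ∀ x : X, ∃ j : ℂ → X, IsOpenEmbedding j ∧ x ∈ range j)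
    {A : ℝ≥0 → X} (hA : IsClosedEmbedding A) {K : Set X} (hK : IsCompact K)
    {O : Set X} (hO : IsOpen O) (hAO : range A ⊆ O) :
    ∃ ω : X ≃ₜ X, (∀ x ∉ O, ω x = x) ∧ ∀ τ, ω (A τ) ∉ K := by
  let P : ℝ≥0 → Prop := fun t => ∀ K : Set X, IsClosed K → (∀ τ, t ≤ τ → A τ ∉ K) →
    ∃ ω : X ≃ₜ X, (∀ x ∉ O, ω x = x) ∧ ∀ τ, ω (A τ) ∉ K
  have hanti : ∀ s t, s ≤ t → P t → P s := fun s t hst ht K hK h =>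
    ht K hK fun τ hτ => h τ (hst.trans hτ)
  have hloc : ∀ s t t' : ℝ≥0, s ≤ t → t < t' →
      ∀ j : ℂ → X, IsOpenEmbedding j → (∀ τ ∈ Icc s t', A τ ∈ range j) → P s → P t := by
    intro s t t' hst htt j hj hch hs K hK hKA
    obtain ⟨h, h1, h2⟩ := exists_push_chart hj hA hst htt hch hK hKA hO hAO
    obtain ⟨ω, h3, h4⟩ := hs (h ⁻¹' K) (hK.preimage h.continuous) h2
    exact ⟨ω.trans h, fun x hx => by simp [h3 x hx, h1 x hx], h4⟩
  have hP : ∀ t, P 0 → P t := by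
    intro t
    refine PreconnectedSpace.induction₂' (fun x y => P x → P y) (fun x => ?_)
      ⟨fun x y z h1 h2 h => h2 (h1 h)⟩ 0 t
    obtain ⟨j, hj, hxj⟩ := hX (A x)
    have h1 : A ⁻¹' range j ∈ 𝓝 x := hA.continuous.continuousAt (hj.isOpen_range.mem_nhds hxj)
    obtain ⟨ε, hε, h2⟩ := Metric.mem_nhds_iff.1 h1
    filter_upwards [ball_mem_nhds x (half_pos hε)] with y hy
    have h3 : ∀ τ ∈ Icc (min x y) (max x y + (ε / 4).toNNReal), A τ ∈ range j := by
      rintro τ ⟨hτ1, hτ2⟩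
      refine h2 ?_
      have h4 : ((min x y : ℝ≥0) : ℝ) ≤ τ := by exact_mod_cast hτ1
      have h5 : (τ : ℝ) ≤ max (x : ℝ) y + ε / 4 := by
        have : (τ : ℝ) ≤ ((max x y + (ε / 4).toNNReal : ℝ≥0) : ℝ) := by exact_mod_cast hτ2
        rw [NNReal.coe_add, Real.coe_toNNReal _ (by positivity)] at this
        exact_mod_cast this
      rw [mem_ball, NNReal.dist_eq, abs_lt] at hy ⊢
      push_cast at h4
      rcases le_total (x : ℝ) y with h | h
      · rw [min_eq_left h] at h4
        rw [max_eq_right h] at h5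
        constructor <;> linarith
      · rw [min_eq_right h] at h4
        rw [max_eq_left h] at h5
        constructor <;> linarith
    have h4 : max x y < max x y + (ε / 4).toNNReal := by simpa using hε
    have h5 := hloc _ _ _ min_le_max h4 j hj h3
    exact ⟨fun h => hanti _ _ (le_max_right x y) (h5 (hanti _ _ (min_le_left x y) h)),
      fun h => hanti _ _ (le_max_left x y) (h5 (hanti _ _ (min_le_right x y) h))⟩
  obtain ⟨t, ht⟩ := (hA.isCompact_preimage hK).bddAbove
  refine hP (t + 1) (fun K _ h => ⟨Homeomorph.refl X, fun _ _ => rfl, fun τ => h τ zero_le⟩) K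
    hK.isClosed fun τ hτ h => ?_
  exact absurd (ht h) (not_le.2 ((lt_add_one t).trans_le hτ))

/-- Removing a properly embedded ray does not change the homeomorphism type of a surface. -/
theorem nonempty_homeomorph_compl_ray [LocallyCompactSpace X] [SecondCountableTopology X]
    (hX : ∀ x : X, ∃ j : ℂ → X, IsOpenEmbedding j ∧ x ∈ range j)
    {A : ℝ≥0 → X} (hA : IsClosedEmbedding A) : Nonempty (((range A)ᶜ : Set X) ≃ₜ X) := by
  have : LocallyCompactSpace ((range A)ᶜ : Set X) :=
    hA.isClosed_range.isOpen_compl.locallyCompactSpace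
  let K := CompactExhaustion.choice X
  let L := CompactExhaustion.choice ((range A)ᶜ : Set X)
  have hL : ∀ n, IsClosed (Subtype.val '' L n : Set X) := fun n =>
    ((L.isCompact n).image continuous_subtype_val).isClosed
  obtain ⟨s, hs0, hs⟩ := exists_seq_step (α := (X ≃ₜ X) × Set X)
    (P := fun b => IsOpen b.2 ∧ range A ⊆ b.2)
    (R := fun n b b' => (∀ x ∉ b.2, b'.1 x = b.1 x) ∧ b'.2 ⊆ b.2 ∧
      Disjoint b'.2 (Subtype.val '' L n) ∧ Disjoint (b'.1 '' b'.2) (K n))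
    (Homeomorph.refl X, univ) ⟨isOpen_univ, subset_univ _⟩ (by
      rintro n ⟨k, O⟩ ⟨hO, hAO⟩
      obtain ⟨ω, h1, h2⟩ := exists_push_ray hX (k.isClosedEmbedding.comp hA) (K.isCompact n)
        (k.isOpenMap O hO) (by rw [range_comp]; exact image_mono hAO)
      refine ⟨(k.trans ω, O ∩ ((k.trans ω) ⁻¹' (K n)ᶜ ∩ (Subtype.val '' L n)ᶜ)),
        ⟨hO.inter (((K.isCompact n).isClosed.isOpen_compl.preimage (k.trans ω).continuous).inter
          (hL n).isOpen_compl), ?_⟩, fun x hx => ?_, inter_subset_left, ?_, ?_⟩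
      · rintro _ ⟨τ, rfl⟩
        refine ⟨hAO ⟨τ, rfl⟩, h2 τ, ?_⟩
        rintro ⟨x, -, hx⟩
        exact x.2 ⟨τ, hx.symm⟩
      · refine h1 _ ?_
        rintro ⟨y, hy, hyx⟩
        exact hx (k.injective hyx ▸ hy)
      · exact disjoint_left.2 fun x hx => hx.2.2
      · rw [disjoint_left]
        rintro _ ⟨x, hx, rfl⟩
        exact hx.2.1)
  have hstep := fun n => (hs n).2
  obtain ⟨f, g, hfg, -⟩ := exists_limit_homeo (T := range A) (T' := ∅) (k := fun n => (s n).1)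
    (O := fun n => (s n).2) (antitone_nat_of_succ_le fun n => (hstep n).2.1)
    (fun n => (hstep n).1) (fun n => (hs n).1.2) (fun x hx => by
      obtain ⟨n, hn⟩ := L.exists_mem ⟨x, hx⟩
      refine ⟨n + 2, ?_⟩
      have h1 : L (n + 1) ∈ 𝓝 (⟨x, hx⟩ : ((range A)ᶜ : Set X)) :=
        mem_interior_iff_mem_nhds.1 (L.subset_interior_succ n hn)
      have h2 : (Subtype.val '' L (n + 1) : Set X) ∈ 𝓝 x :=
        hA.isClosed_range.isOpen_compl.isOpenEmbedding_subtypeVal.image_mem_nhds.2 h1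
      filter_upwards [h2] with y hy hy'
      exact disjoint_left.1 (hstep (n + 1)).2.2.1 hy' hy) (fun n => empty_subset _)
    (fun y _ => by
      obtain ⟨n, hn⟩ := K.exists_mem y
      refine ⟨n + 2, ?_⟩
      filter_upwards [mem_interior_iff_mem_nhds.1 (K.subset_interior_succ n hn)] with z hz hz'
      exact disjoint_left.1 (hstep (n + 1)).2.2.2 hz' hz)
  exact ⟨hfg.toHomeo.trans ((Homeomorph.setCongr compl_empty).trans (Homeomorph.Set.univ X))⟩

end Ray

/-- A normed space is homeomorphic to each of its open balls. -/
def homeoBall {E : Type*} [NormedAddCommGroup E] [NormedSpace ℝ E] (c : E) {r : ℝ} (hr : 0 < r) :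
    E ≃ₜ ball c r :=
  (Homeomorph.Set.univ E).symm.trans
    ((Homeomorph.setCongr (OpenPartialHomeomorph.univBall_source c r).symm).trans
      ((OpenPartialHomeomorph.univBall c r).toHomeomorphSourceTarget.trans
        (Homeomorph.setCongr (OpenPartialHomeomorph.univBall_target c hr))))

/-- The standard isometry between the complex numbers and the plane. -/
def complexPlane : ℂ ≃ₗᵢ[ℝ] Plane := Complex.orthonormalBasisOneI.repr

/-- The homeomorphism between a subspace and its image under the standard isometry. -/
def complexPlaneImage {A : Set ℂ} {B : Set Plane} (h : complexPlane '' A = B) : A ≃ₜ B :=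
  (complexPlane.toHomeomorph.image A).trans (Homeomorph.setCongr h)

theorem full_biUnion {ι : Type*} (S : Finset ι) (T : ι → Set ℂ) (hT : ∀ i, IsCompact (T i))
    (hTf : ∀ i, Full (T i)) (hd : ∀ i j, i ≠ j → Disjoint (T i) (T j)) :
    Full (⋃ i ∈ S, T i) := by
  induction S using Finset.induction_on with
  | empty =>
    intro z _
    exact ⟨univ, isPreconnected_univ, mem_univ z, by simp, NormedSpace.unbounded_univ ℝ ℂ⟩
  | insert j S hj ih =>
    rw [Finset.set_biUnion_insert]
    intro z hz
    have h1 : Disjoint (T j) (⋃ i ∈ S, T i) := by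
      simp only [disjoint_iUnion_right]
      exact fun i hi => hd j i fun h => hj (h ▸ hi)
    refine Esc.union (hT j) (S.isCompact_biUnion fun i _ => hT i) ?_
      (hTf j z fun h => hz (Or.inl h)) (ih z fun h => hz (Or.inr h))
    rw [h1.inter_eq]
    exact isPreconnected_empty

theorem isPreconnected_lt_norm {R : ℝ} (hR : 0 ≤ R) : IsPreconnected {z : ℂ | R < ‖z‖} := by
  have h1 : IsPreconnected (sphere (0 : ℂ) 1) :=
    isPreconnected_sphere (by rw [Complex.rank_real_complex]; exact Cardinal.one_lt_two) 0 1
  have h2 := ((isPreconnected_Ioi (a := R)).prod h1).image (fun p : ℝ × ℂ => p.1 • p.2)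
    (by fun_prop)
  convert h2 using 1
  ext z
  simp only [mem_ofPred_eq, mem_image, mem_prod, mem_Ioi, mem_sphere_zero_iff_norm, Prod.exists]
  constructor
  · intro hz
    have h0 : ‖z‖ ≠ 0 := (hR.trans_lt hz).ne'
    exact ⟨‖z‖, ‖z‖⁻¹ • z, ⟨hz, by rw [norm_smul, norm_inv, norm_norm, inv_mul_cancel₀ h0]⟩,
      smul_inv_smul₀ h0 z⟩
  · rintro ⟨t, w, ⟨ht, hw⟩, rfl⟩
    rw [norm_smul, hw, mul_one, Real.norm_of_nonneg (hR.trans ht.le)]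
    exact ht

theorem Full.isPreconnected_compl {T : Set ℂ} (hT : IsCompact T) (hTf : Full T) :
    IsPreconnected Tᶜ := by
  obtain ⟨R, hR0, hR⟩ := hT.isBounded.subset_closedBall_lt 0 0
  have hsub : {z : ℂ | R < ‖z‖} ⊆ Tᶜ := fun z hz h => by
    have := hR h
    rw [mem_closedBall_zero_iff] at this
    exact absurd this (not_le.2 hz)
  have hmem : ((R + 1 : ℝ) : ℂ) ∈ {z : ℂ | R < ‖z‖} := by
    rw [mem_ofPred_eq, Complex.norm_real, Real.norm_of_nonneg (by linarith)]; linarith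
  refine isPreconnected_of_forall ((R + 1 : ℝ) : ℂ) fun z hz => ?_
  obtain ⟨S, hS, hzS, hST, hb⟩ := hTf z hz
  have h1 : (S ∩ {z : ℂ | R < ‖z‖}).Nonempty := by
    by_contra hcon
    refine hb ((isBounded_closedBall (x := (0 : ℂ)) (r := R)).subset fun w hw => ?_)
    rw [mem_closedBall_zero_iff]
    by_contra h
    exact hcon ⟨w, hw, not_le.1 h⟩
  obtain ⟨w, hw1, hw2⟩ := h1
  exact ⟨_, union_subset (subset_compl_iff_disjoint_right.2 hST) hsub, Or.inr hmem, Or.inl hzS,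
    hS.union w hw1 hw2 (isPreconnected_lt_norm hR0.le)⟩

/-- The radial retraction of the plane onto the closed unit disc. -/
def radialRetract (x : Plane) : (closedBall (0 : Plane) 1 : Set Plane) :=
  ⟨(max 1 ‖x‖)⁻¹ • x, by
    have h : 0 < max 1 ‖x‖ := lt_max_of_lt_left one_pos
    rw [mem_closedBall_zero_iff, norm_smul, norm_inv, Real.norm_of_nonneg h.le,
      inv_mul_le_one₀ h]
    exact le_max_right _ _⟩

theorem full_disc {a : (closedBall (0 : Plane) 1 : Set Plane) → ℂ} (ha : Continuous a)
    (hinj : a.Injective) : Full (range a) := by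
  have : CompactSpace (closedBall (0 : Plane) 1 : Set Plane) :=
    isCompact_iff_compactSpace.1 (isCompact_closedBall _ _)
  refine full_range ha hinj (r := fun z => radialRetract (complexPlane z))
    (i := fun c => complexPlane.symm c) ?_ ?_ fun c => ?_
  · have h : Continuous fun z => max 1 ‖complexPlane z‖ :=
      continuous_const.max complexPlane.continuous.norm
    exact ((h.inv₀ fun z => (lt_max_of_lt_left one_pos).ne').smul
      complexPlane.continuous).subtype_mk _
  · exact complexPlane.symm.continuous.comp (continuous_subtype_val (X := Plane))
  · have h : ‖(c : Plane)‖ ≤ 1 := mem_closedBall_zero_iff.1 c.2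
    ext1
    simp [radialRetract, max_eq_left h]

/-- Removing finitely many disjoint closed discs from a 2-cell leaves a connected 2-cell with
punctures. -/
theorem IsTwoCell.diff_discs {Y : Type} [TopologicalSpace Y] {C : Set Y} (hC : IsTwoCell C)
    {ι : Type*} [Finite ι] {cap : ι → (closedBall (0 : Plane) 1 : Set Plane) → Y}
    (hcont : ∀ i, Continuous (cap i)) (hinj : ∀ i, (cap i).Injective)
    (hsub : ∀ i c, cap i c ∈ C)
    (hd : ∀ i j, i ≠ j → Disjoint (range (cap i)) (range (cap j))) :
    IsPreconnected (C \ ⋃ i, range (cap i)) ∧ IsPuncturedTwoCell (C \ ⋃ i, range (cap i)) := by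
  obtain ⟨e⟩ := hC
  have : CompactSpace (closedBall (0 : Plane) 1 : Set Plane) :=
    isCompact_iff_compactSpace.1 (isCompact_closedBall _ _)
  have : PreconnectedSpace (closedBall (0 : Plane) 1 : Set Plane) :=
    isPreconnected_iff_preconnectedSpace.1 (convex_closedBall _ _).isPreconnected
  have : Nonempty (closedBall (0 : Plane) 1 : Set Plane) :=
    ⟨⟨0, mem_closedBall_self zero_le_one⟩⟩
  have himg : complexPlane '' ball 0 1 = ball (0 : Plane) 1 := by
    rw [complexPlane.image_ball, map_zero]
  let q : C ≃ₜ (ball (0 : ℂ) 1 : Set ℂ) := e.trans (complexPlaneImage himg).symm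
  let p : C ≃ₜ ℂ := q.trans (homeoBall (0 : ℂ) one_pos).symm
  let capC : ι → (closedBall (0 : Plane) 1 : Set Plane) → C := fun i c => ⟨cap i c, hsub i c⟩
  have hcapC : ∀ i, Continuous (capC i) := fun i => (hcont i).subtype_mk _
  have hcapI : ∀ i, (capC i).Injective := fun i x y h => hinj i (congrArg Subtype.val h)
  have key : ∀ j : C → ℂ, j.Injective → ∀ i i', i ≠ i' →
      Disjoint (range (j ∘ capC i)) (range (j ∘ capC i')) := by
    intro j hj i i' hii
    rw [disjoint_left]
    rintro _ ⟨x, rfl⟩ ⟨y, hy⟩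
    exact disjoint_left.1 (hd i i' hii) ⟨x, rfl⟩ ⟨y, congrArg Subtype.val (hj hy)⟩
  have hrange : ∀ (j : C → ℂ), j.Injective → ∀ y : C,
      j y ∉ (⋃ i, range (j ∘ capC i)) ↔ (y : Y) ∉ ⋃ i, range (cap i) := by
    intro j hj y
    refine not_congr ?_
    simp only [mem_iUnion, mem_range]
    refine exists_congr fun i => exists_congr fun c => ?_
    rw [Function.comp_apply, hj.eq_iff, Subtype.ext_iff]
  constructor
  · have h1 : IsPreconnected (⋃ i, range (p ∘ capC i))ᶜ := by
      have := Fintype.ofFinite ι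
      have hcomp : ∀ i, IsCompact (range (p ∘ capC i)) := fun i =>
        isCompact_range (p.continuous.comp (hcapC i))
      refine Full.isPreconnected_compl (isCompact_iUnion hcomp) ?_
      have h2 := full_biUnion Finset.univ (fun i => range (p ∘ capC i)) hcomp
        (fun i => full_disc (p.continuous.comp (hcapC i)) (p.injective.comp (hcapI i)))
        (key p p.injective)
      simpa using h2
    have h2 := h1.image (fun z => ((p.symm z : C) : Y))
      (continuous_subtype_val.comp p.symm.continuous).continuousOn
    convert h2 using 1
    ext y
    constructor
    · rintro ⟨hy, hy'⟩
      exact ⟨p ⟨y, hy⟩, (hrange p p.injective ⟨y, hy⟩).2 hy', by simp⟩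
    · rintro ⟨z, hz, rfl⟩
      refine ⟨(p.symm z).2, (hrange p p.injective _).1 ?_⟩
      simpa using hz
  · let j : C → ℂ := fun y => q y
    have hj : j.Injective := Subtype.val_injective.comp q.injective
    have hjc : Continuous j := continuous_subtype_val.comp q.continuous
    obtain ⟨c, r, hr, hB, hdis, ⟨E⟩⟩ := exists_discs isOpen_ball
      (fun i => range (j ∘ capC i)) (fun i => isCompact_range (hjc.comp (hcapC i)))
      (fun i => isPreconnected_range (hjc.comp (hcapC i)))
      (fun i => full_disc (hjc.comp (hcapC i)) (hj.comp (hcapI i)))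
      (fun i => range_nonempty _) (B := ball 0 1)
      (by rintro i _ ⟨x, rfl⟩; exact (q (capC i x)).2) (key j hj)
    obtain ⟨m, ⟨σ⟩⟩ := Finite.exists_equiv_fin ι
    have hcb : ∀ i, complexPlane '' closedBall (c i) (r i) =
        closedBall (complexPlane (c i)) (r i) := fun i => complexPlane.image_closedBall _ _
    refine ⟨m, fun i => complexPlane (c (σ.symm i)), fun i => r (σ.symm i), fun i => hr _,
      fun i => ?_, fun i i' hii => ?_, ?_⟩
    · rw [← hcb, ← himg]
      exact image_mono (hB _)
    · rw [← hcb, ← hcb]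
      exact (disjoint_image_iff complexPlane.injective).2
        (hdis _ _ fun h => hii (σ.symm.injective h))
    · have h1 : complexPlane '' (ball 0 1 \ ⋃ i, closedBall (c i) (r i)) =
          ball (0 : Plane) 1 \ ⋃ i, closedBall (complexPlane (c (σ.symm i))) (r (σ.symm i)) := by
        rw [image_sdiff complexPlane.injective, himg, image_iUnion]
        simp only [hcb]
        rw [σ.symm.surjective.iUnion_comp
          fun i => closedBall (complexPlane (c i)) (r i)]
      let f : (ball (0 : ℂ) 1 \ ⋃ i, range (j ∘ capC i) : Set ℂ) → Y :=
        fun z => (q.symm ⟨z, z.2.1⟩ : C)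
      have hf : IsEmbedding f := IsEmbedding.subtypeVal.comp
        (q.symm.isEmbedding.comp (IsEmbedding.inclusion sdiff_subset))
      have hfr : range f = C \ ⋃ i, range (cap i) := by
        ext y
        constructor
        · rintro ⟨z, rfl⟩
          refine ⟨(q.symm ⟨z, z.2.1⟩).2, (hrange j hj _).1 ?_⟩
          simpa [j] using z.2.2
        · rintro ⟨hy, hy'⟩
          exact ⟨⟨q ⟨y, hy⟩, (q ⟨y, hy⟩).2, (hrange j hj ⟨y, hy⟩).2 hy'⟩, by simp [f]⟩
      exact ⟨(Homeomorph.setCongr hfr.symm).trans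
        (hf.toHomeomorph.symm.trans (E.trans (complexPlaneImage h1)))⟩

section Charts

variable {Y : Type} [TopologicalSpace Y]

/-- Every point of `Y` lies in an open subset homeomorphic to the plane. -/
def LocPlanar (Y : Type) [TopologicalSpace Y] : Prop :=
  ∀ y : Y, ∃ j : ℂ → Y, IsOpenEmbedding j ∧ y ∈ range j

theorem IsTwoCell.exists_isOpenEmbedding {U : Set Y} (hU : IsOpen U) (h : IsTwoCell U) :
    ∃ j : ℂ → Y, IsOpenEmbedding j ∧ range j = U := by
  obtain ⟨e⟩ := h
  let E : ℂ ≃ₜ U := complexPlane.toHomeomorph.trans ((homeoBall (0 : Plane) one_pos).trans e.symm)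
  refine ⟨Subtype.val ∘ E, hU.isOpenEmbedding_subtypeVal.comp E.isOpenEmbedding, ?_⟩
  rw [E.surjective.range_comp, Subtype.range_coe]

theorem IsClosedSurface.locPlanar (h : IsClosedSurface Y) : LocPlanar Y := by
  intro y
  obtain ⟨U, hU, hy, hc⟩ := h.2.2.2 y
  obtain ⟨j, hj, hr⟩ := hc.exists_isOpenEmbedding hU
  exact ⟨j, hj, hr ▸ hy⟩

theorem LocPlanar.secondCountable [CompactSpace Y] (h : LocPlanar Y) :
    SecondCountableTopology Y := by
  choose j hj hy using h
  obtain ⟨t, ht⟩ := isCompact_univ.elim_finite_subcover (fun y => range (j y))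
    (fun y => (hj y).isOpen_range) fun y _ => mem_iUnion.2 ⟨y, hy y⟩
  have : ∀ y : t, SecondCountableTopology (range (j y)) := fun y =>
    (hj y).isEmbedding.toHomeomorph.symm.isEmbedding.secondCountableTopology
  refine TopologicalSpace.secondCountableTopology_of_countable_cover
    (U := fun y : t => range (j y)) (fun y => (hj y).isOpen_range) (eq_univ_of_forall fun x => ?_)
  have := ht (mem_univ x)
  simp only [mem_iUnion] at this ⊢
  obtain ⟨y, hy, hx⟩ := this
  exact ⟨⟨y, hy⟩, hx⟩

theorem LocPlanar.of_isOpen (h : LocPlanar Y) {U : Set Y} (hU : IsOpen U) : LocPlanar U := by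
  rintro ⟨y, hy⟩
  obtain ⟨j, hj, z, rfl⟩ := h y
  obtain ⟨ε, hε, hb⟩ := Metric.isOpen_iff.1 (hU.preimage hj.continuous) z hy
  let i : ℂ → Y := fun w => j (homeoBall z hε w)
  have hi : IsOpenEmbedding i := hj.comp
    (isOpen_ball.isOpenEmbedding_subtypeVal.comp (homeoBall z hε).isOpenEmbedding)
  refine ⟨fun w => ⟨i w, hb (homeoBall z hε w).2⟩,
    IsOpenEmbedding.of_comp _ hU.isOpenEmbedding_subtypeVal hi,
    (homeoBall z hε).symm ⟨z, mem_ball_self hε⟩, by simp [i]⟩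

theorem nonempty_homeomorph_diff_ray [T2Space Y] [LocallyCompactSpace Y]
    [SecondCountableTopology Y] (h : LocPlanar Y) {U : Set Y} (hU : IsOpen U) {A : ℝ≥0 → Y}
    (hA : IsEmbedding A) (hAU : ∀ τ, A τ ∈ U) {F : Set Y} (hF : IsClosed F)
    (hAF : range A = U ∩ F) : Nonempty ((U \ range A : Set Y) ≃ₜ U) := by
  have := hU.locallyCompactSpace
  let A' : ℝ≥0 → U := codRestrict A U hAU
  have hr : range A' = Subtype.val ⁻¹' F := by
    ext ⟨y, hy⟩
    have : y ∈ range A ↔ y ∈ F := by rw [hAF]; exact and_iff_right hy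
    rw [mem_preimage, ← this]
    simp [A']
  have hA' : IsClosedEmbedding A' :=
    ⟨hA.codRestrict U hAU, hr ▸ hF.preimage continuous_subtype_val⟩
  obtain ⟨e⟩ := nonempty_homeomorph_compl_ray (h.of_isOpen hU) hA'
  have hv : Subtype.val '' (range A')ᶜ = U \ range A := by
    ext y
    constructor
    · rintro ⟨⟨y, hy⟩, hy', rfl⟩
      exact ⟨hy, fun ⟨τ, hτ⟩ => hy' ⟨τ, Subtype.ext hτ⟩⟩
    · rintro ⟨hy, hy'⟩
      exact ⟨⟨y, hy⟩, fun ⟨τ, hτ⟩ => hy' ⟨τ, congrArg Subtype.val hτ⟩, rfl⟩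
  exact ⟨(Homeomorph.setCongr hv.symm).trans
    ((IsEmbedding.subtypeVal.homeomorphImage _).symm.trans e)⟩

theorem isTwoCell_of_homeomorph {U V : Set Y} (e : U ≃ₜ V)
    (hV : ∀ y ∈ V, IsTwoCell (connectedComponentIn V y)) :
    ∀ x ∈ U, IsTwoCell (connectedComponentIn U x) := by
  intro x hx
  obtain ⟨E⟩ := hV (e ⟨x, hx⟩) (e ⟨x, hx⟩).2
  have h1 : e '' connectedComponent ⟨x, hx⟩ = connectedComponent (e ⟨x, hx⟩) := by
    have := e.image_connectedComponentIn (mem_univ (⟨x, hx⟩ : U))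
    rwa [image_univ, e.surjective.range_eq, connectedComponentIn_univ,
      connectedComponentIn_univ] at this
  exact ⟨(Homeomorph.setCongr (connectedComponentIn_eq_image hx)).trans
    ((IsEmbedding.subtypeVal.homeomorphImage _).symm.trans ((e.image _).trans
      ((Homeomorph.setCongr h1).trans ((IsEmbedding.subtypeVal.homeomorphImage _).trans
        ((Homeomorph.setCongr (connectedComponentIn_eq_image (e ⟨x, hx⟩).2).symm).trans E)))))⟩

end Charts

namespace Multigraph

variable (M : Multigraph)

theorem real_cases (x : M.Real) : (∃ v, x = M.vtx v) ∨ ∃ e t, x = M.edgePath e t := by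
  obtain ⟨v | ⟨e, t⟩, rfl⟩ := Quot.exists_rep x
  exacts [Or.inl ⟨v, rfl⟩, Or.inr ⟨e, t, rfl⟩]

theorem edgePath_zero (e : M.E) : M.edgePath e 0 = M.vtx (M.ends e false) :=
  Quot.sound ⟨e, false, rfl, rfl⟩

theorem edgePath_one (e : M.E) : M.edgePath e 1 = M.vtx (M.ends e true) :=
  Quot.sound ⟨e, true, rfl, rfl⟩

theorem continuous_real {Y : Type*} [TopologicalSpace Y] {f : M.Real → Y}
    (h : ∀ e, Continuous fun t => f (M.edgePath e t)) : Continuous f := by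
  let _ : TopologicalSpace M.V := ⊥
  let _ : TopologicalSpace M.E := ⊥
  have : DiscreteTopology M.V := ⟨rfl⟩
  have : DiscreteTopology M.E := ⟨rfl⟩
  have h1 : Continuous (fun x : M.V ⊕ (M.E × unitInterval) => f (Quot.mk M.glue x)) :=
    continuous_sum_dom.2 ⟨continuous_of_discreteTopology, continuous_prod_of_discrete_left.2 h⟩
  exact continuous_coinduced_dom.2 h1

theorem continuous_edgePath (e : M.E) : Continuous (M.edgePath e) := by
  let _ : TopologicalSpace M.V := ⊥
  let _ : TopologicalSpace M.E := ⊥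
  have h1 : Continuous (fun t => (Sum.inr (e, t) : M.V ⊕ (M.E × unitInterval))) := by fun_prop
  exact (continuous_quot_mk (r := M.glue)).comp h1

instance : CompactSpace M.Real := by
  let _ : TopologicalSpace M.V := ⊥
  let _ : TopologicalSpace M.E := ⊥
  have := M.vFin
  have := M.eFin
  have : CompactSpace M.Pre :=
    inferInstanceAs (CompactSpace (M.V ⊕ (M.E × unitInterval)))
  exact Quot.compactSpace

end Multigraph

theorem isEmbedding_of_leftInverse {X Y : Type*} [TopologicalSpace X] [TopologicalSpace Y]
    {f : X → Y} {g : Y → X} (hf : Continuous f) (hg : ∀ x, ContinuousAt g (f x))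
    (h : Function.LeftInverse g f) : IsEmbedding f := by
  refine ⟨isInducing_iff_nhds.2 fun x => le_antisymm (hf.tendsto x).le_comap ?_, h.injective⟩
  have h1 : comap f (𝓝 (f x)) ≤ comap f (comap g (𝓝 (g (f x)))) := comap_mono (hg x).le_comap
  rwa [comap_comap, h.comp_eq_id, comap_id, h x] at h1

/-- A parametrization of the half-open unit interval by a ray. -/
def rayParam (τ : ℝ≥0) : unitInterval :=
  ⟨(1 + (τ : ℝ))⁻¹, by positivity, inv_le_one_of_one_le₀ (by simp)⟩

theorem rayParam_pos (τ : ℝ≥0) : 0 < rayParam τ := by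
  have : (0 : ℝ) < (1 + (τ : ℝ))⁻¹ := by positivity
  exact this

theorem isEmbedding_rayParam : IsEmbedding rayParam := by
  refine isEmbedding_of_leftInverse (g := fun t => ((t : ℝ)⁻¹ - 1).toNNReal)
    (Continuous.subtype_mk (Continuous.inv₀ (by fun_prop) fun τ => by positivity) _)
    (fun τ => ?_) fun τ => by simp [rayParam]
  have h : ((rayParam τ : unitInterval) : ℝ) ≠ 0 := fun h => (rayParam_pos τ).ne' (Subtype.ext h)
  have h1 : ContinuousAt (fun t : unitInterval => (t : ℝ)⁻¹ - 1) (rayParam τ) :=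
    (continuous_subtype_val.continuousAt.inv₀ h).sub continuousAt_const
  exact continuous_real_toNNReal.continuousAt.comp h1

theorem exists_rayParam {t : unitInterval} (ht : t ≠ 0) : ∃ τ, rayParam τ = t := by
  have h0 : 0 < (t : ℝ) := lt_of_le_of_ne t.2.1 fun h => ht (Subtype.ext h.symm)
  have h1 : 1 ≤ (t : ℝ)⁻¹ := (one_le_inv₀ h0).2 t.2.2
  refine ⟨((t : ℝ)⁻¹ - 1).toNNReal, Subtype.ext ?_⟩
  simp only [rayParam]
  rw [Real.coe_toNNReal _ (by linarith), add_sub_cancel, inv_inv]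

namespace HEG

variable (G : HEG)

/-- The parameter along the half-edge `h`, extended by zero to the other edges. -/
def param (h : G.Hh) : G.completedMG.Real → unitInterval :=
  Quot.lift (Sum.elim (Sum.elim (fun _ => 0) fun h' => if h' = h then 1 else 0)
    fun p => Sum.elim (fun _ => 0) (fun h' => if h' = h then p.2 else 0) p.1) (by
    rintro _ _ ⟨e | h', b, rfl, rfl⟩
    · rfl
    · cases b <;> simp [completedMG])

@[simp] theorem param_vtx_inl (h : G.Hh) (v : G.V) :
    G.param h (G.completedMG.vtx (Sum.inl v)) = 0 := rfl

@[simp] theorem param_vtx_inr (h h' : G.Hh) :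
    G.param h (G.completedMG.vtx (Sum.inr h')) = if h' = h then 1 else 0 := rfl

@[simp] theorem param_edgePath_inl (h : G.Hh) (e : G.E) (t : unitInterval) :
    G.param h (G.completedMG.edgePath (Sum.inl e) t) = 0 := rfl

@[simp] theorem param_edgePath_inr (h h' : G.Hh) (t : unitInterval) :
    G.param h (G.completedMG.edgePath (Sum.inr h') t) = if h' = h then t else 0 := rfl

theorem continuous_param (h : G.Hh) : Continuous (G.param h) := by
  refine G.completedMG.continuous_real ?_
  rintro (e | h')
  · exact continuous_const
  · by_cases hh : h' = h
    · simpa [hh] using continuous_id'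
    · simpa [hh] using continuous_const

theorem eq_edgePath_of_param_ne_zero {h : G.Hh} {x : G.completedMG.Real} (hx : G.param h x ≠ 0) :
    x = G.completedMG.edgePath (Sum.inr h) (G.param h x) := by
  rcases G.completedMG.real_cases x with ⟨v | h', rfl⟩ | ⟨e | h', t, rfl⟩
  · simp at hx
  · have hh : h' = h := by by_contra hh; simp [hh] at hx
    subst hh
    rw [param_vtx_inr, if_pos rfl]
    exact (G.completedMG.edgePath_one (Sum.inr h')).symm
  · simp at hx
  · have hh : h' = h := by by_contra hh; simp [hh] at hx
    subst hh
    simp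

theorem continuous_inclReal : Continuous G.inclReal :=
  G.underlyingMG.continuous_real fun e => G.completedMG.continuous_edgePath (Sum.inl e)

/-- The retraction of the completed graph collapsing every half-edge. -/
def collapse : G.completedMG.Real → G.underlyingMG.Real :=
  Quot.lift (Sum.elim (Sum.elim (fun v => G.underlyingMG.vtx v) fun h =>
      G.underlyingMG.vtx (G.hInc h))
    fun p => Sum.elim (fun e => G.underlyingMG.edgePath e p.2)
      (fun h => G.underlyingMG.vtx (G.hInc h)) p.1) (by
    rintro _ _ ⟨e | h, b, rfl, rfl⟩
    · exact Quot.sound ⟨e, b, rfl, rfl⟩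
    · cases b <;> rfl)

theorem inclReal_injective : G.inclReal.Injective := by
  refine Function.LeftInverse.injective (g := G.collapse) fun x => ?_
  obtain ⟨v | ⟨e, t⟩, rfl⟩ := Quot.exists_rep x <;> rfl

theorem range_inclReal : range G.inclReal = {x | ∀ h, G.param h x = 0} := by
  ext x
  constructor
  · rintro ⟨x, rfl⟩ h
    obtain ⟨v | ⟨e, t⟩, rfl⟩ := Quot.exists_rep x <;> rfl
  · intro hx
    rcases G.completedMG.real_cases x with ⟨v | h', rfl⟩ | ⟨e | h', t, rfl⟩
    · exact ⟨G.underlyingMG.vtx v, rfl⟩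
    · simpa using hx h'
    · exact ⟨G.underlyingMG.edgePath e t, rfl⟩
    · have h1 : t = 0 := by simpa using hx h'
      rw [h1]
      exact ⟨G.underlyingMG.vtx (G.hInc h'), (G.completedMG.edgePath_zero (Sum.inr h')).symm⟩

end HEG

namespace HEG

variable (G : HEG)

/-- The completed graph with the half-edges outside of `J` removed. -/
def partialReal (J : Finset G.Hh) : Set G.completedMG.Real := {x | ∀ h ∉ J, G.param h x = 0}

theorem isClosed_partialReal (J : Finset G.Hh) : IsClosed (G.partialReal J) := by
  have : G.partialReal J = ⋂ h, ⋂ _ : h ∉ J, {x | G.param h x = 0} := by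
    ext x; simp [partialReal]
  rw [this]
  exact isClosed_iInter fun h => isClosed_iInter fun _ =>
    isClosed_eq (G.continuous_param h) continuous_const

theorem partialReal_insert (J : Finset G.Hh) (h : G.Hh) :
    G.partialReal (insert h J) = G.partialReal J ∪
      range fun τ => G.completedMG.edgePath (Sum.inr h) (rayParam τ) := by
  ext x
  constructor
  · intro hx
    by_cases h0 : G.param h x = 0
    · refine Or.inl fun h' hh' => ?_
      by_cases he : h' = h
      · rwa [he]
      · exact hx h' (by simp [he, hh'])
    · obtain ⟨τ, hτ⟩ := exists_rayParam h0
      refine Or.inr ⟨τ, ?_⟩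
      simp only
      rw [hτ]
      exact (G.eq_edgePath_of_param_ne_zero h0).symm
  · rintro (hx | ⟨τ, rfl⟩) h' hh'
    · exact hx h' fun h => hh' (Finset.mem_insert_of_mem h)
    · have : h ≠ h' := fun he => hh' (he ▸ Finset.mem_insert_self _ _)
      simp [this]

theorem edgePath_zero_mem_partialReal (J : Finset G.Hh) (h : G.Hh) :
    G.completedMG.edgePath (Sum.inr h) 0 ∈ G.partialReal J := fun h' _ => by simp

theorem edgePath_injective (h : G.Hh) :
    (G.completedMG.edgePath (Sum.inr h)).Injective :=
  Function.LeftInverse.injective (g := G.param h) fun t => by simp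

theorem nonempty_homeomorph_compl_partialReal {Y : Type} [TopologicalSpace Y] [CompactSpace Y]
    [T2Space Y] (hY : LocPlanar Y) {φ : G.completedMG.Real → Y} (hφ : IsEmbedding φ)
    (J : Finset G.Hh) :
    Nonempty (((φ '' G.partialReal ∅)ᶜ : Set Y) ≃ₜ ((φ '' G.partialReal J)ᶜ : Set Y)) := by
  have := hY.secondCountable
  have : T2Space G.completedMG.Real := hφ.t2Space
  have hφc := hφ.continuous.isClosedEmbedding hφ.injective
  induction J using Finset.induction_on with
  | empty => exact ⟨Homeomorph.refl _⟩
  | insert h J hh ih =>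
    obtain ⟨e⟩ := ih
    let ε := G.completedMG.edgePath (Sum.inr h)
    have hε : IsClosedEmbedding ε :=
      (G.completedMG.continuous_edgePath _).isClosedEmbedding (G.edgePath_injective h)
    let A : ℝ≥0 → Y := fun τ => φ (ε (rayParam τ))
    have hA : IsEmbedding A := hφ.comp (hε.isEmbedding.comp isEmbedding_rayParam)
    have hnot : ∀ τ, ε (rayParam τ) ∉ G.partialReal J := fun τ hτ =>
      (rayParam_pos τ).ne' (by simpa [ε] using hτ h hh)
    have hAU : ∀ τ, A τ ∈ (φ '' G.partialReal J)ᶜ := by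
      rintro τ ⟨x, hx, hxτ⟩
      exact hnot τ (hφ.injective hxτ ▸ hx)
    obtain ⟨E⟩ := nonempty_homeomorph_diff_ray hY
      (hφc.isClosedMap _ (G.isClosed_partialReal J)).isOpen_compl hA hAU
      (F := range (φ ∘ ε)) (hφc.comp hε).isClosed_range (by
        ext y
        constructor
        · rintro ⟨τ, rfl⟩
          exact ⟨hAU τ, mem_range_self _⟩
        · rintro ⟨hy, t, rfl⟩
          by_cases ht : t = 0
          · exact absurd ⟨_, G.edgePath_zero_mem_partialReal J h, by rw [ht]; rfl⟩ hy
          · obtain ⟨τ, rfl⟩ := exists_rayParam ht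
            exact ⟨τ, rfl⟩)
    have hset : (φ '' G.partialReal J)ᶜ \ range A = (φ '' G.partialReal (insert h J))ᶜ := by
      rw [G.partialReal_insert J h, image_union, compl_union, ← range_comp]
      rfl
    exact ⟨e.trans (E.symm.trans (Homeomorph.setCongr hset))⟩

end HEG

namespace RegularEmbedding

variable {G : HEG} {S : PuncturedSurface} (φ : RegularEmbedding G S)

theorem image_partialReal_empty :
    φ.toFun '' G.partialReal ∅ = range (φ.toFun ∘ G.inclReal) := by
  rw [range_comp, G.range_inclReal]
  simp [HEG.partialReal]

theorem range_inclReal_subset : range (φ.toFun ∘ G.inclReal) ⊆ S.openPart := by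
  rintro _ ⟨x, rfl⟩
  refine ⟨mem_univ _, fun hd => ?_⟩
  obtain ⟨i, c, hc⟩ := mem_iUnion.1 hd
  have hc1 : ‖(c : Plane)‖ ≤ 1 := mem_closedBall_zero_iff.1 c.2
  rcases hc1.lt_or_eq with h | h
  · exact (φ.range_subset (mem_range_self (G.inclReal x))).2 (mem_iUnion.2 ⟨i, c, h, hc⟩)
  · have h1 : φ.toFun (G.inclReal x) ∈ S.boundary ∩ range φ.toFun :=
      ⟨mem_iUnion.2 ⟨i, c, h, hc⟩, mem_range_self _⟩
    have h2 := φ.regular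
    unfold CellEmbedding.VRegular at h2
    rw [h2] at h1
    obtain ⟨_, ⟨_, ⟨k, rfl⟩, rfl⟩, h3⟩ := h1
    have h4 : G.inclReal x ∈ range G.inclReal := mem_range_self x
    rw [← φ.emb.injective h3, G.range_inclReal] at h4
    simpa using h4 k

theorem isEmbedding_comp_inclReal : IsEmbedding (φ.toFun ∘ G.inclReal) := by
  have := S.surf.2.2.1
  exact ((φ.emb.continuous.comp G.continuous_inclReal).isClosedEmbedding
    (φ.emb.injective.comp G.inclReal_injective)).isEmbedding

theorem isTwoCell_connectedComponentIn :
    ∀ x ∈ (range (φ.toFun ∘ G.inclReal))ᶜ,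
      IsTwoCell (connectedComponentIn (range (φ.toFun ∘ G.inclReal))ᶜ x) := by
  have := S.surf.1
  have := S.surf.2.2.1
  have := G.hFin
  have := Fintype.ofFinite G.Hh
  obtain ⟨e⟩ := G.nonempty_homeomorph_compl_partialReal S.surf.locPlanar φ.emb Finset.univ
  rw [← φ.image_partialReal_empty]
  refine isTwoCell_of_homeomorph e ?_
  have h1 : φ.toFun '' G.partialReal Finset.univ = range φ.toFun := by
    simp [HEG.partialReal]
  have h2 := φ.cellular
  rw [h1, compl_eq_univ_sdiff]
  exact h2

end RegularEmbedding

theorem connectedComponentIn_diff_discs {Y : Type} [TopologicalSpace Y] {U : Set Y}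
    {ι : Type*} [Finite ι] {cap : ι → (closedBall (0 : Plane) 1 : Set Plane) → Y}
    (hcont : ∀ i, Continuous (cap i)) (hinj : ∀ i, (cap i).Injective)
    (hsub : ∀ i, range (cap i) ⊆ U)
    (hd : ∀ i j, i ≠ j → Disjoint (range (cap i)) (range (cap j))) {x : Y}
    (hx : x ∈ U \ ⋃ i, range (cap i)) (hC : IsTwoCell (connectedComponentIn U x)) :
    IsPuncturedTwoCell (connectedComponentIn (U \ ⋃ i, range (cap i)) x) := by
  have : PreconnectedSpace (closedBall (0 : Plane) 1 : Set Plane) :=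
    isPreconnected_iff_preconnectedSpace.1 (convex_closedBall _ _).isPreconnected
  set C := connectedComponentIn U x with hCdef
  let I := {i : ι // range (cap i) ⊆ C}
  obtain ⟨h1, h2⟩ := hC.diff_discs (ι := I) (cap := fun i => cap i) (fun i => hcont i)
    (fun i => hinj i) (fun i c => i.2 (mem_range_self c))
    (fun i j hij => hd i j fun h => hij (Subtype.ext h))
  have hCU : C ⊆ U := connectedComponentIn_subset U x
  have heq : C \ ⋃ i, range (cap i) = C \ ⋃ i : I, range (cap i) := by
    refine Subset.antisymm (sdiff_subset_sdiff_right
      (iUnion_subset fun i => subset_iUnion (fun i => range (cap i)) (i : ι))) ?_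
    rintro y ⟨hyC, hy⟩
    refine ⟨hyC, fun hy' => hy ?_⟩
    obtain ⟨i, hi⟩ := mem_iUnion.1 hy'
    refine mem_iUnion.2 ⟨⟨i, ?_⟩, hi⟩
    rw [hCdef, connectedComponentIn_eq hyC]
    exact (isPreconnected_range (hcont i)).subset_connectedComponentIn hi (hsub i)
  have : connectedComponentIn (U \ ⋃ i, range (cap i)) x = C \ ⋃ i : I, range (cap i) := by
    refine Subset.antisymm ?_ ?_
    · rw [← heq]
      exact fun y hy => ⟨connectedComponentIn_mono x sdiff_subset hy,
        (connectedComponentIn_subset _ x hy).2⟩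
    · refine h1.subset_connectedComponentIn ?_ ?_
      · rw [← heq]
        exact ⟨mem_connectedComponentIn hx.1, hx.2⟩
      · rw [← heq]
        exact sdiff_subset_sdiff_left hCU
  rwa [this]

end PlaneTopology

/-- Let `G` be a HEG cellularly embedded in a punctured
surface `Σ` (i.e. there is a regular embedding `φ` of its completed graph `𝒢̄`
in `Σ ∪ ∂Σ`).  Then the underlying graph `𝒢` of `G` is cellularly embedded in
the punctured surface `Σ` itself: its image lies in `Σ`, the restriction of
`φ` is an embedding, and `Σ − φ(𝒢)` is a disjoint union of 2-cells possibly
with punctures. -/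
theorem underlying_graph_cellularly_embedded_in_punctured (G : HEG)
    (S : PuncturedSurface) (φ : RegularEmbedding G S) :
    Set.range (φ.toFun ∘ G.inclReal) ⊆ S.openPart ∧
    Topology.IsEmbedding (φ.toFun ∘ G.inclReal) ∧
    ∀ x ∈ S.openPart \ Set.range (φ.toFun ∘ G.inclReal),
      IsPuncturedTwoCell
        (connectedComponentIn (S.openPart \ Set.range (φ.toFun ∘ G.inclReal)) x) := by
  refine ⟨φ.range_inclReal_subset, φ.isEmbedding_comp_inclReal, ?_⟩
  have h : S.openPart \ Set.range (φ.toFun ∘ G.inclReal) =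
      (Set.range (φ.toFun ∘ G.inclReal))ᶜ \ ⋃ i, Set.range (S.cap i) := by
    rw [PuncturedSurface.openPart, ← Set.compl_eq_univ_sdiff, Set.sdiff_eq, Set.sdiff_eq,
      Set.inter_comm]
    rfl
  rw [h]
  intro x hx
  have hsub : ∀ i, Set.range (S.cap i) ⊆ (Set.range (φ.toFun ∘ G.inclReal))ᶜ :=
    fun i y hy hy' => (φ.range_inclReal_subset hy').2 (Set.mem_iUnion.2 ⟨i, hy⟩)
  exact connectedComponentIn_diff_discs S.capCont S.capInj hsub S.capDisjoint hx
    (φ.isTwoCell_connectedComponentIn x hx.1)
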